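/- Let V = 3V_4 (three quartic forms) and R = O(V)^{SL(2,ℂ)}. Then R has a homogeneous system of parameters consisting of 6 invariants of degree 2 and 6 invariants of degree 3; it also has one consisting of 5 invariants of degree 2 and 7 invariants of degree 3. Moreover, the minimal number of algebra generators of R equals 25 (with 6 generators of degree 2, 10 of degree 3, 6 of degree 4, and 3 of degree 5). -/

import Mathlib

open MvPolynomial

noncomputable section

namespace BinInv

/-- `k`-fold partial derivative with respect to the variable `v`. -/
def pd {A : Type*} [CommSemiring A] (v : Fin 2) (k : ℕ)
    (f : MvPolynomial (Fin 2) A) : MvPolynomial (Fin 2) A :=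
  (fun g => MvPolynomial.pderiv v g)^[k] f

/-- The `p`-th transvectant of binary forms `g`, `h` of degrees `m`, `n`,
with coefficients in a commutative `ℂ`-algebra `A`. -/
def transvectant {A : Type*} [CommRing A] [Algebra ℂ A] (m n p : ℕ)
    (g h : MvPolynomial (Fin 2) A) : MvPolynomial (Fin 2) A :=
  algebraMap ℂ (MvPolynomial (Fin 2) A)
      ((((m - p).factorial * (n - p).factorial : ℕ) : ℂ) /
        (((m.factorial * n.factorial : ℕ)) : ℂ)) *
    ∑ i ∈ Finset.range (p + 1),
      algebraMap ℂ (MvPolynomial (Fin 2) A) ((-1 : ℂ) ^ i * (p.choose i : ℂ)) *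
        (pd 0 (p - i) (pd 1 i g) * pd 0 i (pd 1 (p - i) h))

variable {p : ℕ}

/-- Index type for the coefficients of a system of binary forms of degrees `n 0, …, n (p-1)`:
the space `V = V_{n 0} ⊕ … ⊕ V_{n (p-1)}` is identified with `Idx n → ℂ`. -/
abbrev Idx (n : Fin p → ℕ) : Type := Σ i : Fin p, Fin (n i + 1)

/-- The binary form of degree `n i` with coefficient vector `c`. -/
def formAt (n : Fin p → ℕ) (c : Idx n → ℂ) (i : Fin p) : MvPolynomial (Fin 2) ℂ :=
  ∑ k : Fin (n i + 1), C (c ⟨i, k⟩) * X 0 ^ (n i - (k : ℕ)) * X 1 ^ (k : ℕ)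

/-- The substitution action of `SL(2,ℂ)` on binary forms: `(g • f)(v) = f (g⁻¹ • v)`. -/
def sl2Act (g : Matrix.SpecialLinearGroup (Fin 2) ℂ) (f : MvPolynomial (Fin 2) ℂ) :
    MvPolynomial (Fin 2) ℂ :=
  aeval (fun i => ∑ j, C ((↑(g⁻¹) : Matrix (Fin 2) (Fin 2) ℂ) i j) * X j) f

/-- The coefficient of `x^(n-k) y^k` in a binary form. -/
def coeffAt (n : Fin p → ℕ) (j : Idx n) (f : MvPolynomial (Fin 2) ℂ) : ℂ :=
  MvPolynomial.coeff
    (Finsupp.single 0 (n j.1 - (j.2 : ℕ)) + Finsupp.single 1 (j.2 : ℕ)) f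

/-- The induced action of `SL(2,ℂ)` on points of `V`, in coefficient coordinates. -/
def actPt (n : Fin p → ℕ) (g : Matrix.SpecialLinearGroup (Fin 2) ℂ) (c : Idx n → ℂ) :
    Idx n → ℂ :=
  fun j => coeffAt n j (sl2Act g (formAt n c j.1))

/-- A polynomial function on `V` is invariant if it is constant on `SL(2,ℂ)`-orbits. -/
def IsInvariant (n : Fin p → ℕ) (P : MvPolynomial (Idx n) ℂ) : Prop :=
  ∀ (g : Matrix.SpecialLinearGroup (Fin 2) ℂ) (c : Idx n → ℂ),
    eval (actPt n g c) P = eval c P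

/-- The invariant ring `R = O(V)^{SL(2,ℂ)}` as a subalgebra of `O(V)`. -/
def invariantRing (n : Fin p → ℕ) : Subalgebra ℂ (MvPolynomial (Idx n) ℂ) where
  carrier := {P | IsInvariant n P}
  mul_mem' := fun ha hb g c => by
    simp only [map_mul]; rw [ha g c, hb g c]
  one_mem' := fun g c => by simp
  add_mem' := fun ha hb g c => by
    simp only [map_add]; rw [ha g c, hb g c]
  zero_mem' := fun g c => by simp
  algebraMap_mem' := fun r g c => by simp

/-- The nullcone: the points of `V` where every homogeneous invariant of positive
degree vanishes. -/
def Nullcone (n : Fin p → ℕ) : Set (Idx n → ℂ) :=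
  {c | ∀ P ∈ invariantRing n, ∀ d : ℕ, 0 < d → P.IsHomogeneous d → eval c P = 0}

/-- `P` is a homogeneous system of parameters of the invariant ring, with degrees `d`:
the `P j` are homogeneous invariants of positive degrees `d j`, algebraically independent
over `ℂ`, and the invariant ring is integral over the subalgebra they generate. -/
def IsHSOP (n : Fin p → ℕ) {k : ℕ} (P : Fin k → MvPolynomial (Idx n) ℂ)
    (d : Fin k → ℕ) : Prop :=
  (∀ j, P j ∈ invariantRing n) ∧ (∀ j, 0 < d j) ∧
    (∀ j, (P j).IsHomogeneous (d j)) ∧ AlgebraicIndependent ℂ P ∧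
    ∀ x ∈ invariantRing n, IsIntegral (↥(Algebra.adjoin ℂ (Set.range P))) x

/-- `r` is the minimal number of generators of the invariant ring. -/
def IsMinimalNumGens (n : Fin p → ℕ) (r : ℕ) : Prop :=
  IsLeast {k | ∃ S : Finset (MvPolynomial (Idx n) ℂ),
    S.card = k ∧ Algebra.adjoin ℂ (S : Set (MvPolynomial (Idx n) ℂ)) = invariantRing n} r

/-- The invariant ring has minimal number of generators `r`, realized by a minimal
system of homogeneous generators of degrees `d 0, …, d (r-1)`. -/
def HasMinimalGens (n : Fin p → ℕ) {r : ℕ} (d : Fin r → ℕ) : Prop :=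
  IsMinimalNumGens n r ∧
    ∃ G : Fin r → MvPolynomial (Idx n) ℂ, Function.Injective G ∧
      (∀ j, (G j).IsHomogeneous (d j)) ∧
      Algebra.adjoin ℂ (Set.range G) = invariantRing n

/-- The generic binary form of degree `n i`, whose coefficients are the corresponding
coordinate functions on `V`. -/
def genForm (n : Fin p → ℕ) (i : Fin p) :
    MvPolynomial (Fin 2) (MvPolynomial (Idx n) ℂ) :=
  ∑ k : Fin (n i + 1), C (X ⟨i, k⟩) * X 0 ^ (n i - (k : ℕ)) * X 1 ^ (k : ℕ)

end BinInv

end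

noncomputable section

namespace ThreeQuartics

section Sl2

variable {M M' : Type*} [AddCommGroup M] [Module ℂ M] [AddCommGroup M'] [Module ℂ M']

/-- The commutation relations of the standard basis of `𝔰𝔩₂`. -/
structure IsSl2 (E F H : M →ₗ[ℂ] M) : Prop where
  comm_EF : ∀ v, E (F v) = F (E v) + H v
  comm_HE : ∀ v, H (E v) = E (H v) + (2 : ℂ) • E v

/-- The coefficients `(-1)^k / (k! (k+1)!)` of the extremal projector on weight zero. -/
def extCoeff (k : ℕ) : ℂ := (-1) ^ k / (k.factorial * (k + 1).factorial)

lemma extCoeff_succ (k : ℕ) :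
    extCoeff (k + 1) * ((k + 1 : ℂ) * (k + 2)) = - extCoeff k := by
  have h1 : (k.factorial : ℂ) ≠ 0 := by exact_mod_cast k.factorial_ne_zero
  have h2 : (k + 1 : ℂ) ≠ 0 := by exact_mod_cast k.succ_ne_zero
  have h3 : (k + 1 + 1 : ℂ) ≠ 0 := by exact_mod_cast (k + 1).succ_ne_zero
  simp only [extCoeff, Nat.factorial_succ, pow_succ]
  push_cast
  field_simp
  ring

/-- The truncated extremal projector, acting on vectors of weight zero. -/
def reyn (E F : M →ₗ[ℂ] M) (N : ℕ) : M →ₗ[ℂ] M :=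
  ∑ k ∈ Finset.range N, extCoeff k • (F ^ k * E ^ k)

lemma reyn_apply (E F : M →ₗ[ℂ] M) (N : ℕ) (v : M) :
    reyn E F N v = ∑ k ∈ Finset.range N, extCoeff k • (F ^ k) ((E ^ k) v) := by
  simp [reyn, LinearMap.sum_apply]

lemma reyn_succ (E F : M →ₗ[ℂ] M) (N : ℕ) (v : M) :
    reyn E F (N + 1) v = reyn E F N v + extCoeff N • (F ^ N) ((E ^ N) v) := by
  simp [reyn_apply, Finset.sum_range_succ]

lemma reyn_of_killed (E F : M →ₗ[ℂ] M) {v : M} (hv : E v = 0) (N : ℕ) :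
    reyn E F (N + 1) v = v := by
  rw [reyn_apply, Finset.sum_range_succ']
  simp [pow_succ, hv, extCoeff]

lemma map_reyn {E F : M →ₗ[ℂ] M} {E' F' : M' →ₗ[ℂ] M'} (φ : M →ₗ[ℂ] M')
    (hE : ∀ v, φ (E v) = E' (φ v)) (hF : ∀ v, φ (F v) = F' (φ v)) (N : ℕ) (v : M) :
    φ (reyn E F N v) = reyn E' F' N (φ v) := by
  have hE' : ∀ k v, φ ((E ^ k) v) = (E' ^ k) (φ v) := by
    intro k
    induction k with
    | zero => simp
    | succ k ih => intro v; simp [pow_succ, ih, hE]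
  have hF' : ∀ k v, φ ((F ^ k) v) = (F' ^ k) (φ v) := by
    intro k
    induction k with
    | zero => simp
    | succ k ih => intro v; simp [pow_succ, ih, hF]
  simp [reyn_apply, hE', hF']

lemma IsSl2.H_E_pow {E F H : M →ₗ[ℂ] M} (h : IsSl2 E F H) {v : M} {c : ℂ}
    (hv : H v = c • v) (k : ℕ) : H ((E ^ k) v) = (c + 2 * k) • (E ^ k) v := by
  induction k with
  | zero => simp [hv]
  | succ k ih =>
    rw [pow_succ', Module.End.mul_apply, h.comm_HE, ih, map_smul, ← add_smul]
    push_cast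
    congr 1
    ring

lemma IsSl2.E_pow_F {E F H : M →ₗ[ℂ] M} (h : IsSl2 E F H) {g : M}
    (hg : H g = (2 : ℂ) • g) (k : ℕ) :
    (E ^ (k + 1)) (F g) = F ((E ^ (k + 1)) g) + ((k + 1 : ℂ) * (k + 2)) • (E ^ k) g := by
  induction k with
  | zero => simp [h.comm_EF, hg]
  | succ k ih =>
    have hE' : E ((E ^ k) g) = (E ^ (k + 1)) g := by rw [pow_succ', Module.End.mul_apply]
    rw [pow_succ' _ (k + 1), Module.End.mul_apply, ih, map_add, h.comm_EF, map_smul,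
      h.H_E_pow hg, add_assoc, hE', ← Module.End.mul_apply E,
      ← add_smul]
    push_cast
    congr 2
    ring

lemma IsSl2.reyn_F_succ {E F H : M →ₗ[ℂ] M} (h : IsSl2 E F H) {g : M}
    (hg : H g = (2 : ℂ) • g) (N : ℕ) :
    reyn E F (N + 1) (F g) = extCoeff N • (F ^ (N + 1)) ((E ^ N) g) := by
  induction N with
  | zero => simp [reyn_apply]
  | succ N ih =>
    rw [reyn_succ, ih, h.E_pow_F hg, map_add, map_smul, smul_add, smul_smul, extCoeff_succ,
      ← Module.End.mul_apply (F ^ (N + 1)) F, ← pow_succ]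
    simp

/-- The extremal projector kills the image of `F`. -/
lemma IsSl2.reyn_F {E F H : M →ₗ[ℂ] M} (h : IsSl2 E F H) {g : M}
    (hg : H g = (2 : ℂ) • g) {n : ℕ} (hn : (E ^ n) g = 0) {N : ℕ} (hN : n < N) :
    reyn E F N (F g) = 0 := by
  obtain ⟨m, rfl⟩ := Nat.exists_eq_add_of_lt hN
  rw [h.reyn_F_succ hg, add_comm n m, pow_add E, Module.End.mul_apply, hn]
  simp

/-- `f` is mapped into `S` by all sufficiently long extremal projectors. -/
def Good (E F : M →ₗ[ℂ] M) (S : Set M) (f : M) : Prop := ∃ N₀, ∀ N ≥ N₀, reyn E F N f ∈ S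

lemma Good.map {E F : M →ₗ[ℂ] M} {E' F' : M' →ₗ[ℂ] M'} (φ : M →ₗ[ℂ] M')
    (hE : ∀ v, φ (E v) = E' (φ v)) (hF : ∀ v, φ (F v) = F' (φ v))
    {S : Set M} {T : Set M'} {f : M} (h : Good E F S f) (hST : Set.MapsTo φ S T) :
    Good E' F' T (φ f) :=
  h.imp fun _ h N hN => by rw [← map_reyn φ hE hF]; exact hST (h N hN)

lemma Good.smul {E F : M →ₗ[ℂ] M} {S : Submodule ℂ M} {f : M} (h : Good E F S f) (c : ℂ) :
    Good E F S (c • f) :=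
  h.imp fun _ h N hN => by rw [map_smul]; exact S.smul_mem c (h N hN)

lemma Good.of_smul {E F : M →ₗ[ℂ] M} {S : Submodule ℂ M} {f : M} {c : ℂ} (hc : c ≠ 0)
    (h : Good E F S (c • f)) : Good E F S f := by
  have := h.smul c⁻¹
  rwa [smul_smul, inv_mul_cancel₀ hc, one_smul] at this

lemma Good.sum {ι : Type*} {E F : M →ₗ[ℂ] M} {S : Submodule ℂ M} (s : Finset ι) (f : ι → M)
    (h : ∀ i ∈ s, Good E F S (f i)) : Good E F S (∑ i ∈ s, f i) := by
  classical
  induction s using Finset.induction_on with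
  | empty => exact ⟨0, fun N _ => by simp⟩
  | insert a s ha ih =>
    obtain ⟨N₁, h₁⟩ := ih fun i hi => h i (Finset.mem_insert_of_mem hi)
    obtain ⟨N₂, h₂⟩ := h a (Finset.mem_insert_self a s)
    refine ⟨max N₁ N₂, fun N hN => ?_⟩
    rw [Finset.sum_insert ha, map_add]
    exact S.add_mem (h₂ N (le_trans (le_max_right _ _) hN)) (h₁ N (le_trans (le_max_left _ _) hN))

end Sl2

section Derivations

variable {σ : Type*} {B : Type*} [CommRing B] [Algebra ℂ B]

lemma algHom_derivation_comm (φ : MvPolynomial σ ℂ →ₐ[ℂ] B)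
    (D : Derivation ℂ (MvPolynomial σ ℂ) (MvPolynomial σ ℂ)) (D' : Derivation ℂ B B)
    (h : ∀ i, φ (D (X i)) = D' (φ (X i))) (f : MvPolynomial σ ℂ) : φ (D f) = D' (φ f) := by
  induction f using MvPolynomial.induction_on with
  | C a =>
    have h1 : (C a : MvPolynomial σ ℂ) = algebraMap ℂ _ a := rfl
    rw [h1, Derivation.map_algebraMap, AlgHom.commutes, Derivation.map_algebraMap, map_zero]
  | add p q hp hq => simp [hp, hq]
  | mul_X p i hp => simp [hp, h]

lemma isSl2_of_generators {E F H : Derivation ℂ (MvPolynomial σ ℂ) (MvPolynomial σ ℂ)}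
    (h₁ : ∀ i, E (F (X i)) = F (E (X i)) + H (X i))
    (h₂ : ∀ i, H (E (X i)) = E (H (X i)) + (2 : ℂ) • E (X i)) :
    IsSl2 (E : MvPolynomial σ ℂ →ₗ[ℂ] MvPolynomial σ ℂ) F H := by
  constructor
  · intro v
    have : ⁅E, F⁆ = H := MvPolynomial.derivation_ext fun i => by
      rw [Derivation.commutator_apply, h₁]; ring
    have := congrArg (fun D => D v) this
    simp only [Derivation.commutator_apply] at this
    simp only [Derivation.coeFn_coe, ← this]; ring
  · intro v
    have : ⁅H, E⁆ = (2 : ℂ) • E := MvPolynomial.derivation_ext fun i => by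
      rw [Derivation.commutator_apply, h₂]; simp
    have := congrArg (fun D => D v) this
    simp only [Derivation.commutator_apply, Derivation.smul_apply] at this
    simp only [Derivation.coeFn_coe, ← this]; ring

lemma derivation_pow_mul_eq_zero (D : Derivation ℂ B B) (n : ℕ) :
    ∀ (a b : ℕ) (f g : B), a + b = n → ((D : B →ₗ[ℂ] B) ^ a) f = 0 →
      ((D : B →ₗ[ℂ] B) ^ b) g = 0 → ((D : B →ₗ[ℂ] B) ^ n) (f * g) = 0 := by
  induction n with
  | zero =>
    intro a b f g h hf hg
    obtain ⟨rfl, rfl⟩ : a = 0 ∧ b = 0 := by omega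
    have : f = 0 := by simpa using hf
    simp [this]
  | succ n ih =>
    intro a b f g h hf hg
    rcases a with - | a
    · have : f = 0 := by simpa using hf
      simp [this]
    rcases b with - | b
    · have : g = 0 := by simpa using hg
      simp [this]
    rw [pow_succ, Module.End.mul_apply, Derivation.coeFn_coe, Derivation.leibniz, map_add,
      smul_eq_mul, smul_eq_mul,
      ih (a + 1) b f (D g) (by omega) hf (by rwa [pow_succ, Module.End.mul_apply] at hg),
      ih (b + 1) a g (D f) (by omega) hg (by rwa [pow_succ, Module.End.mul_apply] at hf), add_zero]

lemma derivation_locally_nilpotent (D : Derivation ℂ (MvPolynomial σ ℂ) (MvPolynomial σ ℂ))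
    (h : ∀ i, ∃ n, ((D : MvPolynomial σ ℂ →ₗ[ℂ] MvPolynomial σ ℂ) ^ n) (X i) = 0)
    (f : MvPolynomial σ ℂ) :
    ∃ n, ((D : MvPolynomial σ ℂ →ₗ[ℂ] MvPolynomial σ ℂ) ^ n) f = 0 := by
  induction f using MvPolynomial.induction_on with
  | C a =>
    refine ⟨1, ?_⟩
    have h1 : (C a : MvPolynomial σ ℂ) = algebraMap ℂ _ a := rfl
    rw [h1, pow_one, Derivation.coeFn_coe, Derivation.map_algebraMap]
  | add p q hp hq =>
    obtain ⟨n, hn⟩ := hp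
    obtain ⟨m, hm⟩ := hq
    refine ⟨n + m, ?_⟩
    rw [map_add]
    conv_lhs =>
      enter [2]
      rw [pow_add, Module.End.mul_apply, hm]
    rw [add_comm n m, pow_add, Module.End.mul_apply, hn]
    simp
  | mul_X p i hp =>
    obtain ⟨n, hn⟩ := hp
    obtain ⟨m, hm⟩ := h i
    exact ⟨n + m, derivation_pow_mul_eq_zero D _ n m _ _ rfl hn hm⟩

end Derivations

section Spinors

variable {M : ℕ}

/-- The ring of polynomial functions of `M` vectors in the plane. -/
abbrev SpinRing (M : ℕ) := MvPolynomial (Fin M × Fin 2) ℂ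

/-- The raising operator on `SpinRing M`. -/
def spinE (M : ℕ) : Derivation ℂ (SpinRing M) (SpinRing M) :=
  ∑ j, (X (j, 0) : SpinRing M) • pderiv (j, 1)

/-- The lowering operator on `SpinRing M`. -/
def spinF (M : ℕ) : Derivation ℂ (SpinRing M) (SpinRing M) :=
  ∑ j, (X (j, 1) : SpinRing M) • pderiv (j, 0)

/-- The weight operator on `SpinRing M`. -/
def spinH (M : ℕ) : Derivation ℂ (SpinRing M) (SpinRing M) :=
  ∑ j, ((X (j, 0) : SpinRing M) • pderiv (j, 0) - (X (j, 1) : SpinRing M) • pderiv (j, 1))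

lemma derivation_sum_apply {ι A : Type*} [CommRing A] [Algebra ℂ A] (s : Finset ι)
    (D : ι → Derivation ℂ A A) (f : A) : (∑ i ∈ s, D i) f = ∑ i ∈ s, D i f := by
  classical
  induction s using Finset.induction_on with
  | empty => simp
  | insert a s ha ih => simp [Finset.sum_insert ha, ih]

lemma spinE_apply (f : SpinRing M) : spinE M f = ∑ j, X (j, 0) * pderiv (j, 1) f := by
  simp [spinE, derivation_sum_apply]

lemma spinF_apply (f : SpinRing M) : spinF M f = ∑ j, X (j, 1) * pderiv (j, 0) f := by
  simp [spinF, derivation_sum_apply]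

lemma spinH_apply (f : SpinRing M) :
    spinH M f = ∑ j, X (j, 0) * pderiv (j, 0) f - ∑ j, X (j, 1) * pderiv (j, 1) f := by
  simp [spinH, derivation_sum_apply]

lemma spinE_X (j : Fin M) (k : Fin 2) :
    spinE M (X (j, k)) = if k = 1 then X (j, 0) else 0 := by
  fin_cases k <;> simp [spinE_apply, pderiv_X, Pi.single_apply, Prod.ext_iff]

lemma spinF_X (j : Fin M) (k : Fin 2) :
    spinF M (X (j, k)) = if k = 0 then X (j, 1) else 0 := by
  fin_cases k <;> simp [spinF_apply, pderiv_X, Pi.single_apply, Prod.ext_iff]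

lemma spinH_X (j : Fin M) (k : Fin 2) :
    spinH M (X (j, k)) = if k = 0 then X (j, 0) else - X (j, 1) := by
  fin_cases k <;> simp [spinH_apply, pderiv_X, Pi.single_apply, Prod.ext_iff]

lemma spin_isSl2 : IsSl2 (spinE M : SpinRing M →ₗ[ℂ] SpinRing M) (spinF M) (spinH M) := by
  apply isSl2_of_generators
  · rintro ⟨j, k⟩
    fin_cases k <;> simp [spinE_X, spinF_X, spinH_X]
  · rintro ⟨j, k⟩
    fin_cases k <;> simp [spinE_X, spinH_X, two_smul]

lemma spinE_nilpotent (f : SpinRing M) :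
    ∃ n, ((spinE M : SpinRing M →ₗ[ℂ] SpinRing M) ^ n) f = 0 := by
  apply derivation_locally_nilpotent
  rintro ⟨j, k⟩
  refine ⟨2, ?_⟩
  fin_cases k <;> simp [pow_succ, spinE_X]

/-- The bracket `[ij]`. -/
def brk (i j : Fin M) : SpinRing M := X (i, 0) * X (j, 1) - X (i, 1) * X (j, 0)

lemma spinE_brk (i j : Fin M) : spinE M (brk i j) = 0 := by
  simp [brk, spinE_X]; ring

lemma spinF_brk (i j : Fin M) : spinF M (brk i j) = 0 := by
  simp [brk, spinF_X]; ring

/-- The weights counting the degree in the `k`-th coordinates. -/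
def spinWt (k : Fin 2) (v : Fin M × Fin 2) : ℕ := if v.2 = k then 1 else 0

lemma euler_spin {k : Fin 2} {n : ℕ} {f : SpinRing M}
    (h : f.IsWeightedHomogeneous (spinWt k) n) : ∑ j, X (j, k) * pderiv (j, k) f = n • f := by
  rw [← h.sum_weight_X_mul_pderiv, Fintype.sum_prod_type]
  refine Finset.sum_congr rfl fun j _ => ?_
  fin_cases k <;> simp [spinWt]

lemma capelli {n : ℕ} {f : SpinRing M} (h₀ : f.IsWeightedHomogeneous (spinWt 0) n)
    (h₁ : f.IsWeightedHomogeneous (spinWt 1) n) :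
    spinF M (spinE M f) =
      (n + n ^ 2 : ℂ) • f - ∑ i, ∑ j, brk i j * pderiv (i, 0) (pderiv (j, 1) f) := by
  have hFE : spinF M (spinE M f) = ∑ i, X (i, 1) * pderiv (i, 1) f
      + ∑ i, ∑ j, X (i, 1) * X (j, 0) * pderiv (i, 0) (pderiv (j, 1) f) := by
    rw [spinE_apply, spinF_apply, ← Finset.sum_add_distrib]
    refine Finset.sum_congr rfl fun i _ => ?_
    rw [map_sum]
    simp only [Derivation.leibniz, smul_eq_mul, pderiv_X, Finset.sum_add_distrib]
    have : ∑ j, pderiv (j, 1) f * (Pi.single (i, 0) 1 : Fin M × Fin 2 → SpinRing M) (j, 0)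
        = pderiv (i, 1) f := by
      simp [Pi.single_apply, Prod.ext_iff]
    rw [this, mul_add, add_comm, Finset.mul_sum]
    simp only [mul_assoc]
  have hXY : ∑ i, X (i, 0) * pderiv (i, 0) (∑ j, X (j, 1) * pderiv (j, 1) f)
      = ∑ i, ∑ j, X (i, 0) * X (j, 1) * pderiv (i, 0) (pderiv (j, 1) f) := by
    refine Finset.sum_congr rfl fun i _ => ?_
    rw [map_sum, Finset.mul_sum]
    refine Finset.sum_congr rfl fun j _ => ?_
    rw [Derivation.leibniz, pderiv_X_of_ne (by simp)]
    simp [mul_assoc]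
  rw [euler_spin h₁] at hXY
  have h2 : ∑ i, X (i, 0) * pderiv (i, 0) (n • f) = (n ^ 2 : ℂ) • f := by
    simp only [map_nsmul, mul_smul_comm]
    rw [← Finset.smul_sum, euler_spin h₀, smul_smul, ← Nat.cast_smul_eq_nsmul ℂ, sq]
    push_cast
    rfl
  rw [h2] at hXY
  rw [hFE, euler_spin h₁, add_smul, hXY, Nat.cast_smul_eq_nsmul, add_sub_assoc,
    ← Finset.sum_sub_distrib]
  congr 1
  refine Finset.sum_congr rfl fun i _ => ?_
  rw [← Finset.sum_sub_distrib]
  refine Finset.sum_congr rfl fun j _ => ?_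
  rw [brk]
  ring

lemma spin_good (n : ℕ) : ∀ f : SpinRing M, f.IsWeightedHomogeneous (spinWt 0) n →
    f.IsWeightedHomogeneous (spinWt 1) n →
    Good (spinE M : SpinRing M →ₗ[ℂ] SpinRing M) (spinF M)
      (Subalgebra.toSubmodule
        (Algebra.adjoin ℂ (Set.range fun p : Fin M × Fin M => brk p.1 p.2))) f := by
  induction n with
  | zero =>
    intro f h₀ h₁
    have hf : f = algebraMap ℂ _ (coeff 0 f) := by
      ext d
      rw [algebraMap_eq, coeff_C]
      split_ifs with hd
      · rw [hd]
      · by_contra hne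
        apply hd
        have e0 := h₀ hne
        have e1 := h₁ hne
        ext v
        rw [Finsupp.weight_apply, Finsupp.sum_fintype _ _ (by simp), Finset.sum_eq_zero_iff]
          at e0 e1
        have e0 := e0 v (Finset.mem_univ v)
        have e1 := e1 v (Finset.mem_univ v)
        obtain ⟨j, k⟩ := v
        fin_cases k
        · simpa [spinWt] using e0.symm
        · simpa [spinWt] using e1.symm
    refine ⟨1, fun N hN => ?_⟩
    obtain ⟨N, rfl⟩ := Nat.exists_eq_add_of_le' hN
    rw [reyn_of_killed]
    · rw [hf]
      exact Subalgebra.algebraMap_mem _ _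
    · rw [hf, Derivation.coeFn_coe, Derivation.map_algebraMap]
  | succ n ih =>
    intro f h₀ h₁
    have hH : spinH M (spinE M f) = (2 : ℂ) • spinE M f := by
      have := spin_isSl2.comm_HE f
      simp only [Derivation.coeFn_coe] at this
      rw [this, spinH_apply, euler_spin h₀, euler_spin h₁]
      simp
    have hbrk : ∀ i j N, reyn (spinE M : SpinRing M →ₗ[ℂ] SpinRing M) (spinF M) N
        (brk i j * pderiv (i, 0) (pderiv (j, 1) f)) =
        brk i j * reyn (spinE M : SpinRing M →ₗ[ℂ] SpinRing M) (spinF M) N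
          (pderiv (i, 0) (pderiv (j, 1) f)) := by
      intro i j N
      refine (map_reyn (LinearMap.mulLeft ℂ (brk i j)) ?_ ?_ N _).symm
      · intro v; simp [spinE_brk]
      · intro v; simp [spinF_brk]
    have hder : Good (spinE M : SpinRing M →ₗ[ℂ] SpinRing M) (spinF M)
        (Subalgebra.toSubmodule
          (Algebra.adjoin ℂ (Set.range fun p : Fin M × Fin M => brk p.1 p.2)))
        (∑ i, ∑ j, brk i j * pderiv (i, 0) (pderiv (j, 1) f)) := by
      refine Good.sum _ _ fun i _ => Good.sum _ _ fun j _ => ?_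
      obtain ⟨N₀, h⟩ := ih (pderiv (i, 0) (pderiv (j, 1) f))
        ((h₀.pderiv (n' := n + 1) (by simp [spinWt])).pderiv (by simp [spinWt]))
        ((h₁.pderiv (n' := n) (by simp [spinWt])).pderiv (by simp [spinWt]))
      refine ⟨N₀, fun N hN => ?_⟩
      rw [hbrk]
      exact Subalgebra.mul_mem _ (Algebra.subset_adjoin ⟨(i, j), rfl⟩) (h N hN)
    obtain ⟨N₁, hN₁⟩ := hder
    obtain ⟨m, hm⟩ := spinE_nilpotent (spinE M f)
    have hc : ((n + 1 : ℕ) + (n + 1 : ℕ) ^ 2 : ℂ) ≠ 0 := by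
      have : 0 < (n + 1) + (n + 1) ^ 2 := by positivity
      exact_mod_cast this.ne'
    refine Good.of_smul hc ⟨max N₁ (m + 1), fun N hN => ?_⟩
    have key := congrArg (reyn (spinE M : SpinRing M →ₗ[ℂ] SpinRing M) (spinF M) N)
      (eq_add_of_sub_eq (capelli h₀ h₁).symm)
    have h0 := spin_isSl2.reyn_F hH hm (N := N) (by omega)
    simp only [Derivation.coeFn_coe] at h0
    rw [key, map_add, h0, zero_add]
    exact hN₁ N (le_trans (le_max_left _ _) hN)

end Spinors

section Contraction

open Matrix

variable {n V R : Type*} [Fintype n] [CommRing R]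

/-- The alternating words `J S_{v₁} J ⋯ S_{v_k} J`. -/
def altWord (J : Matrix n n R) (S : V → Matrix n n R) : List V → Matrix n n R
  | [] => J
  | v :: l => J * S v * altWord J S l

lemma altWord_append (J : Matrix n n R) (S : V → Matrix n n R) (l m : List V) (v : V) :
    altWord J S (l ++ v :: m) = altWord J S l * S v * altWord J S m := by
  induction l with
  | nil => rfl
  | cons a l ih => simp only [List.cons_append, altWord, ih, Matrix.mul_assoc]

variable [Algebra ℂ R]

/-- The bilinear covariants `ξ_sᵀ J S_{v₁} J ⋯ S_{v_k} J ξ_t`. -/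
def bil (J : Matrix n n R) (S : V → Matrix n n R) (ξ : ℕ → n → R) (s : ℕ) (l : List V) (t : ℕ) :
    R := ξ s ⬝ᵥ (altWord J S l *ᵥ ξ t)

/-- The algebra generated by all traces of words and all bilinear covariants. -/
def bilAlg (J : Matrix n n R) (S : V → Matrix n n R) (ξ : ℕ → n → R) : Subalgebra ℂ R :=
  Algebra.adjoin ℂ ((Set.range fun p : V × List V => trace (S p.1 * altWord J S p.2)) ∪
    Set.range fun p : ℕ × List V × ℕ => bil J S ξ p.1 p.2.1 p.2.2)

variable {J : Matrix n n R} {S : V → Matrix n n R} {ξ : ℕ → n → R}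

lemma trace_mem_bilAlg (v : V) (l : List V) : trace (S v * altWord J S l) ∈ bilAlg J S ξ :=
  Algebra.subset_adjoin (Or.inl ⟨(v, l), rfl⟩)

lemma bil_mem_bilAlg (s : ℕ) (l : List V) (t : ℕ) : bil J S ξ s l t ∈ bilAlg J S ξ :=
  Algebra.subset_adjoin (Or.inr ⟨(s, l, t), rfl⟩)

lemma altWord_transpose {κ : ℂ} (hJ : Jᵀ = κ • J) (hS : ∀ v, (S v)ᵀ = S v) (l : List V) :
    (altWord J S l)ᵀ = κ ^ (l.length + 1) • altWord J S l.reverse := by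
  induction l with
  | nil => simp [altWord, hJ]
  | cons v l ih =>
    rw [List.reverse_cons, altWord_append, altWord, altWord, transpose_mul, transpose_mul, ih, hS,
      hJ, List.length_cons, Matrix.smul_mul, Matrix.mul_smul, Matrix.mul_smul, smul_smul,
      Matrix.mul_assoc, ← pow_succ]

/-- The second order operator contracting `S_v` with the partial derivatives in a slot. -/
def contract (S : V → Matrix n n R) (D : n → Derivation ℂ R R) (v : V) : R →ₗ[ℂ] R :=
  ∑ i, ∑ j, LinearMap.mulLeft ℂ (S v i j) ∘ₗ (D i : R →ₗ[ℂ] R) ∘ₗ (D j : R →ₗ[ℂ] R)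

lemma contract_apply (D : n → Derivation ℂ R R) (v : V) (f : R) :
    contract S D v f = ∑ i, ∑ j, S v i j * D i (D j f) := by
  simp [contract]

/-- The polarised symbol of `contract`. -/
def gam (S : V → Matrix n n R) (D : n → Derivation ℂ R R) (v : V) (f g : R) : R :=
  (fun i => D i f) ⬝ᵥ (S v *ᵥ fun j => D j g)

lemma gam_comm (hS : ∀ v, (S v)ᵀ = S v) (D : n → Derivation ℂ R R) (v : V) (f g : R) :
    gam S D v f g = gam S D v g f := by
  rw [gam, gam, dotProduct_mulVec, dotProduct_comm, ← mulVec_transpose, hS]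

lemma contract_mul (hS : ∀ v, (S v)ᵀ = S v) (D : n → Derivation ℂ R R) (v : V) (f g : R) :
    contract S D v (f * g) =
      f * contract S D v g + g * contract S D v f + (gam S D v f g + gam S D v f g) := by
  conv_rhs =>
    enter [2, 2]
    rw [gam_comm hS]
  simp only [contract_apply, gam, dotProduct, mulVec, Finset.mul_sum, ← Finset.sum_add_distrib]
  refine Finset.sum_congr rfl fun i _ => Finset.sum_congr rfl fun j _ => ?_
  simp only [Derivation.leibniz, smul_eq_mul, map_add]
  ring

variable [DecidableEq n]

/-- Everything the contraction operators need to know about the partial derivatives in slot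
`r`. -/
structure IsSlot (J : Matrix n n R) (S : V → Matrix n n R) (ξ : ℕ → n → R) (r : ℕ)
    (D : n → Derivation ℂ R R) : Prop where
  map_J : ∀ i j k, D i (J j k) = 0
  map_S : ∀ v i j k, D i (S v j k) = 0
  map_ξ : ∀ s i j, D i (ξ s j) = if s = r ∧ i = j then 1 else 0

variable {r : ℕ} {D : n → Derivation ℂ R R} {κ : ℂ}

lemma IsSlot.map_altWord (h : IsSlot J S ξ r D) (l : List V) (i j k : n) :
    D i (altWord J S l j k) = 0 := by
  induction l generalizing j k with
  | nil => exact h.map_J i j k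
  | cons v l ih => simp [altWord, Matrix.mul_apply, Finset.sum_mul, h.map_J, h.map_S, ih]

lemma IsSlot.map_trace (h : IsSlot J S ξ r D) (v : V) (l : List V) (i : n) :
    D i (trace (S v * altWord J S l)) = 0 := by
  simp [trace, Matrix.mul_apply, h.map_S, h.map_altWord]

lemma IsSlot.map_mulVec (h : IsSlot J S ξ r D) (l : List V) (t : ℕ) (i k : n) :
    D i ((altWord J S l *ᵥ ξ t) k) = if t = r then altWord J S l k i else 0 := by
  simp only [mulVec, dotProduct, map_sum, Derivation.leibniz, smul_eq_mul, h.map_altWord,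
    mul_zero, add_zero, h.map_ξ]
  split_ifs with ht <;> simp [ht]

lemma IsSlot.map_bil (h : IsSlot J S ξ r D) (hJ : Jᵀ = κ • J) (hS : ∀ v, (S v)ᵀ = S v)
    (s : ℕ) (l : List V) (t : ℕ) (i : n) :
    D i (bil J S ξ s l t) = ((if s = r then 1 else 0 : ℂ) • (altWord J S l *ᵥ ξ t) +
      (if t = r then κ ^ (l.length + 1) else 0 : ℂ) • (altWord J S l.reverse *ᵥ ξ s)) i := by
  rw [bil, dotProduct, map_sum]
  simp only [Derivation.leibniz, smul_eq_mul, h.map_mulVec, h.map_ξ, Finset.sum_add_distrib]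
  rw [add_comm]
  congr 1
  · by_cases hs : s = r <;> simp [hs]
  · by_cases ht : t = r
    · simp only [ht, if_true]
      have := altWord_transpose hJ hS l
      have h2 : ∀ x, altWord J S l x i = (κ ^ (l.length + 1) • altWord J S l.reverse) i x := by
        intro x; rw [← this]; rfl
      simp only [h2, mulVec, dotProduct, Pi.smul_apply, Matrix.smul_apply, Finset.smul_sum]
      refine Finset.sum_congr rfl fun x _ => ?_
      rw [mul_comm, smul_mul_assoc]
    · simp [ht]

lemma gam_vec_mem (hJ : Jᵀ = κ • J) (hS : ∀ v, (S v)ᵀ = S v) (v : V) (l m : List V) (s t : ℕ) :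
    (altWord J S l *ᵥ ξ s) ⬝ᵥ (S v *ᵥ (altWord J S m *ᵥ ξ t)) ∈ bilAlg J S ξ := by
  have : (altWord J S l *ᵥ ξ s) ⬝ᵥ (S v *ᵥ (altWord J S m *ᵥ ξ t)) =
      κ ^ (l.length + 1) • bil J S ξ s (l.reverse ++ v :: m) t := by
    rw [bil, altWord_append, mulVec_mulVec, dotProduct_comm, dotProduct_mulVec,
      dotProduct_comm, ← mulVec_transpose, altWord_transpose hJ hS, mulVec_mulVec]
    simp [Matrix.mul_assoc, smul_mulVec, dotProduct_smul]
  rw [this]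
  exact Subalgebra.smul_mem _ (bil_mem_bilAlg _ _ _) _

lemma IsSlot.gam_mem (h : IsSlot J S ξ r D) (hJ : Jᵀ = κ • J) (hS : ∀ v, (S v)ᵀ = S v) (v : V)
    {f g : R} (hf : f ∈ bilAlg J S ξ) (hg : g ∈ bilAlg J S ξ) :
    gam S D v f g ∈ bilAlg J S ξ := by
  have gam_mul : ∀ f g g', gam S D v f (g * g') = g * gam S D v f g' + g' * gam S D v f g := by
    intro f g g'
    simp only [gam, dotProduct, mulVec, Finset.mul_sum, ← Finset.sum_add_distrib]
    refine Finset.sum_congr rfl fun i _ => Finset.sum_congr rfl fun j _ => ?_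
    simp only [Derivation.leibniz, smul_eq_mul]
    ring
  have gam_add : ∀ f g g', gam S D v f (g + g') = gam S D v f g + gam S D v f g' := by
    intro f g g'
    simp only [gam, dotProduct, mulVec, Finset.mul_sum, ← Finset.sum_add_distrib]
    refine Finset.sum_congr rfl fun i _ => Finset.sum_congr rfl fun j _ => ?_
    simp only [map_add]
    ring
  have gam_algebraMap : ∀ f c, gam S D v f (algebraMap ℂ R c) = 0 := by
    intro f c
    simp [gam, dotProduct, mulVec]
  have step : ∀ f, (∀ s l t, gam S D v f (bil J S ξ s l t) ∈ bilAlg J S ξ) →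
      ∀ g ∈ bilAlg J S ξ, gam S D v f g ∈ bilAlg J S ξ := by
    intro f hf g hg
    induction hg using Algebra.adjoin_induction with
    | mem x hx =>
      rcases hx with ⟨p, rfl⟩ | ⟨p, rfl⟩
      · simp [gam, h.map_trace, dotProduct, mulVec]
      · exact hf _ _ _
    | algebraMap c => rw [gam_algebraMap]; exact Subalgebra.zero_mem _
    | add x y _ _ hx hy => rw [gam_add]; exact Subalgebra.add_mem _ hx hy
    | mul x y hx' hy' hx hy =>
      rw [gam_mul]
      exact Subalgebra.add_mem _ (Subalgebra.mul_mem _ hx' hy) (Subalgebra.mul_mem _ hy' hx)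
  refine step f (fun s l t => ?_) g hg
  rw [gam_comm hS]
  refine step _ (fun s' l' t' => ?_) f hf
  have hvec : ∀ s l t, (fun i => D i (bil J S ξ s l t)) = _ :=
    fun s l t => funext (h.map_bil hJ hS s l t)
  simp only [gam, hvec, mulVec_add, mulVec_smul, dotProduct_add,
    add_dotProduct, smul_dotProduct, dotProduct_smul]
  refine Subalgebra.add_mem _ (Subalgebra.smul_mem _ (Subalgebra.add_mem _ ?_ ?_) _)
    (Subalgebra.smul_mem _ (Subalgebra.add_mem _ ?_ ?_) _) <;>
    exact Subalgebra.smul_mem _ (gam_vec_mem hJ hS _ _ _ _ _) _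

/-- The contraction operators preserve the algebra of traces and bilinear covariants. -/
theorem IsSlot.contract_mem (h : IsSlot J S ξ r D) (hJ : Jᵀ = κ • J) (hS : ∀ v, (S v)ᵀ = S v)
    (v : V) {f : R} (hf : f ∈ bilAlg J S ξ) : contract S D v f ∈ bilAlg J S ξ := by
  induction hf using Algebra.adjoin_induction with
  | mem x hx =>
    rcases hx with ⟨p, rfl⟩ | ⟨⟨s, l, t⟩, rfl⟩
    · simp [contract_apply, h.map_trace]
    · have key : ∀ i j, D i (D j (bil J S ξ s l t)) =
          (if s = r ∧ t = r then 1 else 0 : ℂ) • (altWord J S l j i +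
            κ ^ (l.length + 1) • altWord J S l.reverse j i) := by
        intro i j
        rw [h.map_bil hJ hS]
        simp only [Pi.add_apply, Pi.smul_apply, map_add, Derivation.map_smul, h.map_mulVec]
        by_cases hs : s = r <;> by_cases ht : t = r <;> simp [hs, ht]
      have : contract S D v (bil J S ξ s l t) = (if s = r ∧ t = r then 1 else 0 : ℂ) •
          (trace (S v * altWord J S l) + κ ^ (l.length + 1) • trace (S v * altWord J S l.reverse))
          := by
        simp only [contract_apply, key, trace, Matrix.mul_apply, diag_apply, Finset.smul_sum,
          ← Finset.sum_add_distrib, mul_smul_comm, mul_add]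
      simp only [this]
      exact Subalgebra.smul_mem _ (Subalgebra.add_mem _ (trace_mem_bilAlg _ _)
        (Subalgebra.smul_mem _ (trace_mem_bilAlg _ _) _)) _
  | algebraMap c => simp [contract_apply]
  | add x y _ _ hx hy => rw [map_add]; exact Subalgebra.add_mem _ hx hy
  | mul x y hx' hy' hx hy =>
    rw [contract_mul hS]
    have := h.gam_mem hJ hS v hx' hy'
    exact Subalgebra.add_mem _ (Subalgebra.add_mem _ (Subalgebra.mul_mem _ hx' hy)
      (Subalgebra.mul_mem _ hy' hx)) (Subalgebra.add_mem _ this this)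

end Contraction

section Clifford

open Matrix

variable {V R : Type*} [CommRing R]

/-- The generic traceless two by two matrix. -/
def tl (q : Fin 3 → R) : Matrix (Fin 2) (Fin 2) R := !![-q 1, q 0; -q 2, q 1]

lemma tl_triple (x v w : Fin 3 → R) : (2 : R) • (tl x * tl v * tl w) =
    trace (tl x * tl v * tl w) • (1 : Matrix (Fin 2) (Fin 2) R) +
    (trace (tl v * tl w) • tl x - trace (tl x * tl w) • tl v + trace (tl x * tl v) • tl w) := by
  ext i j
  fin_cases i <;> fin_cases j <;> simp [tl, trace, Fin.sum_univ_two] <;> ring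

lemma tl_tri (x a b c : Fin 3 → R) : (2 : R) • (trace (tl a * tl b * tl c) • tl x) =
    trace (tl x * tl a) • (tl b * tl c - tl c * tl b) +
    trace (tl x * tl b) • (tl c * tl a - tl a * tl c) +
    trace (tl x * tl c) • (tl a * tl b - tl b * tl a) := by
  ext i j
  fin_cases i <;> fin_cases j <;> simp [tl, trace, Fin.sum_univ_two] <;> ring

lemma trace_tl (x : Fin 3 → R) : trace (tl x) = 0 := by simp [tl, trace, Fin.sum_univ_two]

variable [Algebra ℂ R]

/-- The algebra generated by the traces of products of two of the matrices `tl (q v)`. -/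
def dotAlg (q : V → Fin 3 → R) : Subalgebra ℂ R :=
  Algebra.adjoin ℂ (Set.range fun p : V × V => trace (tl (q p.1) * tl (q p.2)))

/-- The trace of a product of three of the matrices `tl (q v)`. -/
def tri (q : V → Fin 3 → R) (a b c : V) : R := trace (tl (q a) * tl (q b) * tl (q c))

/-- A space containing all even words. -/
def evenSpan (q : V → Fin 3 → R) : Submodule (dotAlg q) (Matrix (Fin 2) (Fin 2) R) :=
  Submodule.span _ ({1} ∪ Set.range fun p : V × V => tl (q p.1) * tl (q p.2))

/-- A space containing all odd words. -/
def oddSpan (q : V → Fin 3 → R) : Submodule (dotAlg q) (Matrix (Fin 2) (Fin 2) R) :=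
  Submodule.span _ ((Set.range fun v : V => tl (q v)) ∪
    Set.range fun p : V × V × V => tri q p.1 p.2.1 p.2.2 • (1 : Matrix (Fin 2) (Fin 2) R))

variable (q : V → Fin 3 → R)

lemma dot_mem (v w : V) : trace (tl (q v) * tl (q w)) ∈ dotAlg q :=
  Algebra.subset_adjoin ⟨(v, w), rfl⟩

lemma evenSpan_one : 1 ∈ evenSpan q := Submodule.subset_span (Or.inl rfl)

lemma evenSpan_mul (v w : V) : tl (q v) * tl (q w) ∈ evenSpan q :=
  Submodule.subset_span (Or.inr ⟨(v, w), rfl⟩)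

lemma oddSpan_tl (v : V) : tl (q v) ∈ oddSpan q := Submodule.subset_span (Or.inl ⟨v, rfl⟩)

lemma oddSpan_tri (a b c : V) : tri q a b c • (1 : Matrix (Fin 2) (Fin 2) R) ∈ oddSpan q :=
  Submodule.subset_span (Or.inr ⟨(a, b, c), rfl⟩)

lemma mem_of_two_smul {N : Submodule (dotAlg q) (Matrix (Fin 2) (Fin 2) R)}
    {m : Matrix (Fin 2) (Fin 2) R} (h : (2 : R) • m ∈ N) : m ∈ N := by
  have h2 := N.smul_mem (algebraMap ℂ (dotAlg q) (1 / 2)) h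
  have : (algebraMap ℂ (dotAlg q) (1 / 2)) • ((2 : R) • m) = m := by
    have e1 : (2 : R) • m = (2 : ℂ) • m := by rw [two_smul, two_smul]
    rw [e1, algebraMap_smul, smul_smul]
    norm_num
  rwa [this] at h2

lemma dot_smul_mem {N : Submodule (dotAlg q) (Matrix (Fin 2) (Fin 2) R)}
    {m : Matrix (Fin 2) (Fin 2) R} (h : m ∈ N) (v w : V) :
    trace (tl (q v) * tl (q w)) • m ∈ N :=
  N.smul_mem ⟨_, dot_mem q v w⟩ h

lemma tl_mul_even (x : V) {m : Matrix (Fin 2) (Fin 2) R} (hm : m ∈ evenSpan q) :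
    tl (q x) * m ∈ oddSpan q := by
  induction hm using Submodule.span_induction with
  | mem m hm =>
    rcases hm with rfl | ⟨⟨v, w⟩, rfl⟩
    · rw [mul_one]; exact oddSpan_tl q x
    · apply mem_of_two_smul
      simp only
      rw [← Matrix.mul_assoc, tl_triple]
      refine Submodule.add_mem _ (oddSpan_tri q x v w) (Submodule.add_mem _
        (Submodule.sub_mem _ ?_ ?_) ?_) <;> exact dot_smul_mem q (oddSpan_tl q _) _ _
  | zero => rw [mul_zero]; exact Submodule.zero_mem _
  | add m m' _ _ h h' => rw [mul_add]; exact Submodule.add_mem _ h h'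
  | smul d m _ h =>
    have : tl (q x) * d • m = d • (tl (q x) * m) := Matrix.mul_smul _ (d : R) _
    rw [this]
    exact Submodule.smul_mem _ _ h

lemma tl_mul_odd (x : V) {m : Matrix (Fin 2) (Fin 2) R} (hm : m ∈ oddSpan q) :
    tl (q x) * m ∈ evenSpan q := by
  induction hm using Submodule.span_induction with
  | mem m hm =>
    rcases hm with ⟨v, rfl⟩ | ⟨⟨a, b, c⟩, rfl⟩
    · exact evenSpan_mul q x v
    · simp only [Matrix.mul_smul, mul_one]
      apply mem_of_two_smul
      rw [tri, tl_tri]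
      refine Submodule.add_mem _ (Submodule.add_mem _ ?_ ?_) ?_ <;>
        exact dot_smul_mem q (Submodule.sub_mem _ (evenSpan_mul q _ _) (evenSpan_mul q _ _)) _ _
  | zero => rw [mul_zero]; exact Submodule.zero_mem _
  | add m m' _ _ h h' => rw [mul_add]; exact Submodule.add_mem _ h h'
  | smul d m _ h =>
    have : tl (q x) * d • m = d • (tl (q x) * m) := Matrix.mul_smul _ (d : R) _
    rw [this]
    exact Submodule.smul_mem _ _ h

/-- The space spanned by the traces of three matrices. -/
def triSpan : Submodule (dotAlg q) R :=
  Submodule.span _ (Set.range fun p : V × V × V => tri q p.1 p.2.1 p.2.2)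

lemma trace_evenSpan {m : Matrix (Fin 2) (Fin 2) R} (hm : m ∈ evenSpan q) :
    trace m ∈ dotAlg q := by
  induction hm using Submodule.span_induction with
  | mem m hm =>
    rcases hm with rfl | ⟨⟨v, w⟩, rfl⟩
    · rw [trace_one, Fintype.card_fin]
      exact Subalgebra.natCast_mem _ 2
    · exact dot_mem q v w
  | zero => rw [trace_zero]; exact Subalgebra.zero_mem _
  | add m m' _ _ h h' => rw [trace_add]; exact Subalgebra.add_mem _ h h'
  | smul d m _ h =>
    have : trace (d • m) = (d : R) * trace m := trace_smul (d : R) m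
    rw [this]
    exact Subalgebra.mul_mem _ d.2 h

lemma trace_oddSpan {m : Matrix (Fin 2) (Fin 2) R} (hm : m ∈ oddSpan q) :
    trace m ∈ triSpan q := by
  induction hm using Submodule.span_induction with
  | mem m hm =>
    rcases hm with ⟨v, rfl⟩ | ⟨⟨a, b, c⟩, rfl⟩
    · simp only [trace_tl]; exact Submodule.zero_mem _
    · simp only [trace_smul, trace_one, Fintype.card_fin, smul_eq_mul]
      rw [mul_comm]
      exact (triSpan q).smul_mem ((2 : ℕ) : dotAlg q) (Submodule.subset_span ⟨(a, b, c), rfl⟩)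
  | zero => rw [trace_zero]; exact Submodule.zero_mem _
  | add m m' _ _ h h' => rw [trace_add]; exact Submodule.add_mem _ h h'
  | smul d m _ h =>
    have : trace (d • m) = d • trace m := trace_smul (d : R) m
    rw [this]
    exact Submodule.smul_mem _ _ h

lemma triSpan_mul {f g : R} (hf : f ∈ triSpan q) (hg : g ∈ triSpan q) : f * g ∈ dotAlg q := by
  induction hf using Submodule.span_induction with
  | mem f hf =>
    induction hg using Submodule.span_induction with
    | mem g hg =>
      obtain ⟨⟨a, b, c⟩, rfl⟩ := hf
      obtain ⟨⟨d, e, k⟩, rfl⟩ := hg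
      have h := trace_evenSpan q
        (tl_mul_odd q d (tl_mul_even q e (tl_mul_odd q k (oddSpan_tri q a b c))))
      simpa [tri, Matrix.mul_smul, trace_smul, Matrix.mul_assoc] using h
    | zero => rw [mul_zero]; exact Subalgebra.zero_mem _
    | add m m' _ _ h h' => rw [mul_add]; exact Subalgebra.add_mem _ h h'
    | smul d m _ h =>
      have : f * d • m = (d : R) * (f * m) := by rw [← mul_left_comm]; rfl
      rw [this]
      exact Subalgebra.mul_mem _ d.2 h
  | zero => rw [zero_mul]; exact Subalgebra.zero_mem _
  | add m m' _ _ h h' => rw [add_mul]; exact Subalgebra.add_mem _ h h'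
  | smul d m _ h =>
    have : d • m * g = (d : R) * (m * g) := by rw [← mul_assoc]; rfl
    rw [this]
    exact Subalgebra.mul_mem _ d.2 h

lemma word_mem (l : List V) : (l.map fun v => tl (q v)).prod ∈ evenSpan q ∨
    (l.map fun v => tl (q v)).prod ∈ oddSpan q := by
  induction l with
  | nil => exact Or.inl (evenSpan_one q)
  | cons v l ih =>
    rw [List.map_cons, List.prod_cons]
    exact ih.symm.imp (tl_mul_odd q v) (tl_mul_even q v)

/-- Invariants of traceless two by two matrices which are even under the sign change are
generated by the traces of products of two. -/
theorem mem_dotAlg_of_even (θ : R →ₐ[ℂ] R) (hθ : ∀ v i, θ (q v i) = - q v i) {f : R}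
    (hf : f ∈ Algebra.adjoin ℂ
      (Set.range fun l : List V => trace (l.map fun v => tl (q v)).prod))
    (hθf : θ f = f) : f ∈ dotAlg q := by
  have hsum : ∃ d ∈ dotAlg q, ∃ o ∈ triSpan q, f = d + o := by
    clear hθf
    induction hf using Algebra.adjoin_induction with
    | mem f hf =>
      obtain ⟨l, rfl⟩ := hf
      rcases word_mem q l with h | h
      · exact ⟨_, trace_evenSpan q h, 0, Submodule.zero_mem _, (add_zero _).symm⟩
      · exact ⟨0, Subalgebra.zero_mem _, _, trace_oddSpan q h, (zero_add _).symm⟩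
    | algebraMap c =>
      exact ⟨_, Subalgebra.algebraMap_mem _ c, 0, Submodule.zero_mem _, (add_zero _).symm⟩
    | add f g _ _ hf hg =>
      obtain ⟨d, hd, o, ho, rfl⟩ := hf
      obtain ⟨d', hd', o', ho', rfl⟩ := hg
      exact ⟨_, Subalgebra.add_mem _ hd hd', _, Submodule.add_mem _ ho ho', by ring⟩
    | mul f g _ _ hf hg =>
      obtain ⟨d, hd, o, ho, rfl⟩ := hf
      obtain ⟨d', hd', o', ho', rfl⟩ := hg
      exact ⟨_, Subalgebra.add_mem _ (Subalgebra.mul_mem _ hd hd') (triSpan_mul q ho ho'), _,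
        Submodule.add_mem _ ((triSpan q).smul_mem ⟨d, hd⟩ ho') ((triSpan q).smul_mem ⟨d', hd'⟩ ho),
        by simp only [Subalgebra.smul_def, smul_eq_mul]; ring⟩
  have hfix : ∀ d ∈ dotAlg q, θ d = d := by
    intro d hd
    induction hd using Algebra.adjoin_induction with
    | mem f hf =>
      obtain ⟨p, rfl⟩ := hf
      simp [tl, trace, Fin.sum_univ_two, hθ]
    | algebraMap c => simp
    | add f g _ _ hf hg => rw [map_add, hf, hg]
    | mul f g _ _ hf hg => rw [map_mul, hf, hg]
  have hneg : ∀ o ∈ triSpan q, θ o = -o := by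
    intro o ho
    induction ho using Submodule.span_induction with
    | mem f hf =>
      obtain ⟨p, rfl⟩ := hf
      simp [tri, tl, trace, Fin.sum_univ_two, hθ]
      ring
    | zero => simp
    | add f g _ _ hf hg => rw [map_add, hf, hg, neg_add]
    | smul d f _ hf =>
      rw [Subalgebra.smul_def, smul_eq_mul, map_mul, hf, hfix _ d.2, mul_neg]
  obtain ⟨d, hd, o, ho, rfl⟩ := hsum
  rw [map_add, hfix d hd, hneg o ho] at hθf
  have h2 : (2 : ℂ) • o = 0 := by
    rw [two_smul]
    linear_combination -hθf
  have h0 : o = 0 := by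
    have := congrArg (fun x => (1 / 2 : ℂ) • x) h2
    simpa [smul_smul] using this
  rw [h0, add_zero]
  exact hd

end Clifford

/-- The variables of the big ring: three quartic forms, and infinitely many quadratic and linear
forms. -/
inductive Var
  | a (i : Fin 3) (k : Fin 5)
  | u (s : ℕ) (k : Fin 3)
  | x (s : ℕ) (k : Fin 2)

instance : DecidableEq Var := Classical.decEq _

/-- The big ring. -/
abbrev Big := MvPolynomial Var ℂ

/-- The raising operator. -/
def bigE : Derivation ℂ Big Big := mkDerivation ℂ fun
  | .a i k => ((k : ℕ) : ℂ) • X (.a i (k - 1))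
  | .u s k => ((k : ℕ) : ℂ) • X (.u s (k - 1))
  | .x s k => ((k : ℕ) : ℂ) • X (.x s (k - 1))

/-- The lowering operator. -/
def bigF : Derivation ℂ Big Big := mkDerivation ℂ fun
  | .a i k => (4 - (k : ℕ) : ℂ) • X (.a i (k + 1))
  | .u s k => (2 - (k : ℕ) : ℂ) • X (.u s (k + 1))
  | .x s k => (1 - (k : ℕ) : ℂ) • X (.x s (k + 1))

/-- The weights of the variables. -/
def bigWt : Var → ℤ
  | .a _ k => 4 - 2 * (k : ℕ)
  | .u _ k => 2 - 2 * (k : ℕ)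
  | .x _ k => 1 - 2 * (k : ℕ)

lemma bigE_a (i k) : bigE (X (.a i k)) = ((k : ℕ) : ℂ) • X (.a i (k - 1)) := mkDerivation_X ..
lemma bigE_u (s k) : bigE (X (.u s k)) = ((k : ℕ) : ℂ) • X (.u s (k - 1)) := mkDerivation_X ..
lemma bigE_x (s k) : bigE (X (.x s k)) = ((k : ℕ) : ℂ) • X (.x s (k - 1)) := mkDerivation_X ..
lemma bigF_a (i k) : bigF (X (.a i k)) = (4 - (k : ℕ) : ℂ) • X (.a i (k + 1)) := mkDerivation_X ..
lemma bigF_u (s k) : bigF (X (.u s k)) = (2 - (k : ℕ) : ℂ) • X (.u s (k + 1)) := mkDerivation_X ..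
lemma bigF_x (s k) : bigF (X (.x s k)) = (1 - (k : ℕ) : ℂ) • X (.x s (k + 1)) := mkDerivation_X ..

/-- The symmetric matrices of the quadratic forms. -/
def S₂ (v : ℕ) : Matrix (Fin 2) (Fin 2) Big :=
  !![X (.u v 0), X (.u v 1); X (.u v 1), X (.u v 2)]

/-- The Hankel matrices of the quartic forms. -/
def S₃ (v : Fin 3) : Matrix (Fin 3) (Fin 3) Big :=
  !![X (.a v 0), X (.a v 1), X (.a v 2); X (.a v 1), X (.a v 2), X (.a v 3);
    X (.a v 2), X (.a v 3), X (.a v 4)]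

/-- The invariant bilinear form on linear forms. -/
def J₂ (R : Type*) [CommRing R] : Matrix (Fin 2) (Fin 2) R := !![0, 1; -1, 0]

/-- The invariant bilinear form on quadratic forms. -/
def J₃ (R : Type*) [CommRing R] : Matrix (Fin 3) (Fin 3) R := !![0, 0, 1; 0, -2, 0; 1, 0, 0]

/-- The generic linear forms. -/
def ξ₂ (s : ℕ) (k : Fin 2) : Big := X (.x s k)

/-- The generic quadratic forms. -/
def ξ₃ (s : ℕ) (k : Fin 3) : Big := X (.u s k)

lemma J₂_transpose {R : Type*} [CommRing R] [Algebra ℂ R] :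
    (J₂ R).transpose = (-1 : ℂ) • J₂ R := by
  ext i j; fin_cases i <;> fin_cases j <;> simp [J₂]

lemma J₃_transpose {R : Type*} [CommRing R] [Algebra ℂ R] :
    (J₃ R).transpose = (1 : ℂ) • J₃ R := by
  ext i j; fin_cases i <;> fin_cases j <;> simp [J₃]

lemma S₂_transpose (v : ℕ) : (S₂ v).transpose = S₂ v := by
  ext i j; fin_cases i <;> fin_cases j <;> simp [S₂]

lemma S₃_transpose (v : Fin 3) : (S₃ v).transpose = S₃ v := by
  ext i j; fin_cases i <;> fin_cases j <;> simp [S₃]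

/-- The partial derivatives in a slot of linear forms. -/
def D₂ (r : ℕ) (i : Fin 2) : Derivation ℂ Big Big := pderiv (.x r i)

/-- The partial derivatives in a slot of quadratic forms. -/
def D₃ (r : ℕ) (i : Fin 3) : Derivation ℂ Big Big := pderiv (.u r i)

lemma isSlot₂ (r : ℕ) : IsSlot (J₂ Big) S₂ ξ₂ r (D₂ r) where
  map_J i j k := by fin_cases j <;> fin_cases k <;> simp [J₂]
  map_S v i j k := by fin_cases j <;> fin_cases k <;> simp [S₂, D₂, pderiv_X]
  map_ξ s i j := by
    simp only [ξ₂, D₂, pderiv_X, Pi.single_apply, Var.x.injEq]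
    simp only [eq_comm]

lemma isSlot₃ (r : ℕ) : IsSlot (J₃ Big) S₃ ξ₃ r (D₃ r) where
  map_J i j k := by
    have h2 : D₃ r i 2 = 0 := by
      have := (D₃ r i).map_natCast 2
      simpa using this
    fin_cases j <;> fin_cases k <;> simp [J₃, h2]
  map_S v i j k := by fin_cases j <;> fin_cases k <;> simp [S₃, D₃, pderiv_X]
  map_ξ s i j := by
    simp only [ξ₃, D₃, pderiv_X, Pi.single_apply, Var.u.injEq]
    simp only [eq_comm]

lemma commutator_eq {D D' D'' : Derivation ℂ Big Big}
    (h : ∀ i, D (D' (X i)) = D' (D (X i)) + D'' (X i)) (f : Big) :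
    D (D' f) = D' (D f) + D'' f := by
  have : ⁅D, D'⁆ = D'' := MvPolynomial.derivation_ext fun i => by
    rw [Derivation.commutator_apply, h]; ring
  have := congrArg (fun D => D f) this
  simp only [Derivation.commutator_apply] at this
  rw [← this]; ring

lemma D₂_E (r : ℕ) (i : Fin 2) (f : Big) :
    D₂ r i (bigE f) = bigE (D₂ r i f) + ((1 - (i : ℕ) : ℂ) • D₂ r (i + 1)) f := by
  refine commutator_eq (fun j => ?_) f
  rcases j with ⟨j, k⟩ | ⟨s, k⟩ | ⟨s, k⟩
  · simp [bigE_a, D₂, pderiv_X]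
  · simp [bigE_u, D₂, pderiv_X]
  · by_cases hs : r = s
    · fin_cases i <;> fin_cases k <;> simp [bigE_x, D₂, pderiv_X, hs]
    · fin_cases i <;> fin_cases k <;> simp [bigE_x, D₂, pderiv_X, Ne.symm hs]

lemma D₂_F (r : ℕ) (i : Fin 2) (f : Big) :
    D₂ r i (bigF f) = bigF (D₂ r i f) + (((i : ℕ) : ℂ) • D₂ r (i - 1)) f := by
  refine commutator_eq (fun j => ?_) f
  rcases j with ⟨j, k⟩ | ⟨s, k⟩ | ⟨s, k⟩
  · simp [bigF_a, D₂, pderiv_X]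
  · simp [bigF_u, D₂, pderiv_X]
  · by_cases hs : r = s
    · fin_cases i <;> fin_cases k <;> simp [bigF_x, D₂, pderiv_X, hs]
    · fin_cases i <;> fin_cases k <;> simp [bigF_x, D₂, pderiv_X, Ne.symm hs]

lemma D₃_E (r : ℕ) (i : Fin 3) (f : Big) :
    D₃ r i (bigE f) = bigE (D₃ r i f) + ((if i = 2 then 0 else ((i : ℕ) + 1 : ℂ)) •
      D₃ r (i + 1)) f := by
  refine commutator_eq (fun j => ?_) f
  rcases j with ⟨j, k⟩ | ⟨s, k⟩ | ⟨s, k⟩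
  · fin_cases i <;> simp [bigE_a, D₃, pderiv_X]
  · by_cases hs : r = s
    · fin_cases i <;> fin_cases k <;> simp [bigE_u, D₃, pderiv_X, hs] <;> norm_num
    · fin_cases i <;> fin_cases k <;> simp [bigE_u, D₃, pderiv_X, Ne.symm hs]
  · fin_cases i <;> simp [bigE_x, D₃, pderiv_X]

lemma D₃_F (r : ℕ) (i : Fin 3) (f : Big) :
    D₃ r i (bigF f) = bigF (D₃ r i f) + ((if i = 0 then 0 else (3 - (i : ℕ) : ℂ)) •
      D₃ r (i - 1)) f := by
  refine commutator_eq (fun j => ?_) f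
  rcases j with ⟨j, k⟩ | ⟨s, k⟩ | ⟨s, k⟩
  · fin_cases i <;> simp [bigF_a, D₃, pderiv_X]
  · by_cases hs : r = s
    · fin_cases i <;> fin_cases k <;> simp [bigF_u, D₃, pderiv_X, hs] <;> norm_num
    · fin_cases i <;> fin_cases k <;> simp [bigF_u, D₃, pderiv_X, Ne.symm hs]
  · fin_cases i <;> simp [bigF_x, D₃, pderiv_X]

lemma contract₂_E (r v : ℕ) (f : Big) :
    contract S₂ (D₂ r) v (bigE f) = bigE (contract S₂ (D₂ r) v f) := by
  simp only [contract_apply, Fin.sum_univ_two, map_add, Derivation.leibniz, D₂_E, smul_eq_mul,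
    Derivation.smul_apply]
  simp [S₂, bigE_u]
  simp only [smul_eq_C_mul, map_ofNat]
  ring

lemma contract₂_F (r v : ℕ) (f : Big) :
    contract S₂ (D₂ r) v (bigF f) = bigF (contract S₂ (D₂ r) v f) := by
  simp only [contract_apply, Fin.sum_univ_two, map_add, Derivation.leibniz, D₂_F, smul_eq_mul,
    Derivation.smul_apply]
  simp [S₂, bigF_u]
  simp only [smul_eq_C_mul, map_sub, map_one, map_ofNat]
  ring

lemma contract₃_E (r : ℕ) (v : Fin 3) (f : Big) :
    contract S₃ (D₃ r) v (bigE f) = bigE (contract S₃ (D₃ r) v f) := by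
  simp only [contract_apply, Fin.sum_univ_three, map_add, Derivation.leibniz, D₃_E, smul_eq_mul,
    Derivation.smul_apply]
  simp [S₃, bigE_a]
  simp only [smul_eq_C_mul, map_add, map_one, map_ofNat]
  ring

lemma contract₃_F (r : ℕ) (v : Fin 3) (f : Big) :
    contract S₃ (D₃ r) v (bigF f) = bigF (contract S₃ (D₃ r) v f) := by
  simp only [contract_apply, Fin.sum_univ_three, map_add, Derivation.leibniz, D₃_F, smul_eq_mul,
    Derivation.smul_apply]
  simp [S₃, bigF_a]
  simp only [smul_eq_C_mul, map_sub, map_one, map_ofNat]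
  ring

section Contraction

variable {n V R : Type*} [Fintype n] [CommRing R] [Algebra ℂ R]
  {J : Matrix n n R} {S : V → Matrix n n R} {ξ : ℕ → n → R}

lemma derivation_list_prod_eq_zero (D : Derivation ℂ R R) (l : List R) (h : ∀ x ∈ l, D x = 0) :
    D l.prod = 0 := by
  induction l with
  | nil => simp
  | cons a l ih =>
    simp [h a (by simp), ih fun x hx => h x (by simp [hx])]

lemma contract_mul_of_killed {D : n → Derivation ℂ R R} (v : V) {f : R} (hf : ∀ i, D i f = 0)
    (g : R) : contract S D v (f * g) = f * contract S D v g := by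
  have key : ∀ i g, D i (f * g) = f * D i g := fun i g => by simp [Derivation.leibniz, hf]
  simp only [contract_apply, key, Finset.mul_sum]
  refine Finset.sum_congr rfl fun i _ => Finset.sum_congr rfl fun j _ => ?_
  ring

lemma IsSlot.contract_ξ_mul_ξ [DecidableEq n] {r : ℕ} {D : n → Derivation ℂ R R}
    (h : IsSlot J S ξ r D) (v : V) (i j : n) :
    contract S D v (ξ r i * ξ r j) = S v i j + S v j i := by
  have hif : ∀ (a b c : n), D a (if b = c then (1 : R) else 0) = 0 := by
    intro a b c; split_ifs <;> simp
  simp only [contract_apply, Derivation.leibniz, smul_eq_mul, h.map_ξ, map_add, true_and, hif,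
    mul_zero, zero_add, mul_add, Finset.sum_add_distrib]
  simp

/-- Killing the slots maps `bilAlg` into the algebra generated by traces. -/
lemma map_bilAlg (φ : R →ₐ[ℂ] R) (hJ : ∀ i j, φ (J i j) = J i j)
    (hS : ∀ v i j, φ (S v i j) = S v i j) (hξ : ∀ s i, φ (ξ s i) = 0) {f : R}
    (hf : f ∈ bilAlg J S ξ) : φ f ∈ Algebra.adjoin ℂ
      (Set.range fun p : V × List V => Matrix.trace (S p.1 * altWord J S p.2)) := by
  have hw : ∀ l i j, φ (altWord J S l i j) = altWord J S l i j := by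
    intro l
    induction l with
    | nil => exact hJ
    | cons v l ih => intro i j; simp [altWord, Matrix.mul_apply, hJ, hS, ih]
  induction hf using Algebra.adjoin_induction with
  | mem x hx =>
    rcases hx with ⟨p, rfl⟩ | ⟨p, rfl⟩
    · refine Algebra.subset_adjoin ⟨p, ?_⟩
      simp [Matrix.trace, Matrix.mul_apply, hS, hw]
    · simp [bil, dotProduct, hξ]
  | algebraMap r => rw [AlgHom.commutes]; exact Subalgebra.algebraMap_mem _ r
  | add f g _ _ hf hg => rw [map_add]; exact add_mem hf hg
  | mul f g _ _ hf hg => rw [map_mul]; exact mul_mem hf hg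

end Contraction

/-- The monomials in the linear forms. -/
def monX (l : List (ℕ × Fin 2)) : Big := (l.map fun p => X (.x p.1 p.2)).prod

/-- The monomials in the quadratic forms. -/
def monU (l : List (ℕ × Fin 3)) : Big := (l.map fun p => X (.u p.1 p.2)).prod

/-- The monomials in the quartic forms. -/
def monA (l : List (Fin 3 × Fin 5)) : Big := (l.map fun p => X (.a p.1 p.2)).prod

/-- The map identifying the ring of finitely many linear forms with a subring. -/
def spinHom (M : ℕ) : SpinRing M →ₐ[ℂ] Big := rename fun p => Var.x p.1 p.2

lemma spinHom_E (M : ℕ) (f : SpinRing M) : spinHom M (spinE M f) = bigE (spinHom M f) := by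
  refine algHom_derivation_comm _ _ _ (fun p => ?_) f
  obtain ⟨j, k⟩ := p
  fin_cases k <;> simp [spinHom, spinE_X, bigE_x]

lemma spinHom_F (M : ℕ) (f : SpinRing M) : spinHom M (spinF M f) = bigF (spinHom M f) := by
  refine algHom_derivation_comm _ _ _ (fun p => ?_) f
  obtain ⟨j, k⟩ := p
  fin_cases k <;> simp [spinHom, spinF_X, bigF_x]

lemma weight_list (l : List (ℕ × Fin 2)) : (l.map fun p => bigWt (.x p.1 p.2)).sum =
    ((l.map fun p => if p.2 = 0 then 1 else 0).sum : ℕ) -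
      ((l.map fun p => if p.2 = 1 then 1 else 0).sum : ℕ) := by
  induction l with
  | nil => simp
  | cons p l ih =>
    obtain ⟨s, k⟩ := p
    rw [List.map_cons, List.sum_cons, ih, List.map_cons, List.map_cons, List.sum_cons,
      List.sum_cons]
    push_cast
    fin_cases k <;> simp [bigWt] <;> ring

lemma good_monX (l : List (ℕ × Fin 2)) (h : (l.map fun p => bigWt (.x p.1 p.2)).sum = 0) :
    Good (bigE : Big →ₗ[ℂ] Big) bigF
      (Subalgebra.toSubmodule (bilAlg (J₂ Big) S₂ ξ₂)) (monX l) := by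
  obtain ⟨M, hM⟩ : ∃ M : ℕ, ∀ p ∈ l, p.1 < M + 1 := by
    refine ⟨(l.map Prod.fst).sum, fun p hp => Nat.lt_succ_of_le ?_⟩
    exact List.le_sum_of_mem (List.mem_map_of_mem hp)
  let g : List (ℕ × Fin 2) → SpinRing (M + 1) := fun l =>
    (l.map fun p => X (Fin.ofNat (M + 1) p.1, p.2)).prod
  have hg : ∀ l : List (ℕ × Fin 2), (∀ p ∈ l, p.1 < M + 1) → spinHom (M + 1) (g l) = monX l := by
    intro l hl
    simp only [g, monX, map_list_prod, List.map_map]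
    congr 1
    refine List.map_congr_left fun p hp => ?_
    simp [spinHom, Nat.mod_eq_of_lt (hl p hp)]
  have hw : ∀ (l : List (ℕ × Fin 2)) (k : Fin 2), (g l).IsWeightedHomogeneous (spinWt k)
      (l.map fun p => if p.2 = k then 1 else 0).sum := by
    intro l k
    induction l with
    | nil => exact isWeightedHomogeneous_one ..
    | cons p l ih =>
      simp only [g, List.map_cons, List.prod_cons, List.sum_cons]
      exact (isWeightedHomogeneous_X ..).mul ih
  have h1 := hw l 1
  rw [weight_list, sub_eq_zero, Nat.cast_inj] at h
  rw [← h] at h1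
  have := (spin_good _ (g l) (hw l 0) h1).map (T := Subalgebra.toSubmodule (bilAlg (J₂ Big) S₂ ξ₂))
    (spinHom (M + 1)).toLinearMap (spinHom_E _) (spinHom_F _) ?_
  · have e : (spinHom (M + 1)).toLinearMap (g l) = monX l := hg l hM
    rwa [e] at this
  · intro f hf
    simp only [Subalgebra.coe_toSubmodule, SetLike.mem_coe] at hf ⊢
    change spinHom (M + 1) f ∈ _
    induction hf using Algebra.adjoin_induction with
    | mem x hx =>
      obtain ⟨⟨i, j⟩, rfl⟩ := hx
      have : spinHom (M + 1) (brk i j) = bil (J₂ Big) S₂ ξ₂ i [] j := by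
        simp [spinHom, brk, bil, altWord, J₂, ξ₂, dotProduct, Matrix.mulVec, Fin.sum_univ_two]
        ring
      rw [this]
      exact bil_mem_bilAlg (i : ℕ) [] (j : ℕ)
    | algebraMap r => rw [AlgHom.commutes]; exact Subalgebra.algebraMap_mem _ r
    | add f g _ _ hf hg => rw [map_add]; exact add_mem hf hg
    | mul f g _ _ hf hg => rw [map_mul]; exact mul_mem hf hg

lemma exists_fresh {α : Type*} (l : List (ℕ × α)) : ∃ s, ∀ p ∈ l, p.1 ≠ s := by
  refine ⟨(l.map Prod.fst).sum + 1, fun p hp h => ?_⟩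
  have := List.le_sum_of_mem (List.mem_map_of_mem (f := Prod.fst) hp)
  omega

lemma D₂_monX {s : ℕ} {l : List (ℕ × Fin 2)} (h : ∀ p ∈ l, p.1 ≠ s) (i : Fin 2) :
    D₂ s i (monX l) = 0 := by
  refine derivation_list_prod_eq_zero _ _ fun x hx => ?_
  obtain ⟨p, hp, rfl⟩ := List.mem_map.1 hx
  simp [D₂, pderiv_X, h p hp]

lemma D₂_monU (s : ℕ) (l : List (ℕ × Fin 3)) (i : Fin 2) : D₂ s i (monU l) = 0 := by
  refine derivation_list_prod_eq_zero _ _ fun x hx => ?_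
  obtain ⟨p, hp, rfl⟩ := List.mem_map.1 hx
  simp [D₂, pderiv_X]

lemma D₃_monU {s : ℕ} {l : List (ℕ × Fin 3)} (h : ∀ p ∈ l, p.1 ≠ s) (i : Fin 3) :
    D₃ s i (monU l) = 0 := by
  refine derivation_list_prod_eq_zero _ _ fun x hx => ?_
  obtain ⟨p, hp, rfl⟩ := List.mem_map.1 hx
  simp [D₃, pderiv_X, h p hp]

lemma D₃_monA (s : ℕ) (l : List (Fin 3 × Fin 5)) (i : Fin 3) : D₃ s i (monA l) = 0 := by
  refine derivation_list_prod_eq_zero _ _ fun x hx => ?_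
  obtain ⟨p, hp, rfl⟩ := List.mem_map.1 hx
  simp [D₃, pderiv_X]

lemma good_monU (lu : List (ℕ × Fin 3)) (lx : List (ℕ × Fin 2))
    (h : (lu.map fun p => bigWt (.u p.1 p.2)).sum + (lx.map fun p => bigWt (.x p.1 p.2)).sum = 0) :
    Good (bigE : Big →ₗ[ℂ] Big) bigF
      (Subalgebra.toSubmodule (bilAlg (J₂ Big) S₂ ξ₂)) (monU lu * monX lx) := by
  induction lu generalizing lx with
  | nil => simpa [monU] using good_monX lx (by simpa using h)
  | cons p lu ih =>
    obtain ⟨v, k⟩ := p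
    obtain ⟨s, hs⟩ := exists_fresh lx
    obtain ⟨i, j, hij, hw⟩ : ∃ i j, S₂ v i j + S₂ v j i = (2 : ℂ) • X (.u v k) ∧
        bigWt (.u v k) = bigWt (.x s i) + bigWt (.x s j) := by
      fin_cases k
      exacts [⟨0, 0, by simp [S₂, two_smul], by simp [bigWt]⟩,
        ⟨0, 1, by simp [S₂, two_smul], by simp [bigWt]⟩,
        ⟨1, 1, by simp [S₂, two_smul], by simp [bigWt]⟩]
    have := (ih ((s, i) :: (s, j) :: lx) (by
      simp only [List.map_cons, List.sum_cons] at h ⊢; linarith)).map (contract S₂ (D₂ s) v)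
      (contract₂_E s v) (contract₂_F s v)
      fun f hf => (isSlot₂ s).contract_mem J₂_transpose S₂_transpose v hf
    rw [← Subalgebra.coe_toSubmodule] at this
    refine Good.of_smul (c := 2) two_ne_zero ?_
    convert this using 1
    have e1 : monU lu * monX ((s, i) :: (s, j) :: lx) =
        (monU lu * monX lx) * (ξ₂ s i * ξ₂ s j) := by
      simp only [monX, List.map_cons, List.prod_cons, ξ₂]; ring
    rw [e1, contract_mul_of_killed, (isSlot₂ s).contract_ξ_mul_ξ, hij]
    · simp only [monU, List.map_cons, List.prod_cons, smul_eq_C_mul]; ring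
    · intro i; simp [D₂_monX hs, D₂_monU]

/-- The homomorphism killing the linear forms. -/
def killX : Big →ₐ[ℂ] Big := aeval fun
  | .x _ _ => 0
  | z => X z

/-- The homomorphism changing the sign of the quadratic forms. -/
def negU : Big →ₐ[ℂ] Big := aeval fun
  | .u s k => - X (.u s k)
  | z => X z

/-- The homomorphism killing linear and quadratic forms. -/
def killUX : Big →ₐ[ℂ] Big := aeval fun
  | .a i k => X (.a i k)
  | _ => 0

@[simp] lemma killX_a (i k) : killX (X (.a i k)) = X (.a i k) := by simp [killX]
@[simp] lemma killX_u (i k) : killX (X (.u i k)) = X (.u i k) := by simp [killX]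
@[simp] lemma killX_x (i k) : killX (X (.x i k)) = 0 := by simp [killX]
@[simp] lemma negU_a (i k) : negU (X (.a i k)) = X (.a i k) := by simp [negU]
@[simp] lemma negU_u (i k) : negU (X (.u i k)) = - X (.u i k) := by simp [negU]
@[simp] lemma negU_x (i k) : negU (X (.x i k)) = X (.x i k) := by simp [negU]
@[simp] lemma killUX_a (i k) : killUX (X (.a i k)) = X (.a i k) := by simp [killUX]
@[simp] lemma killUX_u (i k) : killUX (X (.u i k)) = 0 := by simp [killUX]
@[simp] lemma killUX_x (i k) : killUX (X (.x i k)) = 0 := by simp [killUX]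

lemma killX_E (f : Big) : killX (bigE f) = bigE (killX f) :=
  algHom_derivation_comm _ _ _ (by rintro (_ | _ | _) <;> simp [bigE_a, bigE_u, bigE_x]) f

lemma killX_F (f : Big) : killX (bigF f) = bigF (killX f) :=
  algHom_derivation_comm _ _ _ (by rintro (_ | _ | _) <;> simp [bigF_a, bigF_u, bigF_x]) f

lemma negU_E (f : Big) : negU (bigE f) = bigE (negU f) :=
  algHom_derivation_comm _ _ _ (by rintro (_ | _ | _) <;> simp [bigE_a, bigE_u, bigE_x]) f

lemma negU_F (f : Big) : negU (bigF f) = bigF (negU f) :=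
  algHom_derivation_comm _ _ _ (by rintro (_ | _ | _) <;> simp [bigF_a, bigF_u, bigF_x]) f

lemma killUX_E (f : Big) : killUX (bigE f) = bigE (killUX f) :=
  algHom_derivation_comm _ _ _ (by rintro (_ | _ | _) <;> simp [bigE_a, bigE_u, bigE_x]) f

lemma killUX_F (f : Big) : killUX (bigF f) = bigF (killUX f) :=
  algHom_derivation_comm _ _ _ (by rintro (_ | _ | _) <;> simp [bigF_a, bigF_u, bigF_x]) f

lemma mul_altWord {V R n : Type*} [Fintype n] [DecidableEq n] [CommRing R] (J : Matrix n n R)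
    (S : V → Matrix n n R) (v : V) (l : List V) :
    S v * altWord J S l = ((v :: l).map fun w => S w * J).prod := by
  induction l generalizing v with
  | nil => simp [altWord]
  | cons w l ih => rw [List.map_cons, List.prod_cons, ← ih]; simp only [altWord, Matrix.mul_assoc]

lemma S₂_mul_J₂ (v : ℕ) : S₂ v * J₂ Big = tl fun k => X (.u v k) := by
  simp [S₂, J₂, tl]

lemma good_monU_even (lu : List (ℕ × Fin 3)) (heven : Even lu.length)
    (h : (lu.map fun p => bigWt (.u p.1 p.2)).sum = 0) :
    Good (bigE : Big →ₗ[ℂ] Big) bigF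
      (Subalgebra.toSubmodule (bilAlg (J₃ Big) S₃ ξ₃)) (monU lu) := by
  obtain ⟨N₀, hN₀⟩ := good_monU lu [] (by simpa using h)
  refine ⟨N₀, fun N hN => ?_⟩
  have key := hN₀ N hN
  rw [show monX [] = 1 from rfl, mul_one] at key
  have hk : killX (monU lu) = monU lu := by
    simp [monU, map_list_prod, List.map_map, Function.comp_def]
  have hn : negU (monU lu) = monU lu := by
    clear key hk hN₀ h
    have : ∀ l : List (ℕ × Fin 3), negU (monU l) = (-1) ^ l.length * monU l := by
      intro l
      induction l with
      | nil => simp [monU]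
      | cons p l ih =>
        simp only [monU, List.map_cons, List.prod_cons, map_mul, negU_u, List.length_cons] at ih ⊢
        rw [ih]; ring
    rw [this, heven.neg_one_pow, one_mul]
  have hk' : killX (reyn (bigE : Big →ₗ[ℂ] Big) bigF N (monU lu)) =
      reyn (bigE : Big →ₗ[ℂ] Big) bigF N (monU lu) := by
    have := map_reyn (E := (bigE : Big →ₗ[ℂ] Big)) (F := (bigF : Big →ₗ[ℂ] Big))
      killX.toLinearMap killX_E killX_F N (monU lu)
    simpa [hk] using this
  have hn' : negU (reyn (bigE : Big →ₗ[ℂ] Big) bigF N (monU lu)) =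
      reyn (bigE : Big →ₗ[ℂ] Big) bigF N (monU lu) := by
    have := map_reyn (E := (bigE : Big →ₗ[ℂ] Big)) (F := (bigF : Big →ₗ[ℂ] Big))
      negU.toLinearMap negU_E negU_F N (monU lu)
    simpa [hn] using this
  have h1 := map_bilAlg killX (fun i j => by fin_cases i <;> fin_cases j <;> simp [J₂])
    (fun v i j => by fin_cases i <;> fin_cases j <;> simp [S₂]) (fun s i => by simp [ξ₂]) key
  rw [hk'] at h1
  have h2 := mem_dotAlg_of_even (V := ℕ) (fun v k => (X (.u v k) : Big)) negU
    (fun v i => negU_u v i) (f := reyn (bigE : Big →ₗ[ℂ] Big) bigF N (monU lu))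
    (Algebra.adjoin_mono (by
      rintro _ ⟨⟨v, l⟩, rfl⟩
      exact ⟨v :: l, by simp only [mul_altWord, S₂_mul_J₂]⟩) h1) hn'
  refine Algebra.adjoin_le (S := bilAlg (J₃ Big) S₃ ξ₃) ?_ h2
  rintro _ ⟨⟨v, w⟩, rfl⟩
  have : Matrix.trace (tl (fun k => (X (.u v k) : Big)) * tl fun k => (X (.u w k) : Big)) =
      - bil (J₃ Big) S₃ ξ₃ v [] w := by
    simp [tl, bil, altWord, J₃, ξ₃, dotProduct, Matrix.mulVec, Fin.sum_univ_three,
      Matrix.trace_fin_two]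
    ring
  simp only [this]
  exact neg_mem (bil_mem_bilAlg v [] w)

lemma good_monA_monU (la : List (Fin 3 × Fin 5)) (lu : List (ℕ × Fin 3)) (heven : Even lu.length)
    (h : (la.map fun p => bigWt (.a p.1 p.2)).sum + (lu.map fun p => bigWt (.u p.1 p.2)).sum = 0) :
    Good (bigE : Big →ₗ[ℂ] Big) bigF
      (Subalgebra.toSubmodule (bilAlg (J₃ Big) S₃ ξ₃)) (monA la * monU lu) := by
  induction la generalizing lu with
  | nil => simpa [monA] using good_monU_even lu heven (by simpa using h)
  | cons p la ih =>
    obtain ⟨v, k⟩ := p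
    obtain ⟨s, hs⟩ := exists_fresh lu
    obtain ⟨i, j, hij, hw⟩ : ∃ i j, S₃ v i j + S₃ v j i = (2 : ℂ) • X (.a v k) ∧
        bigWt (.a v k) = bigWt (.u s i) + bigWt (.u s j) := by
      fin_cases k
      exacts [⟨0, 0, by simp [S₃, two_smul], by simp [bigWt]⟩,
        ⟨0, 1, by simp [S₃, two_smul], by simp [bigWt]⟩,
        ⟨1, 1, by simp [S₃, two_smul], by simp [bigWt]⟩,
        ⟨1, 2, by simp [S₃, two_smul], by simp [bigWt]⟩,
        ⟨2, 2, by simp [S₃, two_smul], by simp [bigWt]⟩]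
    have := (ih ((s, i) :: (s, j) :: lu) (by
      simp only [List.length_cons]; grind) (by
      simp only [List.map_cons, List.sum_cons] at h ⊢; linarith)).map (contract S₃ (D₃ s) v)
      (contract₃_E s v) (contract₃_F s v)
      fun f hf => (isSlot₃ s).contract_mem J₃_transpose S₃_transpose v hf
    rw [← Subalgebra.coe_toSubmodule] at this
    refine Good.of_smul (c := 2) two_ne_zero ?_
    convert this using 1
    have e1 : monA la * monU ((s, i) :: (s, j) :: lu) =
        (monA la * monU lu) * (ξ₃ s i * ξ₃ s j) := by
      simp only [monU, List.map_cons, List.prod_cons, ξ₃]; ring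
    rw [e1, contract_mul_of_killed, (isSlot₃ s).contract_ξ_mul_ξ, hij]
    · simp only [monA, List.map_cons, List.prod_cons, smul_eq_C_mul]; ring
    · intro i; simp [D₃_monU hs, D₃_monA]

/-- The algebra generated by the traces of all words in the three matrices. -/
def traceAlg : Subalgebra ℂ Big := Algebra.adjoin ℂ
  (Set.range fun p : Fin 3 × List (Fin 3) => Matrix.trace (S₃ p.1 * altWord (J₃ Big) S₃ p.2))

/-- The first fundamental theorem. -/
theorem good_monA (la : List (Fin 3 × Fin 5)) (h : (la.map fun p => bigWt (.a p.1 p.2)).sum = 0) :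
    Good (bigE : Big →ₗ[ℂ] Big) bigF (Subalgebra.toSubmodule traceAlg) (monA la) := by
  have := (good_monA_monU la [] (by simp) (by simpa using h)).map
    (T := Subalgebra.toSubmodule traceAlg) killUX.toLinearMap killUX_E killUX_F
    fun f hf => map_bilAlg killUX (fun i j => by
      fin_cases i <;> fin_cases j <;> simp [J₃, map_ofNat])
      (fun v i j => by fin_cases i <;> fin_cases j <;> simp [S₃]) (fun s i => by simp [ξ₃]) hf
  have e : killUX.toLinearMap (monA la * monU []) = monA la := by
    simp [monA, monU, map_list_prod, List.map_map, Function.comp_def]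
  rwa [e] at this

section WordFunctions

/-- A function on the words of length `n` with the formal properties of the class of the trace
of a word in self-adjoint traceless three by three matrices modulo traces of shorter words. -/
structure IsWordFun {α : Type*} (n : ℕ) (t : List α → ℂ) : Prop where
  cyc : ∀ p q, (p ++ q).length = n → t (p ++ q) = t (q ++ p)
  rev : ∀ p, p.length = n → t p.reverse = t p
  sym : ∀ p q r w, p ≠ [] → q ≠ [] → r ≠ [] → w ≠ [] → (p ++ q ++ r ++ w).length = n →
    t (p ++ q ++ r ++ w) + t (p ++ r ++ q ++ w) + t (q ++ p ++ r ++ w) +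
    t (q ++ r ++ p ++ w) + t (r ++ p ++ q ++ w) + t (r ++ q ++ p ++ w) = 0

variable {α : Type*} {n : ℕ} {t : List α → ℂ}

lemma IsWordFun.cube (h : IsWordFun n t) (x : α) (w : List α) (hw : w ≠ [])
    (hn : w.length + 3 = n) : t (x :: x :: x :: w) = 0 := by
  have := h.sym [x] [x] [x] w (by simp) (by simp) (by simp) hw (by simp; omega)
  simp only [List.cons_append, List.nil_append] at this
  linear_combination this / 6

lemma IsWordFun.cube' (h : IsWordFun n t) (x : α) (p q : List α) (hw : p ++ q ≠ [])
    (hn : p.length + q.length + 3 = n) : t (p ++ x :: x :: x :: q) = 0 := by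
  rw [h.cyc p _ (by simp; omega)]
  exact h.cube x (q ++ p) (by simpa [and_comm] using hw) (by simp; omega)

lemma IsWordFun.swap (h : IsWordFun n t) (x : α) (p q : List α) (hp : p ≠ [])
    (hn : p.length + q.length + 3 = n) :
    t (x :: x :: p ++ x :: q) = - t (x :: x :: q ++ x :: p) := by
  have h1 := h.sym [x] [x] p (x :: q) (by simp) (by simp) hp (by simp) (by simp; omega)
  have h2 := h.cube' x p q (by simp [hp]) hn
  have h3 := h.cyc (x :: p) (x :: x :: q) (by simp; omega)
  simp only [List.cons_append, List.nil_append, List.append_assoc] at *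
  linear_combination h1 / 2 - h2 - h3

lemma IsWordFun.flip (h : IsWordFun n t) (x : α) (p q : List α)
    (hn : p.length + q.length + 3 = n) :
    t (x :: x :: p ++ x :: q) = t (x :: x :: q.reverse ++ x :: p.reverse) := by
  have h1 := h.rev (x :: x :: p ++ x :: q) (by simp; omega)
  have h2 := h.cyc (q.reverse ++ x :: p.reverse) [x, x] (by simp; omega)
  simp only [List.reverse_append, List.reverse_cons, List.cons_append, List.nil_append,
    List.append_assoc] at *
  rw [← h1, h2]

lemma IsWordFun.three_eq (h : IsWordFun n t) (x : α) (p q r : List α) (hp : p ≠ []) (hq : q ≠ [])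
    (hn : p.length + q.length + r.length + 3 = n) :
    t (x :: p ++ x :: q ++ x :: r) = - t (x :: x :: (p ++ q) ++ x :: r) +
      t (x :: x :: (r ++ p) ++ x :: q) := by
  have h1 := h.sym [x] [x] p (q ++ x :: r) (by simp) (by simp) hp (by simp) (by simp; omega)
  have h2 := h.cyc p (x :: x :: (q ++ x :: r)) (by simp; omega)
  have h3 := h.swap x q (r ++ p) hq (by simp; omega)
  simp only [List.cons_append, List.nil_append, List.append_assoc] at *
  linear_combination h1 / 2 - h2 - h3

lemma IsWordFun.three_cyc (h : IsWordFun n t) (x : α) (p q r : List α)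
    (hn : p.length + q.length + r.length + 3 = n) :
    t (x :: p ++ x :: q ++ x :: r) = t (x :: q ++ x :: r ++ x :: p) := by
  have h1 := h.cyc (x :: p) (x :: q ++ x :: r) (by simp; omega)
  simp only [List.cons_append, List.append_assoc] at *
  exact h1

lemma IsWordFun.three (h : IsWordFun n t) (x : α) (p q r : List α) (hp : p ≠ []) (hq : q ≠ [])
    (hr : r ≠ []) (hn : p.length + q.length + r.length + 3 = n) :
    t (x :: p ++ x :: q ++ x :: r) = 0 ∧
    t (x :: x :: (p ++ q) ++ x :: r) = t (x :: x :: (q ++ r) ++ x :: p) := by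
  have a1 := h.three_eq x p q r hp hq hn
  have a2 := h.three_eq x q r p hq hr (by omega)
  have a3 := h.three_eq x r p q hr hp (by omega)
  have c1 := h.three_cyc x p q r hn
  have c2 := h.three_cyc x q r p (by omega)
  have h0 : t (x :: p ++ x :: q ++ x :: r) = 0 := by
    linear_combination (a1 + a2 + a3) / 3 + 2 / 3 * c1 + c2 / 3
  exact ⟨h0, by linear_combination h0 - c1 - a2⟩

lemma IsWordFun.shift (h : IsWordFun n t) (x : α) (p q r : List α) (hp : p ≠ []) (hq : q ≠ [])
    (hr : r ≠ []) (hn : p.length + q.length + r.length + 3 = n) :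
    t (x :: x :: (p ++ q) ++ x :: r) = - t (x :: x :: p ++ x :: (q ++ r)) := by
  rw [(h.three x p q r hp hq hr hn).2, h.swap x (q ++ r) p (by simp [hq]) (by simp; omega)]

/-- If two of the three `x` are adjacent. -/
lemma IsWordFun.double_of_four (h : IsWordFun n t) (x : α) (a b c d : List α) (ha : a ≠ [])
    (hb : b ≠ []) (hc : c ≠ []) (hd : d ≠ [])
    (hn : a.length + b.length + c.length + d.length + 3 = n) :
    t (x :: x :: a ++ x :: (b ++ c ++ d)) = 0 ∧ t (x :: x :: (a ++ b) ++ x :: (c ++ d)) = 0 ∧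
    t (x :: x :: (a ++ b ++ c) ++ x :: d) = 0 := by
  have h1 := h.shift x a b (c ++ d) ha hb (by simp [hc]) (by simp; omega)
  have h2 := h.shift x (a ++ b) c d (by simp [ha]) hc hd (by simp; omega)
  have h3 := h.shift x a (b ++ c) d ha (by simp [hb]) hd (by simp; omega)
  simp only [List.append_assoc] at *
  refine ⟨?_, ?_, ?_⟩
  · linear_combination (h3 - h2 + h1) / 2
  · linear_combination (h1 + h2 - h3) / 2
  · linear_combination (h2 + h3 - h1) / 2

lemma IsWordFun.double (h : IsWordFun n t) (hn6 : 7 ≤ n) (x : α) (p q : List α) (hp : p ≠ [])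
    (hq : q ≠ []) (hn : p.length + q.length + 3 = n) : t (x :: x :: p ++ x :: q) = 0 := by
  rcases p with _ | ⟨a, _ | ⟨b, _ | ⟨c, p⟩⟩⟩
  · simp at hp
  · rcases q with _ | ⟨b, _ | ⟨c, _ | ⟨d, q⟩⟩⟩ <;> simp at hn <;> try omega
    simpa using (h.double_of_four x [a] [b] [c] (d :: q) (by simp) (by simp) (by simp) (by simp)
      (by simp; omega)).1
  · rcases q with _ | ⟨c, _ | ⟨d, q⟩⟩ <;> simp at hn <;> try omega
    simpa using (h.double_of_four x [a] [b] [c] (d :: q) (by simp) (by simp) (by simp) (by simp)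
      (by simp; omega)).2.1
  · simpa using (h.double_of_four x [a] [b] (c :: p) q (by simp) (by simp) (by simp) hq
      (by simp at *; omega)).2.2

lemma exists_eq_of_succ_le_count {w : List (Fin 3)} {x : Fin 3} {k : ℕ}
    (hw : k + 1 ≤ w.count x) : ∃ p w', w = p ++ x :: w' ∧ k ≤ w'.count x := by
  induction w generalizing k with
  | nil => simp at hw
  | cons a w ih =>
    by_cases hax : a = x
    · exact ⟨[], w, by simp [hax], by simpa [hax] using hw⟩
    · obtain ⟨p, w', rfl, hw'⟩ := ih (k := k) (by simpa [List.count_cons, hax] using hw)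
      exact ⟨a :: p, w', by simp, hw'⟩

lemma exists_eq_of_three_le_count {w : List (Fin 3)} {x : Fin 3} (hw : 3 ≤ w.count x) :
    ∃ p q r s, w = p ++ x :: q ++ x :: r ++ x :: s := by
  obtain ⟨p, w₁, rfl, h₁⟩ := exists_eq_of_succ_le_count hw
  obtain ⟨q, w₂, rfl, h₂⟩ := exists_eq_of_succ_le_count h₁
  obtain ⟨r, w₃, rfl, h₃⟩ := exists_eq_of_succ_le_count h₂
  exact ⟨p, q, r, w₃, by simp⟩

lemma IsWordFun.eq_zero_of_double {t : List (Fin 3) → ℂ} (h : IsWordFun n t) (hn4 : 4 ≤ n)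
    (hd : ∀ x p q, p ≠ [] → q ≠ [] → p.length + q.length + 3 = n → t (x :: x :: p ++ x :: q) = 0)
    {w : List (Fin 3)} {x : Fin 3} (hw : w.length = n) (hx : 3 ≤ w.count x) : t w = 0 := by
  have key : ∀ p q, p.length + q.length + 3 = n → t (x :: x :: p ++ x :: q) = 0 := by
    intro p q hpq
    by_cases hp : p = []
    · subst hp
      exact h.cube x q (by rintro rfl; simp at hpq; omega) (by simpa using hpq)
    · by_cases hq : q = []
      · subst hq
        rw [h.cyc _ _ (by simp; simp at hpq; omega)]
        exact h.cube x p hp (by simpa using hpq)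
      · exact hd x p q hp hq hpq
  obtain ⟨p, q, r, s, rfl⟩ := exists_eq_of_three_le_count hx
  have e := h.cyc p (x :: q ++ x :: r ++ x :: s) (by simpa using hw)
  have hw' : p.length + q.length + r.length + s.length + 3 = n := by
    simp at hw; omega
  simp only [List.append_assoc, List.cons_append] at e ⊢
  rw [e]
  by_cases hq : q = []
  · subst hq
    have := key r (s ++ p) (by simp at *; omega)
    simpa using this
  by_cases hr : r = []
  · subst hr
    have e' := h.cyc (x :: q) (x :: x :: (s ++ p)) (by simp at *; omega)
    have := key (s ++ p) q (by simp at *; omega)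
    simp only [List.append_assoc, List.cons_append, List.nil_append] at *
    rw [e', this]
  by_cases hsp : s ++ p = []
  · have hl := congrArg List.length hsp
    simp only [List.length_append, List.length_nil] at hl
    have e' := h.cyc (x :: q ++ x :: r) [x] (by simp; omega)
    have := key q r (by omega)
    rw [hsp]
    simp only [List.append_assoc, List.cons_append, List.nil_append] at *
    rw [e', this]
  · have := (h.three x q r (s ++ p) hq hr hsp (by simp; omega)).1
    simpa using this

lemma IsWordFun.xxyyzz (h : IsWordFun 6 t) (x y z : α) : t [x, x, y, y, z, z] = 0 := by
  have s1 : t [x, x, y, y, z, z] + t [x, y, x, y, z, z] + t [x, x, y, y, z, z] +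
      t [x, y, x, y, z, z] + t [y, x, x, y, z, z] + t [y, x, x, y, z, z] = 0 :=
    h.sym [x] [x] [y] [y, z, z] (by simp) (by simp) (by simp) (by simp) rfl
  have s2 : t [x, x, y, y, z, z] + t [x, x, y, y, z, z] + t [y, x, x, y, z, z] +
      t [y, y, x, x, z, z] + t [y, x, x, y, z, z] + t [y, y, x, x, z, z] = 0 :=
    h.sym [x, x] [y] [y] [z, z] (by simp) (by simp) (by simp) (by simp) rfl
  have s3 : t [x, x, y, y, z, z] + t [x, x, z, y, y, z] + t [y, y, x, x, z, z] +
      t [y, y, z, x, x, z] + t [z, x, x, y, y, z] + t [z, y, y, x, x, z] = 0 :=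
    h.sym [x, x] [y, y] [z] [z] (by simp) (by simp) (by simp) (by simp) rfl
  have s4 : t [x, x, y, z, z, y] + t [x, y, z, x, z, y] + t [x, x, y, z, z, y] +
      t [x, y, z, x, z, y] + t [y, z, x, x, z, y] + t [y, z, x, x, z, y] = 0 :=
    h.sym [x] [x] [y, z] [z, y] (by simp) (by simp) (by simp) (by simp) rfl
  have s5 : t [x, y, x, y, z, z] + t [x, z, y, x, y, z] + t [y, x, y, x, z, z] +
      t [y, x, y, z, x, z] + t [z, x, y, x, y, z] + t [z, y, x, y, x, z] = 0 :=
    h.sym [x] [y, x, y] [z] [z] (by simp) (by simp) (by simp) (by simp) rfl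
  have e1 : t [y, x, x, y, z, z] = t [x, x, y, z, z, y] :=
    h.cyc [y] [x, x, y, z, z] rfl
  have e2 : t [y, y, x, x, z, z] = t [x, x, y, y, z, z] :=
    ((h.rev [y, y, x, x, z, z] rfl).symm.trans (h.cyc [z, z] [x, x, y, y] rfl))
  have e3 : t [y, y, z, x, x, z] = t [x, x, z, y, y, z] :=
    h.cyc [y, y, z] [x, x, z] rfl
  have e4 : t [z, x, x, y, y, z] = t [x, x, y, y, z, z] :=
    h.cyc [z] [x, x, y, y, z] rfl
  have e5 : t [z, y, y, x, x, z] = t [x, x, y, y, z, z] :=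
    ((h.rev [z, y, y, x, x, z] rfl).symm.trans (h.cyc [z] [x, x, y, y, z] rfl))
  have e6 : t [y, z, x, x, z, y] = t [x, x, z, y, y, z] :=
    h.cyc [y, z] [x, x, z, y] rfl
  have e7 : t [x, z, y, x, y, z] = t [x, y, z, x, z, y] :=
    h.cyc [x, z, y] [x, y, z] rfl
  have e8 : t [y, x, y, x, z, z] = t [x, y, x, y, z, z] :=
    ((h.rev [y, x, y, x, z, z] rfl).symm.trans (h.cyc [z, z] [x, y, x, y] rfl))
  have e9 : t [y, x, y, z, x, z] = t [x, y, z, x, z, y] :=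
    h.cyc [y] [x, y, z, x, z] rfl
  have e10 : t [z, x, y, x, y, z] = t [x, y, x, y, z, z] :=
    h.cyc [z] [x, y, x, y, z] rfl
  have e11 : t [z, y, x, y, x, z] = t [x, y, x, y, z, z] :=
    ((h.rev [z, y, x, y, x, z] rfl).symm.trans (h.cyc [z] [x, y, x, y, z] rfl))
  linear_combination (-1/6) * s1 + (1/4) * s2 + (1/12) * s3 + (-1/12) * s4 + (1/12) * s5 +
    (-1/6) * e1 + (-7/12) * e2 + (-1/12) * e3 + (-1/12) * e4 + (-1/12) * e5 +
    (1/6) * e6 + (-1/12) * e7 + (-1/12) * e8 + (-1/12) * e9 + (-1/12) * e10 +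
    (-1/12) * e11

lemma IsWordFun.xxyzyz (h : IsWordFun 6 t) (x y z : α) : t [x, x, y, z, y, z] = 0 := by
  have hG := h.xxyyzz x y z
  have s1 : t [x, x, y, y, z, z] + t [x, x, y, y, z, z] + t [y, x, x, y, z, z] +
      t [y, y, x, x, z, z] + t [y, x, x, y, z, z] + t [y, y, x, x, z, z] = 0 :=
    h.sym [x, x] [y] [y] [z, z] (by simp) (by simp) (by simp) (by simp) rfl
  have s2 : t [x, x, y, y, z, z] + t [x, x, y, z, y, z] + t [y, x, x, y, z, z] +
      t [y, z, x, x, y, z] + t [z, x, x, y, y, z] + t [z, y, x, x, y, z] = 0 :=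
    h.sym [x, x, y] [y] [z] [z] (by simp) (by simp) (by simp) (by simp) rfl
  have e1 : t [y, x, x, y, z, z] = t [x, x, y, z, z, y] :=
    h.cyc [y] [x, x, y, z, z] rfl
  have e2 : t [y, y, x, x, z, z] = t [x, x, y, y, z, z] :=
    ((h.rev [y, y, x, x, z, z] rfl).symm.trans (h.cyc [z, z] [x, x, y, y] rfl))
  have e3 : t [y, z, x, x, y, z] = t [x, x, y, z, y, z] :=
    h.cyc [y, z] [x, x, y, z] rfl
  have e4 : t [z, x, x, y, y, z] = t [x, x, y, y, z, z] :=
    h.cyc [z] [x, x, y, y, z] rfl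
  have e5 : t [z, y, x, x, y, z] = t [x, x, y, z, z, y] :=
    h.cyc [z, y] [x, x, y, z] rfl
  linear_combination (-1/2) * s1 + (1/2) * s2 + (1) * hG + (1/2) * e1 + (1) * e2 +
    (-1/2) * e3 + (-1/2) * e4 + (-1/2) * e5

lemma IsWordFun.xxyzzy (h : IsWordFun 6 t) (x y z : α) : t [x, x, y, z, z, y] = 0 := by
  have hG := h.xxyyzz x y z
  have s1 : t [x, x, y, y, z, z] + t [x, x, y, y, z, z] + t [y, x, x, y, z, z] +
      t [y, y, x, x, z, z] + t [y, x, x, y, z, z] + t [y, y, x, x, z, z] = 0 :=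
    h.sym [x, x] [y] [y] [z, z] (by simp) (by simp) (by simp) (by simp) rfl
  have e1 : t [y, x, x, y, z, z] = t [x, x, y, z, z, y] :=
    h.cyc [y] [x, x, y, z, z] rfl
  have e2 : t [y, y, x, x, z, z] = t [x, x, y, y, z, z] :=
    ((h.rev [y, y, x, x, z, z] rfl).symm.trans (h.cyc [z, z] [x, x, y, y] rfl))
  linear_combination (1/2) * s1 + (-2) * hG + (-1) * e1 + (-1) * e2

lemma IsWordFun.double_six {t : List (Fin 3) → ℂ} (h : IsWordFun 6 t) (x a b c : Fin 3) :
    t [x, x, a, x, b, c] = 0 := by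
  have anti : ∀ a b c, t [x, x, a, x, b, c] = - t [x, x, a, x, c, b] := by
    intro a b c
    have h1 := h.swap x [a] [c, b] (by simp) rfl
    have h2 := h.flip x [a] [b, c] rfl
    simp only [List.cons_append, List.nil_append, List.reverse_cons, List.reverse_nil] at h1 h2
    rw [h2, h1, neg_neg]
  have rot : ∀ a b c, t [x, x, a, x, b, c] = t [x, x, b, x, c, a] := by
    intro a b c
    have h1 := (h.three x [a] [b] [c] (by simp) (by simp) (by simp) rfl).2
    have h2 := h.swap x [a] [b, c] (by simp) rfl
    have h3 := h.swap x [b] [c, a] (by simp) rfl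
    have h4 := (h.three x [b] [c] [a] (by simp) (by simp) (by simp) rfl).2
    simp only [List.cons_append, List.nil_append] at h1 h2 h3 h4
    rw [h2, h3, h4]
  have hx : ∀ b c, t [x, x, x, x, b, c] = 0 := fun b c => h.cube x [x, b, c] (by simp) rfl
  have heq : ∀ a b, t [x, x, a, x, b, b] = 0 := fun a b => by linear_combination anti a b b / 2
  by_cases hbc : b = c
  · subst hbc; exact heq a b
  by_cases hab : a = b
  · subst hab; rw [rot, rot]; exact heq c a
  by_cases hac : a = c
  · subst hac; rw [rot]; exact heq b a
  have : x = a ∨ x = b ∨ x = c := by omega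
  rcases this with rfl | rfl | rfl
  · exact hx b c
  · rw [rot]; exact hx c a
  · rw [rot, rot]; exact hx a b

lemma count_add_count_add_count (w : List (Fin 3)) :
    w.count 0 + w.count 1 + w.count 2 = w.length := by
  induction w with
  | nil => simp
  | cons a w ih => fin_cases a <;> simp <;> omega

lemma exists_eq_of_two_le_count {w : List (Fin 3)} {x : Fin 3} (hw : 2 ≤ w.count x) :
    ∃ p q r, w = p ++ x :: q ++ x :: r := by
  obtain ⟨p, w₁, rfl, h₁⟩ := exists_eq_of_succ_le_count hw
  obtain ⟨q, w₂, rfl, -⟩ := exists_eq_of_succ_le_count h₁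
  exact ⟨p, q, w₂, by simp⟩

lemma IsWordFun.eq_zero_of_pair {t : List (Fin 3) → ℂ} (h : IsWordFun n t)
    {x : Fin 3} (hxx : ∀ v, v.length + 2 = n → t (x :: x :: v) = 0)
    {w : List (Fin 3)} (hw : w.length = n) (hx : 2 ≤ w.count x) : t w = 0 := by
  obtain ⟨p, q, r, rfl⟩ := exists_eq_of_two_le_count hx
  have hw' : p.length + q.length + r.length + 2 = n := by simp at hw; omega
  have e := h.cyc p (x :: q ++ x :: r) (by simpa using hw)
  simp only [List.append_assoc, List.cons_append] at e ⊢
  rw [e]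
  by_cases hq : q = []
  · subst hq
    simpa using hxx (r ++ p) (by simp at *; omega)
  by_cases hrp : r ++ p = []
  · have hl := congrArg List.length hrp
    simp only [List.length_append, List.length_nil] at hl
    have e' := h.cyc (x :: q) [x] (by simp; omega)
    rw [hrp]
    simp only [List.cons_append, List.nil_append] at e' ⊢
    rw [e', hxx q (by omega)]
  · have h1 := h.sym [x] [x] q (r ++ p) (by simp) (by simp) hq hrp (by simp; omega)
    have h2 := h.cyc q (x :: x :: (r ++ p)) (by simp; omega)
    have h3 := hxx (q ++ (r ++ p)) (by simp; omega)
    have h4 := hxx ((r ++ p) ++ q) (by simp; omega)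
    simp only [List.append_assoc, List.cons_append, List.nil_append] at *
    linear_combination h1 / 2 - h3 - h2 - h4

lemma paired_or_triple (x a b c d : Fin 3) : (a = b ∧ c = d) ∨ (a = c ∧ b = d) ∨
    (a = d ∧ b = c) ∨ ∃ y, 3 ≤ [x, x, a, b, c, d].count y := by
  revert x a b c d; decide

lemma paired_or_triple' (z a b c d : Fin 3) (hz : [z, a, b, c, d].count z = 1) :
    (a = b ∧ c = d) ∨ (a = c ∧ b = d) ∨
    (a = d ∧ b = c) ∨ ∃ y, 3 ≤ [z, a, b, c, d].count y := by
  revert z a b c d; decide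

lemma IsWordFun.eq_zero_six {t : List (Fin 3) → ℂ} (h : IsWordFun 6 t)
    {w : List (Fin 3)} (hw : w.length = 6) : t w = 0 := by
  have htriple : ∀ {w : List (Fin 3)} {x : Fin 3}, w.length = 6 → 3 ≤ w.count x → t w = 0 := by
    refine fun {w x} => h.eq_zero_of_double (by norm_num) ?_
    intro x p q hp hq hpq
    obtain ⟨a, p, rfl⟩ := List.exists_cons_of_ne_nil hp
    obtain ⟨b, q, rfl⟩ := List.exists_cons_of_ne_nil hq
    rcases p with _ | ⟨c, _ | ⟨d, p⟩⟩
    · rcases q with _ | ⟨c, _ | ⟨d, q⟩⟩ <;> simp at hpq <;> try omega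
      exact h.double_six x a b c
    · rcases q with _ | ⟨d, q⟩ <;> simp at hpq <;> try omega
      rw [h.swap x [a, c] [b] (by simp) rfl]
      simpa using h.double_six x b a c
    · simp at hpq; omega
  have hcount := count_add_count_add_count w
  have : ∃ x, 2 ≤ w.count x := by
    by_contra! hcon
    have h0 := hcon 0
    have h1 := hcon 1
    have h2 := hcon 2
    omega
  obtain ⟨x, hx⟩ := this
  refine h.eq_zero_of_pair ?_ hw hx
  intro v hv
  rcases v with _ | ⟨a, _ | ⟨b, _ | ⟨c, _ | ⟨d, _ | ⟨e, v⟩⟩⟩⟩⟩ <;> simp at hv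
  rcases paired_or_triple x a b c d with ⟨rfl, rfl⟩ | ⟨rfl, rfl⟩ | ⟨rfl, rfl⟩ | ⟨y, hy⟩
  · exact h.xxyyzz x a c
  · exact h.xxyzyz x a b
  · exact h.xxyzzy x a b
  · exact htriple rfl hy

lemma IsWordFun.eq_zero_five {t : List (Fin 3) → ℂ} (h : IsWordFun 5 t)
    (h5 : ∀ x y z, [x, x, y, y, z].count z = 1 → (∀ u, [x, x, y, y, z].count u ≤ 2) →
      t [x, x, y, y, z] = 0)
    {w : List (Fin 3)} (hw : w.length = 5) : t w = 0 := by
  have htriple : ∀ {w : List (Fin 3)} {x : Fin 3}, w.length = 5 → 3 ≤ w.count x → t w = 0 := by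
    refine fun {w x} => h.eq_zero_of_double (by norm_num) ?_
    intro x p q hp hq hpq
    obtain ⟨a, p, rfl⟩ := List.exists_cons_of_ne_nil hp
    obtain ⟨b, q, rfl⟩ := List.exists_cons_of_ne_nil hq
    have hp' : p = [] := List.eq_nil_of_length_eq_zero (by simp at hpq; omega)
    have hq' : q = [] := List.eq_nil_of_length_eq_zero (by simp at hpq; omega)
    subst hp' hq'
    have h1 := h.swap x [a] [b] (by simp) rfl
    have h2 := h.flip x [a] [b] rfl
    simp only [List.reverse_cons, List.reverse_nil, List.nil_append] at h2
    linear_combination h1 / 2 + h2 / 2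
  by_cases hcon : ∃ x, 3 ≤ w.count x
  · obtain ⟨x, hx⟩ := hcon
    exact htriple hw hx
  push Not at hcon
  have hcount := count_add_count_add_count w
  have : ∃ z, w.count z = 1 := by
    have h0 := hcon 0
    have h1 := hcon 1
    have h2 := hcon 2
    by_contra! hne
    have h0' := hne 0
    have h1' := hne 1
    have h2' := hne 2
    omega
  obtain ⟨z, hz⟩ := this
  obtain ⟨p, v, rfl, -⟩ := exists_eq_of_succ_le_count (k := 0) hz.ge
  rw [h.cyc _ _ hw]
  have hcon' : ∀ y, (z :: v ++ p).count y ≤ 2 := fun y => by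
    have := hcon y
    simp only [List.count_append] at this ⊢
    omega
  have hz' : (z :: v ++ p).count z = 1 := by
    simp only [List.count_append] at hz ⊢
    omega
  have hv : (v ++ p).length = 4 := by simp at hw ⊢; omega
  rw [List.cons_append] at hcon' hz' ⊢
  generalize v ++ p = v at *
  rcases v with _ | ⟨a, _ | ⟨b, _ | ⟨c, _ | ⟨d, _ | ⟨e, v⟩⟩⟩⟩⟩ <;> simp at hv
  have hfive : ∀ x y, [z, x, x, y, y].count z = 1 → (∀ u, [z, x, x, y, y].count u ≤ 2) →
      t [z, x, x, y, y] = 0 ∧ t [z, x, y, x, y] = 0 ∧ t [z, x, y, y, x] = 0 := by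
    intro x y h1 h2
    have e0 : t [z, x, x, y, y] = t [x, x, y, y, z] := h.cyc [z] [x, x, y, y] rfl
    have e1 : t [x, x, y, y, z] = 0 := by
      have hp : List.Perm [x, x, y, y, z] [z, x, x, y, y] :=
        List.perm_append_comm (l₁ := [x, x, y, y]) (l₂ := [z])
      exact h5 x y z (by rw [hp.count_eq, h1]) (fun u => by rw [hp.count_eq]; exact h2 u)
    have s1 : t [x, x, y, y, z] + t [x, y, x, y, z] + t [x, x, y, y, z] +
      t [x, y, x, y, z] + t [y, x, x, y, z] + t [y, x, x, y, z] = 0 :=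
      h.sym [x] [x] [y] [y, z] (by simp) (by simp) (by simp) (by simp) rfl
    have s2 : t [y, y, x, x, z] + t [y, x, y, x, z] + t [y, y, x, x, z] +
      t [y, x, y, x, z] + t [x, y, y, x, z] + t [x, y, y, x, z] = 0 :=
      h.sym [y] [y] [x] [x, z] (by simp) (by simp) (by simp) (by simp) rfl
    have s3 : t [x, x, y, y, z] + t [x, y, y, x, z] + t [x, x, y, y, z] +
      t [x, y, y, x, z] + t [y, y, x, x, z] + t [y, y, x, x, z] = 0 :=
      h.sym [x] [x] [y, y] [z] (by simp) (by simp) (by simp) (by simp) rfl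
    have e2 : t [y, y, x, x, z] = t [z, x, x, y, y] := (h.rev [y, y, x, x, z] rfl).symm
    have e3 : t [z, x, y, x, y] = t [x, y, x, y, z] := h.cyc [z] [x, y, x, y] rfl
    have e4 : t [y, x, y, x, z] = t [z, x, y, x, y] := (h.rev [y, x, y, x, z] rfl).symm
    have e5 : t [z, x, y, y, x] = t [x, y, y, x, z] := h.cyc [z] [x, y, y, x] rfl
    refine ⟨e0.trans e1, ?_, ?_⟩
    · linear_combination s2 / 2 - s3 / 2 + e1 - e4
    · linear_combination e5 + s3 / 2 - e2 - e0 - 2 * e1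
  have perm : ∀ {u v w x : Fin 3}, List.Perm [u, v, w, x] [a, b, c, d] →
      [z, u, v, w, x].count z = 1 ∧ ∀ y, [z, u, v, w, x].count y ≤ 2 := by
    intro u v w x hp
    exact ⟨by rw [(hp.cons z).count_eq, hz'], fun y => by rw [(hp.cons z).count_eq]; exact hcon' y⟩
  rcases paired_or_triple' z a b c d hz' with ⟨rfl, rfl⟩ | ⟨rfl, rfl⟩ | ⟨rfl, rfl⟩ | ⟨y, hy⟩
  · obtain ⟨k1, k2⟩ := perm (List.Perm.refl _)
    exact (hfive a c k1 k2).1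
  · obtain ⟨k1, k2⟩ := perm (u := a) (v := a) (w := b) (x := b)
      (by exact (List.Perm.swap b a [b]).cons a)
    exact (hfive a b k1 k2).2.1
  · obtain ⟨k1, k2⟩ := perm (u := a) (v := a) (w := b) (x := b)
      ((List.perm_append_comm (l₁ := [a]) (l₂ := [b, b])).cons a)
    exact (hfive a b k1 k2).2.2
  · exact absurd (hcon' y) (by omega)

lemma IsWordFun.eq_zero_four {t : List (Fin 3) → ℂ} (h : IsWordFun 4 t)
    (h4 : ∀ x y z, x ≠ y → x ≠ z → t [x, x, y, z] = 0)
    {w : List (Fin 3)} (hw : w.length = 4) : t w = 0 := by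
  have hcount := count_add_count_add_count w
  have : ∃ x, 2 ≤ w.count x := by
    by_contra! hcon
    have h0 := hcon 0
    have h1 := hcon 1
    have h2 := hcon 2
    omega
  obtain ⟨x, hx⟩ := this
  refine h.eq_zero_of_pair ?_ hw hx
  intro v hv
  rcases v with _ | ⟨y, _ | ⟨z, _ | ⟨c, v⟩⟩⟩ <;> simp at hv
  by_cases hy : x = y
  · subst hy; exact h.cube x [z] (by simp) rfl
  by_cases hz : x = z
  · subst hz
    rw [show t [x, x, y, x] = t [x, x, x, y] from h.cyc [x, x, y] [x] rfl]
    exact h.cube x [y] (by simp) rfl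
  exact h4 x y z hy hz

lemma IsWordFun.eq_zero_of_seven_le {t : List (Fin 3) → ℂ} (h : IsWordFun n t) (hn : 7 ≤ n)
    {w : List (Fin 3)} (hw : w.length = n) : t w = 0 := by
  have hcount := count_add_count_add_count w
  have : ∃ x, 3 ≤ w.count x := by
    by_contra! hcon
    have h0 := hcon 0
    have h1 := hcon 1
    have h2 := hcon 2
    omega
  obtain ⟨x, hx⟩ := this
  exact h.eq_zero_of_double (by omega) (fun x p q => h.double hn x p q) hw hx

end WordFunctions

section MatrixWords

open Matrix

/-- The polarised Cayley–Hamilton identity for three by three matrices. -/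
lemma polarised_cayley_hamilton {R : Type*} [CommRing R] (X Y Z : Matrix (Fin 3) (Fin 3) R) :
    X * Y * Z + X * Z * Y + Y * X * Z + Y * Z * X + Z * X * Y + Z * Y * X =
      X.trace • (Y * Z + Z * Y) + Y.trace • (X * Z + Z * X) + Z.trace • (X * Y + Y * X) -
      (X.trace * Y.trace - (X * Y).trace) • Z - (X.trace * Z.trace - (X * Z).trace) • Y -
      (Y.trace * Z.trace - (Y * Z).trace) • X +
      (X.trace * Y.trace * Z.trace - X.trace * (Y * Z).trace - Y.trace * (X * Z).trace -
        Z.trace * (X * Y).trace + (X * Y * Z).trace + (X * Z * Y).trace) • 1 := by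
  ext i j
  fin_cases i <;> fin_cases j <;>
    simp [Matrix.mul_apply, Fin.sum_univ_three, Matrix.trace] <;> ring

/-- Three traceless three by three matrices, self-adjoint with respect to `J`. -/
structure IsSystem {R : Type*} [CommRing R] (J K : Matrix (Fin 3) (Fin 3) R)
    (M : Fin 3 → Matrix (Fin 3) (Fin 3) R) : Prop where
  trace_eq_zero : ∀ i, (M i).trace = 0
  mul_eq : ∀ i, J * M i = (M i)ᵀ * J
  inv_mul : K * J = 1
  mul_inv : J * K = 1

/-- The words in three letters whose traces generate the ring of invariants. -/
def gword : Fin 25 → List (Fin 3) :=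
  ![[0, 0], [0, 1], [0, 2], [1, 1], [1, 2], [2, 2],
    [0, 0, 0], [0, 0, 1], [0, 0, 2], [0, 1, 1], [0, 1, 2], [0, 2, 2],
    [1, 1, 1], [1, 1, 2], [1, 2, 2], [2, 2, 2],
    [0, 0, 1, 1], [0, 0, 2, 2], [1, 1, 2, 2], [0, 0, 1, 2], [1, 1, 0, 2], [2, 2, 0, 1],
    [0, 0, 1, 1, 2], [0, 0, 2, 2, 1], [1, 1, 2, 2, 0]]

/-- The trace of a word in three matrices. -/
def trw {R : Type*} [CommRing R] (M : Fin 3 → Matrix (Fin 3) (Fin 3) R) (w : List (Fin 3)) : R :=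
  (w.map M).prod.trace

variable {R : Type*} [CommRing R] {J K : Matrix (Fin 3) (Fin 3) R}
  {M : Fin 3 → Matrix (Fin 3) (Fin 3) R}

lemma trw_append_comm (p q : List (Fin 3)) : trw M (p ++ q) = trw M (q ++ p) := by
  simp only [trw, List.map_append, List.prod_append]
  exact Matrix.trace_mul_comm _ _

lemma IsSystem.mul_prod_reverse (h : IsSystem J K M) (w : List (Fin 3)) :
    J * (w.reverse.map M).prod = ((w.map M).prod)ᵀ * J := by
  induction w with
  | nil => simp
  | cons a w ih =>
    simp only [List.reverse_cons, List.map_append, List.prod_append, List.map_cons, List.map_nil,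
      List.prod_cons, List.prod_nil, mul_one, Matrix.transpose_mul]
    rw [← Matrix.mul_assoc, ih, Matrix.mul_assoc, h.mul_eq, Matrix.mul_assoc]

lemma IsSystem.trw_reverse (h : IsSystem J K M) (w : List (Fin 3)) :
    trw M w.reverse = trw M w := by
  have h1 : (w.reverse.map M).prod = K * (((w.map M).prod)ᵀ * J) := by
    rw [← h.mul_prod_reverse, ← Matrix.mul_assoc, h.inv_mul, Matrix.one_mul]
  rw [trw, h1, Matrix.trace_mul_comm, Matrix.mul_assoc, h.mul_inv, Matrix.mul_one,
    Matrix.trace_transpose, trw]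

lemma trw_sym (p q r w : List (Fin 3)) :
    trw M (p ++ q ++ r ++ w) + trw M (p ++ r ++ q ++ w) + trw M (q ++ p ++ r ++ w) +
      trw M (q ++ r ++ p ++ w) + trw M (r ++ p ++ q ++ w) + trw M (r ++ q ++ p ++ w) =
    trw M p * (trw M (q ++ r ++ w) + trw M (r ++ q ++ w)) +
    trw M q * (trw M (p ++ r ++ w) + trw M (r ++ p ++ w)) +
    trw M r * (trw M (p ++ q ++ w) + trw M (q ++ p ++ w)) -
    (trw M p * trw M q - trw M (p ++ q)) * trw M (r ++ w) -
    (trw M p * trw M r - trw M (p ++ r)) * trw M (q ++ w) -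
    (trw M q * trw M r - trw M (q ++ r)) * trw M (p ++ w) +
    (trw M p * trw M q * trw M r - trw M p * trw M (q ++ r) - trw M q * trw M (p ++ r) -
      trw M r * trw M (p ++ q) + trw M (p ++ q ++ r) + trw M (p ++ r ++ q)) * trw M w := by
  have h := congrArg (fun A => (A * (w.map M).prod).trace)
    (polarised_cayley_hamilton (p.map M).prod (q.map M).prod (r.map M).prod)
  simpa only [trw, List.map_append, List.prod_append, add_mul, sub_mul, smul_mul_assoc,
    Matrix.one_mul, Matrix.trace_add, Matrix.trace_sub, Matrix.trace_smul, smul_eq_mul,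
    mul_add] using h

variable [Algebra ℂ R]

/-- The algebra generated by the traces of the words `gword j`. -/
def genAlg (M : Fin 3 → Matrix (Fin 3) (Fin 3) R) : Subalgebra ℂ R :=
  Algebra.adjoin ℂ (Set.range fun j => trw M (gword j))

lemma trw_gword_mem (j : Fin 25) : trw M (gword j) ∈ genAlg M :=
  Algebra.subset_adjoin ⟨j, rfl⟩

lemma gword_two (a b : Fin 3) : ∃ j, gword j = [a, b] ∨ gword j = [b, a] := by
  revert a b; decide

lemma gword_three (a b c : Fin 3) : ∃ j, gword j = [a, b, c] ∨ gword j = [b, c, a] ∨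
    gword j = [c, a, b] ∨ gword j = [c, b, a] ∨ gword j = [b, a, c] ∨ gword j = [a, c, b] := by
  revert a b c; decide

lemma gword_four (x y z : Fin 3) (hy : x ≠ y) (hz : x ≠ z) :
    ∃ j, gword j = [x, x, y, z] ∨ gword j = [x, x, z, y] ∨
      gword j = [y, z, x, x] := by
  revert x y z; decide

lemma gword_five (x y z : Fin 3) (hz : [x, x, y, y, z].count z = 1)
    (h : ∀ u, [x, x, y, y, z].count u ≤ 2) :
    ∃ j, gword j = [x, x, y, y, z] ∨ gword j = [y, y, x, x, z] := by
  revert x y z; decide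

lemma IsSystem.trw_mem (h : IsSystem J K M) (w : List (Fin 3)) : trw M w ∈ genAlg M := by
  induction hn : w.length using Nat.strong_induction_on generalizing w with
  | _ n ih =>
  subst hn
  have ih' : ∀ v : List (Fin 3), v.length < w.length → trw M v ∈ genAlg M :=
    fun v hv => ih _ hv v rfl
  by_contra hcon
  obtain ⟨φ, hφ, hle⟩ := Submodule.exists_le_ker_of_notMem
    (p := Subalgebra.toSubmodule (genAlg M)) hcon
  have hφ0 : ∀ v ∈ genAlg M, φ v = 0 := fun v hv => hle hv
  apply hφ
  have hword : IsWordFun w.length fun v => φ (trw M v) := by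
    refine ⟨fun p q _ => by rw [trw_append_comm], fun p _ => by rw [h.trw_reverse], ?_⟩
    intro p q r v hp hq hr hv hlen
    simp only [← map_add]
    rw [trw_sym]
    have lp := List.length_pos_iff.mpr hp
    have lq := List.length_pos_iff.mpr hq
    have lr := List.length_pos_iff.mpr hr
    have lv := List.length_pos_iff.mpr hv
    simp only [List.length_append] at hlen
    apply hφ0
    refine add_mem (sub_mem (sub_mem (sub_mem (add_mem (add_mem (mul_mem ?_ (add_mem ?_ ?_))
      (mul_mem ?_ (add_mem ?_ ?_))) (mul_mem ?_ (add_mem ?_ ?_)))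
      (mul_mem (sub_mem (mul_mem ?_ ?_) ?_) ?_)) (mul_mem (sub_mem (mul_mem ?_ ?_) ?_) ?_))
      (mul_mem (sub_mem (mul_mem ?_ ?_) ?_) ?_))
      (mul_mem (add_mem (add_mem (sub_mem (sub_mem (sub_mem (mul_mem (mul_mem ?_ ?_) ?_)
        (mul_mem ?_ ?_)) (mul_mem ?_ ?_)) (mul_mem ?_ ?_)) ?_) ?_) ?_) <;>
    · apply ih'
      try simp only [List.length_append]
      omega
  have hgen : ∀ v j, gword j = v → φ (trw M v) = 0 := by
    rintro v j rfl
    exact hφ0 _ (trw_gword_mem j)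
  obtain hn | hn | hn | hn | hn | hn | hn | hn : w.length = 0 ∨ w.length = 1 ∨ w.length = 2 ∨
    w.length = 3 ∨ w.length = 4 ∨ w.length = 5 ∨ w.length = 6 ∨ 7 ≤ w.length := by omega
  · obtain rfl := List.eq_nil_of_length_eq_zero hn
    apply hφ0
    simp only [trw, List.map_nil, List.prod_nil, Matrix.trace_one]
    exact natCast_mem _ _
  · obtain ⟨a, rfl⟩ := List.length_eq_one_iff.mp hn
    simp [trw, h.trace_eq_zero]
  · obtain ⟨a, b, rfl⟩ := List.length_eq_two.mp hn
    obtain ⟨j, hj | hj⟩ := gword_two a b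
    · exact hgen _ j hj
    · rw [show trw M [a, b] = trw M [b, a] from trw_append_comm [a] [b]]
      exact hgen _ j hj
  · obtain ⟨a, b, c, rfl⟩ := List.length_eq_three.mp hn
    have e1 : trw M [a, b, c] = trw M [b, c, a] := trw_append_comm [a] [b, c]
    have e2 : trw M [a, b, c] = trw M [c, a, b] := trw_append_comm [a, b] [c]
    have e3 : trw M [c, b, a] = trw M [a, b, c] := h.trw_reverse [a, b, c]
    have e4 : trw M [c, b, a] = trw M [b, a, c] := trw_append_comm [c] [b, a]
    have e5 : trw M [c, b, a] = trw M [a, c, b] := trw_append_comm [c, b] [a]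
    obtain ⟨j, hj | hj | hj | hj | hj | hj⟩ := gword_three a b c
    · exact hgen _ j hj
    · rw [e1]; exact hgen _ j hj
    · rw [e2]; exact hgen _ j hj
    · rw [← e3]; exact hgen _ j hj
    · rw [← e3, e4]; exact hgen _ j hj
    · rw [← e3, e5]; exact hgen _ j hj
  · rw [hn] at hword
    refine hword.eq_zero_four ?_ hn
    intro x y z hy hz
    obtain ⟨j, hj | hj | hj⟩ := gword_four x y z hy hz
    · exact hgen _ j hj
    · have e : trw M [x, x, y, z] = trw M [x, x, z, y] :=
        (trw_append_comm [x, x] [y, z]).trans (h.trw_reverse [x, x, z, y])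
      simp only [e]
      exact hgen _ j hj
    · have e : trw M [x, x, y, z] = trw M [y, z, x, x] := trw_append_comm [x, x] [y, z]
      simp only [e]
      exact hgen _ j hj
  · rw [hn] at hword
    refine hword.eq_zero_five ?_ hn
    intro x y z h1 h2
    obtain ⟨j, hj | hj⟩ := gword_five x y z h1 h2
    · exact hgen _ j hj
    · have e : trw M [x, x, y, y, z] = trw M [y, y, x, x, z] :=
        (trw_append_comm [x, x, y, y] [z]).trans (h.trw_reverse [y, y, x, x, z])
      simp only [e]
      exact hgen _ j hj
  · rw [hn] at hword
    exact hword.eq_zero_six hn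
  · exact hword.eq_zero_of_seven_le hn rfl

end MatrixWords

open BinInv

/-- The coordinate ring of the space of triples of quartic forms. -/
abbrev Coord := MvPolynomial (Idx ![4, 4, 4]) ℂ

lemma four_eq (i : Fin 3) : (![4, 4, 4] : Fin 3 → ℕ) i = 4 := by fin_cases i <;> rfl

/-- The index of the `k`-th coefficient of the `i`-th form. -/
def ix (i : Fin 3) (k : Fin 5) : Idx ![4, 4, 4] := ⟨i, Fin.cast (by rw [four_eq]) k⟩

/-- The position of a coefficient in its form. -/
def pos (j : Idx ![4, 4, 4]) : Fin 5 := Fin.cast (by rw [four_eq]) j.2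

@[simp] lemma pos_ix (i k) : pos (ix i k) = k := rfl

@[simp] lemma ix_fst (i k) : (ix i k).1 = i := rfl

@[simp] lemma ix_pos (j) : ix j.1 (pos j) = j := rfl

lemma formAt_eq (c : Idx ![4, 4, 4] → ℂ) (i : Fin 3) :
    formAt ![4, 4, 4] c i =
      ∑ k : Fin 5, C (c (ix i k)) * X 0 ^ (4 - (k : ℕ)) * X 1 ^ (k : ℕ) := by
  fin_cases i <;> rfl

lemma coeffAt_formAt (c : Idx ![4, 4, 4] → ℂ) (i : Fin 3) (k : Fin 5) :
    coeffAt ![4, 4, 4] (ix i k) (formAt ![4, 4, 4] c i) = c (ix i k) := by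
  rw [formAt_eq, coeffAt, coeff_sum, Finset.sum_eq_single k]
  · rw [X_pow_eq_monomial, X_pow_eq_monomial, C_mul_monomial, monomial_mul, mul_one, mul_one]
    show coeff (Finsupp.single 0 (![4, 4, 4] i - (k : ℕ)) + Finsupp.single 1 (k : ℕ)) _ = _
    rw [four_eq, coeff_monomial, if_pos rfl]
  · intro l _ hl
    rw [X_pow_eq_monomial, X_pow_eq_monomial, C_mul_monomial, monomial_mul, coeff_monomial, if_neg]
    intro h
    have := DFunLike.congr_fun h 1
    simp at this
    exact hl (Fin.ext this)
  · simp

/-- The action of a substitution on the coefficients of a quartic form. -/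
def act5 {R : Type*} [CommRing R] (p q r s : R) (a : Fin 5 → R) : Fin 5 → R :=
  ![p ^ 4 * a 0 + 4 * p ^ 3 * r * a 1 +
      6 * p ^ 2 * r ^ 2 * a 2 +
      4 * p * r ^ 3 * a 3 + r ^ 4 * a 4,
    p ^ 3 * q * a 0 + (3 * p ^ 2 * q * r + p ^ 3 * s) * a 1 +
      (3 * p * q * r ^ 2 + 3 * p ^ 2 * r * s) * a 2 +
      (q * r ^ 3 + 3 * p * r ^ 2 * s) * a 3 + r ^ 3 * s * a 4,
    p ^ 2 * q ^ 2 * a 0 + (2 * p * q ^ 2 * r + 2 * p ^ 2 * q * s) * a 1 +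
      (q ^ 2 * r ^ 2 + 4 * p * q * r * s + p ^ 2 * s ^ 2) * a 2 +
      (2 * q * r ^ 2 * s + 2 * p * r * s ^ 2) * a 3 + r ^ 2 * s ^ 2 * a 4,
    p * q ^ 3 * a 0 + (q ^ 3 * r + 3 * p * q ^ 2 * s) * a 1 +
      (3 * q ^ 2 * r * s + 3 * p * q * s ^ 2) * a 2 +
      (3 * q * r * s ^ 2 + p * s ^ 3) * a 3 + r * s ^ 3 * a 4,
    q ^ 4 * a 0 + 4 * q ^ 3 * s * a 1 +
      6 * q ^ 2 * s ^ 2 * a 2 +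
      4 * q * s ^ 3 * a 3 + s ^ 4 * a 4]

/-- The binomial coefficients. -/
def binom4 : Fin 5 → ℂ := ![1, 4, 6, 4, 1]

lemma binom4_ne_zero (k : Fin 5) : binom4 k ≠ 0 := by fin_cases k <;> simp [binom4]

/-- The point of the space of triples of quartic forms with the given normalised coefficients. -/
def toPt (a : Fin 3 → Fin 5 → ℂ) : Idx ![4, 4, 4] → ℂ := fun j => binom4 (pos j) * a j.1 (pos j)

lemma exists_toPt (c : Idx ![4, 4, 4] → ℂ) : ∃ a, c = toPt a := by
  refine ⟨fun i k => (binom4 k)⁻¹ * c (ix i k), ?_⟩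
  ext j
  simp [toPt, mul_inv_cancel_left₀ (binom4_ne_zero _)]

lemma sl2Act_formAt (g : Matrix.SpecialLinearGroup (Fin 2) ℂ) (a : Fin 3 → Fin 5 → ℂ) (i : Fin 3) :
    sl2Act g (formAt ![4, 4, 4] (toPt a) i) = formAt ![4, 4, 4] (toPt fun i =>
      act5 ((↑(g⁻¹) : Matrix (Fin 2) (Fin 2) ℂ) 0 0) ((↑(g⁻¹) : Matrix (Fin 2) (Fin 2) ℂ) 0 1)
        ((↑(g⁻¹) : Matrix (Fin 2) (Fin 2) ℂ) 1 0) ((↑(g⁻¹) : Matrix (Fin 2) (Fin 2) ℂ) 1 1)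
        (a i)) i := by
  rw [formAt_eq, formAt_eq, sl2Act]
  generalize (↑(g⁻¹) : Matrix (Fin 2) (Fin 2) ℂ) = h
  simp only [Fin.sum_univ_five, Fin.sum_univ_two, map_add, map_mul, map_pow, aeval_X, toPt, pos_ix,
    ix_fst, binom4, act5, algHom_C, algebraMap_eq]
  simp only [map_mul, map_pow, map_add, show (C 2 : MvPolynomial (Fin 2) ℂ) = 2 from map_ofNat C 2,
    show (C 3 : MvPolynomial (Fin 2) ℂ) = 3 from map_ofNat C 3,
    show (C 4 : MvPolynomial (Fin 2) ℂ) = 4 from map_ofNat C 4,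
    show (C 6 : MvPolynomial (Fin 2) ℂ) = 6 from map_ofNat C 6, Matrix.cons_val, map_one,
    Fin.isValue, Fin.coe_ofNat_eq_mod]
  norm_num
  ring

lemma actPt_toPt (g : Matrix.SpecialLinearGroup (Fin 2) ℂ) (a : Fin 3 → Fin 5 → ℂ) :
    actPt ![4, 4, 4] g (toPt a) = toPt fun i =>
      act5 ((↑(g⁻¹) : Matrix (Fin 2) (Fin 2) ℂ) 0 0) ((↑(g⁻¹) : Matrix (Fin 2) (Fin 2) ℂ) 0 1)
        ((↑(g⁻¹) : Matrix (Fin 2) (Fin 2) ℂ) 1 0) ((↑(g⁻¹) : Matrix (Fin 2) (Fin 2) ℂ) 1 1)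
        (a i) := by
  ext j
  rw [actPt, sl2Act_formAt]
  exact coeffAt_formAt _ j.1 (pos j)

/-- The self-adjoint matrix of a quartic form. -/
def mat {R : Type*} [CommRing R] (a : Fin 5 → R) : Matrix (Fin 3) (Fin 3) R :=
  !![a 2, -2 * a 1, a 0; a 3, -2 * a 2, a 1; a 4, -2 * a 3, a 2]

/-- The inverse of `J₃`. -/
def K₃ (R : Type*) [CommRing R] [Algebra ℂ R] : Matrix (Fin 3) (Fin 3) R :=
  !![0, 0, 1; 0, - algebraMap ℂ R (1 / 2), 0; 1, 0, 0]

lemma isSystem {R : Type*} [CommRing R] [Algebra ℂ R] (a : Fin 3 → Fin 5 → R) :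
    IsSystem (J₃ R) (K₃ R) fun i => mat (a i) := by
  have h2 : algebraMap ℂ R (1 / 2) * 2 = 1 := by
    rw [← map_ofNat (algebraMap ℂ R) 2, ← map_mul]; norm_num
  refine ⟨fun i => ?_, fun i => ?_, ?_, ?_⟩
  · simp [mat, Matrix.trace, Fin.sum_univ_three]; ring
  · ext k l
    fin_cases k <;> fin_cases l <;>
      simp [mat, J₃, Matrix.mul_apply, Fin.sum_univ_three] <;> ring
  · ext k l
    fin_cases k <;> fin_cases l <;>
      simp [K₃, J₃, Matrix.mul_apply, Fin.sum_univ_three]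
    simpa using h2
  · ext k l
    fin_cases k <;> fin_cases l <;>
      simp [K₃, J₃, Matrix.mul_apply, Fin.sum_univ_three]
    simpa [mul_comm] using h2

/-- The action of a substitution on quadratic forms. -/
def sym2 {R : Type*} [CommRing R] (p q r s : R) : Matrix (Fin 3) (Fin 3) R :=
  !![p ^ 2, 2 * p * r, r ^ 2; p * q, p * s + q * r, r * s; q ^ 2, 2 * q * s, s ^ 2]

/-- The Hankel matrix of a quartic form. -/
def hank {R : Type*} [CommRing R] (a : Fin 5 → R) : Matrix (Fin 3) (Fin 3) R :=
  !![a 0, a 1, a 2; a 1, a 2, a 3; a 2, a 3, a 4]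

lemma mat_eq {R : Type*} [CommRing R] (a : Fin 5 → R) : mat a = hank a * J₃ R := by
  ext k l
  fin_cases k <;> fin_cases l <;>
    simp [mat, J₃, hank, Matrix.mul_apply, Fin.sum_univ_three] <;> ring

lemma hank_act5 {R : Type*} [CommRing R] (p q r s : R) (a : Fin 5 → R) :
    hank (act5 p q r s a) = sym2 p q r s * hank a * (sym2 p q r s).transpose := by
  ext k l
  fin_cases k <;> fin_cases l <;>
    simp [hank, act5, sym2, Matrix.mul_apply, Fin.sum_univ_three] <;> ring

lemma sym2_mul_J₃ {R : Type*} [CommRing R] {p q r s : R} (h : p * s - q * r = 1) :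
    (sym2 p q r s).transpose * J₃ R * sym2 p q r s = J₃ R := by
  ext k l
  fin_cases k <;> fin_cases l <;>
    simp [J₃, sym2, Matrix.mul_apply, Fin.sum_univ_three]
  · ring
  · ring
  · linear_combination (p * s - q * r + 1) * h
  · ring
  · linear_combination (-2) * (p * s - q * r + 1) * h
  · ring
  · linear_combination (p * s - q * r + 1) * h
  · ring
  · ring

lemma mat_act5 {R : Type*} [CommRing R] {p q r s : R} (h : p * s - q * r = 1) (a : Fin 5 → R) :
    mat (act5 p q r s a) * sym2 p q r s = sym2 p q r s * mat a := by
  rw [mat_eq, mat_eq, hank_act5, Matrix.mul_assoc, Matrix.mul_assoc, Matrix.mul_assoc,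
    ← Matrix.mul_assoc _ (J₃ R), sym2_mul_J₃ h]

lemma det_sym2 {R : Type*} [CommRing R] {p q r s : R} (h : p * s - q * r = 1) :
    (sym2 p q r s).det = 1 := by
  have : (sym2 p q r s).det = (p * s - q * r) ^ 3 := by
    simp [sym2, Matrix.det_fin_three]; ring
  rw [this, h, one_pow]

lemma trw_eq_of_conj {R : Type*} [CommRing R] {M M' : Fin 3 → Matrix (Fin 3) (Fin 3) R}
    {S : Matrix (Fin 3) (Fin 3) R} (hS : S.det = 1) (h : ∀ i, M' i * S = S * M i)
    (w : List (Fin 3)) : trw M' w = trw M w := by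
  have key : (w.map M').prod * S = S * (w.map M).prod := by
    induction w with
    | nil => simp
    | cons i w ih =>
      simp only [List.map_cons, List.prod_cons]
      rw [Matrix.mul_assoc, ih, ← Matrix.mul_assoc, h, Matrix.mul_assoc]
  have hu : IsUnit S.det := by simp [hS]
  have : (w.map M').prod = S * (w.map M).prod * S⁻¹ := by
    rw [← key, Matrix.mul_nonsing_inv_cancel_right _ _ hu]
  rw [trw, this, Matrix.trace_mul_comm, Matrix.nonsing_inv_mul_cancel_left _ _ hu, trw]

/-- The generic normalised coefficients. -/
def coef (i : Fin 3) (k : Fin 5) : Coord := C (binom4 k)⁻¹ * X (ix i k)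

lemma eval_coef (a : Fin 3 → Fin 5 → ℂ) (i k) : eval (toPt a) (coef i k) = a i k := by
  simp [coef, toPt, binom4_ne_zero]

lemma map_mat {R R' : Type*} [CommRing R] [CommRing R'] (φ : R →+* R') (a : Fin 5 → R) :
    φ.mapMatrix (mat a) = mat (φ ∘ a) := by
  ext k l
  fin_cases k <;> fin_cases l <;> simp [mat, map_ofNat]

lemma map_trw {R R' : Type*} [CommRing R] [CommRing R'] (φ : R →+* R')
    (M : Fin 3 → Matrix (Fin 3) (Fin 3) R) (w : List (Fin 3)) :
    φ (trw M w) = trw (fun i => φ.mapMatrix (M i)) w := by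
  rw [trw, trw, ← Function.comp_def, ← List.map_map, ← map_list_prod]
  exact (AddMonoidHom.map_trace φ.toAddMonoidHom _)

/-- The trace of a word in the matrices of the three generic quartic forms. -/
def trc (w : List (Fin 3)) : Coord := trw (fun i => mat (coef i)) w

lemma eval_trc (a : Fin 3 → Fin 5 → ℂ) (w : List (Fin 3)) :
    eval (toPt a) (trc w) = trw (fun i => mat (a i)) w := by
  rw [trc, map_trw]
  simp only [map_mat]
  congr! 4 with i
  ext k
  exact eval_coef a i k

lemma trc_mem_invariantRing (w : List (Fin 3)) : trc w ∈ invariantRing ![4, 4, 4] := by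
  intro g c
  obtain ⟨a, rfl⟩ := exists_toPt c
  have hdet := (g⁻¹).det_coe
  rw [Matrix.det_fin_two] at hdet
  rw [actPt_toPt, eval_trc, eval_trc]
  refine trw_eq_of_conj (det_sym2 ?_) (fun i => mat_act5 ?_ _) w <;> linear_combination hdet

/-- The embedding of the coordinate ring into the big ring. -/
def toBig : Coord →ₐ[ℂ] Big := aeval fun j => binom4 (pos j) • X (.a j.1 (pos j))

/-- The retraction of the big ring onto the coordinate ring. -/
def ofBig : Big →ₐ[ℂ] Coord := aeval fun
  | .a i k => coef i k
  | _ => 0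

lemma toBig_X (j) : toBig (X j) = binom4 (pos j) • X (.a j.1 (pos j)) := aeval_X ..

lemma ofBig_a (i k) : ofBig (X (.a i k)) = coef i k := aeval_X ..

lemma ofBig_toBig (h : Coord) : ofBig (toBig h) = h := by
  have : ofBig.comp toBig = AlgHom.id ℂ Coord := by
    ext1 j
    rw [AlgHom.comp_apply, toBig_X, map_smul, ofBig_a, coef, AlgHom.id_apply, ix_pos,
      smul_eq_C_mul, ← mul_assoc, ← C_mul, mul_inv_cancel₀ (binom4_ne_zero _), C_1, one_mul]
  exact DFunLike.congr_fun this h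

/-- The algebra generated by the twenty-five basic traces. -/
abbrev gens : Subalgebra ℂ Coord := genAlg fun i => mat (coef i)

lemma trc_mem_gens (w : List (Fin 3)) : trc w ∈ gens := (isSystem coef).trw_mem w

lemma ofBig_mem_gens {f : Big} (hf : f ∈ traceAlg) : ofBig f ∈ gens := by
  have : traceAlg ≤ gens.comap ofBig := by
    refine Algebra.adjoin_le ?_
    rintro _ ⟨⟨v, l⟩, rfl⟩
    have e : (ofBig : Big →+* Coord) (trw (fun i => S₃ i * J₃ Big) (v :: l)) = trc (v :: l) := by
      rw [map_trw, trc]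
      congr 1
      funext i
      rw [mat_eq, map_mul]
      congr 1
      · ext k l
        fin_cases k <;> fin_cases l <;> simp [S₃, hank, ofBig_a]
      · ext k l
        fin_cases k <;> fin_cases l <;> simp [J₃, map_ofNat]
    simp only [mul_altWord]
    show ofBig (trw (fun i => S₃ i * J₃ Big) (v :: l)) ∈ gens
    exact e ▸ trc_mem_gens _
  exact this hf

/-- The component of weight zero. -/
def comp0 : Big →ₗ[ℂ] Big := weightedHomogeneousComponent bigWt 0

lemma comp0_of_weight {f : Big} (hf : IsWeightedHomogeneous bigWt f 0) : comp0 f = f :=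
  hf.weightedHomogeneousComponent_same

lemma comp0_mul (f : Big) {g : Big} (hg : IsWeightedHomogeneous bigWt g 0) :
    comp0 (f * g) = comp0 f * g := by
  induction f using MvPolynomial.induction_on' with
  | add p q hp hq => rw [add_mul, map_add, map_add, hp, hq, add_mul]
  | monomial m c =>
    have h1 := isWeightedHomogeneous_monomial bigWt m c rfl
    have h2 := h1.mul hg
    rw [add_zero] at h2
    by_cases h0 : Finsupp.weight bigWt m = 0
    · rw [h0] at h1 h2
      rw [comp0_of_weight h1, comp0_of_weight h2]
    · rw [comp0, h1.weightedHomogeneousComponent_ne _ (Ne.symm h0),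
        h2.weightedHomogeneousComponent_ne _ (Ne.symm h0), zero_mul]

/-- The truncated Reynolds operator. -/
def rey (N : ℕ) : Coord →ₗ[ℂ] Coord :=
  ofBig.toLinearMap ∘ₗ reyn (bigE : Big →ₗ[ℂ] Big) bigF N ∘ₗ comp0 ∘ₗ toBig.toLinearMap

lemma rey_apply (N : ℕ) (h : Coord) :
    rey N h = ofBig (reyn (bigE : Big →ₗ[ℂ] Big) bigF N (comp0 (toBig h))) := rfl

lemma span_list_prod {σ : Type*} :
    Submodule.span ℂ (Set.range fun l : List σ => (l.map (X : σ → MvPolynomial σ ℂ)).prod) = ⊤ := by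
  rw [eq_top_iff, ← Algebra.top_toSubmodule, ← adjoin_range_X, Algebra.adjoin_eq_span]
  refine Submodule.span_mono fun f hf => ?_
  induction hf using Submonoid.closure_induction with
  | mem x hx => obtain ⟨j, rfl⟩ := hx; exact ⟨[j], by simp⟩
  | one => exact ⟨[], by simp⟩
  | mul x y _ _ hx hy =>
    obtain ⟨l, rfl⟩ := hx
    obtain ⟨m, rfl⟩ := hy
    exact ⟨l ++ m, by simp⟩

lemma weight_monA (l : List (Fin 3 × Fin 5)) :
    IsWeightedHomogeneous bigWt (monA l) (l.map fun p => bigWt (.a p.1 p.2)).sum := by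
  induction l with
  | nil => exact isWeightedHomogeneous_one _ _
  | cons p l ih => exact (isWeightedHomogeneous_X _ _ _).mul ih

lemma toBig_list_prod (l : List (Idx ![4, 4, 4])) :
    toBig (l.map X).prod = (l.map fun j => binom4 (pos j)).prod •
      monA (l.map fun j => (j.1, pos j)) := by
  induction l with
  | nil => simp [monA]
  | cons j l ih =>
    simp only [List.map_cons, List.prod_cons, map_mul, ih, toBig_X, monA]
    rw [smul_mul_smul_comm]

lemma rey_mem_gens (h : Coord) : ∃ N₀, ∀ N ≥ N₀, rey N h ∈ gens := by
  suffices Good (bigE : Big →ₗ[ℂ] Big) bigF (Subalgebra.toSubmodule traceAlg) (comp0 (toBig h)) from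
    this.imp fun _ h N hN => ofBig_mem_gens (h N hN)
  have hmem : h ∈ (⊤ : Submodule ℂ Coord) := trivial
  rw [← span_list_prod] at hmem
  induction hmem using Submodule.span_induction with
  | zero => exact ⟨0, fun N _ => by simp⟩
  | add x y _ _ hx hy =>
    have := Good.sum Finset.univ ![comp0 (toBig x), comp0 (toBig y)]
      (fun i _ => by fin_cases i <;> assumption)
    simpa [Fin.sum_univ_two] using this
  | smul c x _ hx => rw [map_smul, map_smul]; exact hx.smul c
  | mem x hx =>
    obtain ⟨l, rfl⟩ := hx
    simp only [toBig_list_prod, map_smul]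
    refine Good.smul ?_ _
    have h1 := weight_monA (l.map fun j => (j.1, pos j))
    by_cases h0 : ((l.map fun j => (j.1, pos j)).map fun p => bigWt (.a p.1 p.2)).sum = 0
    · rw [comp0_of_weight (h0 ▸ h1)]
      exact good_monA _ h0
    · rw [comp0, h1.weightedHomogeneousComponent_ne _ (Ne.symm h0)]
      exact ⟨0, fun N _ => by simp⟩

/-- Substitute a one-parameter family of points. -/
def curve (q r : Polynomial ℂ) (b : Var → ℂ) : Coord →ₐ[ℂ] Polynomial ℂ :=
  aeval fun j => Polynomial.C (binom4 (pos j)) *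
    act5 1 q r 1 (fun k => Polynomial.C (b (.a j.1 k))) (pos j)

lemma eval_curve (q r : Polynomial ℂ) (b : Var → ℂ) (t : ℂ) (h : Coord) :
    (curve q r b h).eval t =
      eval (toPt fun i => act5 1 (q.eval t) (r.eval t) 1 fun k => b (.a i k)) h := by
  rw [← Polynomial.coe_evalRingHom, ← AlgHom.coe_toRingHom, ← RingHom.comp_apply]
  congr 1
  refine MvPolynomial.ringHom_ext (fun c => ?_) fun j => ?_
  · simp [curve]
  · simp only [RingHom.comp_apply, curve, AlgHom.coe_toRingHom, aeval_X, eval_X, toPt, map_mul,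
      Polynomial.coe_evalRingHom, Polynomial.eval_C]
    congr 1
    generalize pos j = k
    fin_cases k <;> simp [act5]

lemma eval_toBig (b : Var → ℂ) (h : Coord) :
    eval b (toBig h) = eval (toPt fun i k => b (.a i k)) h := by
  rw [← AlgHom.coe_toRingHom, ← RingHom.comp_apply]
  congr 1
  refine MvPolynomial.ringHom_ext (fun c => ?_) fun j => ?_
  · simp
  · simp [toBig_X, toPt, smul_eval]

lemma derivation_toBig_eq_zero (q r : Polynomial ℂ) (hq : q.eval 0 = 0) (hr : r.eval 0 = 0)
    (hqr : q * r = 0) (D : Derivation ℂ Big Big)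
    (hD : ∀ b i k, eval b (D (X (.a i k))) =
      (Polynomial.derivative (act5 1 q r 1 (fun k => Polynomial.C (b (.a i k))) k)).eval 0)
    {P : Coord} (hP : P ∈ invariantRing ![4, 4, 4]) : D (toBig P) = 0 := by
  refine MvPolynomial.funext fun b => ?_
  rw [map_zero]
  have h0 : ∀ h, (curve q r b h).eval 0 = eval b (toBig h) := by
    intro h
    have e : (fun i => act5 1 0 0 1 fun k => b (.a i k)) = fun i k => b (.a i k) := by
      funext i k
      fin_cases k <;> simp [act5]
    rw [eval_curve, eval_toBig, hq, hr, e]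
  have key : ∀ h : Coord,
      eval b (D (toBig h)) = (Polynomial.derivative (curve q r b h)).eval 0 := by
    intro h
    induction h using MvPolynomial.induction_on with
    | C c => simp [curve]
    | add p q hp hq => simp [hp, hq]
    | mul_X p j hp =>
      rw [map_mul toBig, map_mul (curve q r b), Derivation.leibniz, Polynomial.derivative_mul,
        map_add, Polynomial.eval_add, Polynomial.eval_mul, Polynomial.eval_mul, smul_eq_mul, smul_eq_mul,
        map_mul (eval b), map_mul (eval b), hp, h0, h0, toBig_X, D.map_smul, smul_eval,
        smul_eval, hD]
      simp only [curve, aeval_X, Polynomial.derivative_mul, Polynomial.derivative_C,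
        Polynomial.eval_mul, Polynomial.eval_C, zero_mul, zero_add]
      ring
  rw [key]
  have hc : curve q r b P = Polynomial.C (eval (toPt fun i k => b (.a i k)) P) := by
    refine Polynomial.funext fun t => ?_
    have hdet : q.eval t * r.eval t = 0 := by rw [← Polynomial.eval_mul, hqr, Polynomial.eval_zero]
    rw [eval_curve, Polynomial.eval_C]
    let g : Matrix.SpecialLinearGroup (Fin 2) ℂ :=
      ⟨!![1, q.eval t; r.eval t, 1], by simp [Matrix.det_fin_two, hdet]⟩
    have := hP g⁻¹ (toPt fun i k => b (.a i k))
    rw [actPt_toPt, inv_inv] at this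
    exact this
  rw [hc]
  simp

lemma bigE_toBig {P : Coord} (hP : P ∈ invariantRing ![4, 4, 4]) : bigE (toBig P) = 0 := by
  refine derivation_toBig_eq_zero Polynomial.X 0 (by simp) (by simp) (by simp) _ ?_ hP
  intro b i k
  rw [bigE_a]
  fin_cases k <;> simp [act5, smul_eval]

lemma bigF_toBig {P : Coord} (hP : P ∈ invariantRing ![4, 4, 4]) : bigF (toBig P) = 0 := by
  refine derivation_toBig_eq_zero 0 Polynomial.X (by simp) (by simp) (by simp) _ ?_ hP
  intro b i k
  rw [bigF_a]
  fin_cases k <;> simp [act5, smul_eval] <;> norm_num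

lemma bracket_X (v : Var) : ⁅bigE, bigF⁆ (X v) = (bigWt v : ℂ) • (X v : Big) := by
  rw [Derivation.commutator_apply]
  obtain ⟨i, k⟩ | ⟨i, k⟩ | ⟨i, k⟩ := v <;> fin_cases k <;>
    simp [bigE_a, bigF_a, bigE_u, bigF_u, bigE_x, bigF_x, bigWt, smul_smul] <;> norm_num <;> module

lemma coeff_bracket (f : Big) (d : Var →₀ ℕ) :
    coeff d (⁅bigE, bigF⁆ f) = (Finsupp.weight bigWt d : ℂ) * coeff d f := by
  induction f using MvPolynomial.induction_on generalizing d with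
  | C c =>
    rw [← algebraMap_eq, Derivation.map_algebraMap, algebraMap_eq, coeff_C]
    split_ifs with h
    · simp [← h]
    · simp
  | add p q hp hq => rw [map_add, coeff_add, coeff_add, hp, hq, mul_add]
  | mul_X p v hp =>
    rw [Derivation.leibniz, bracket_X, smul_eq_mul, smul_eq_mul, coeff_add, mul_smul_comm,
      coeff_smul, mul_comm (X v), coeff_mul_X', coeff_mul_X']
    split_ifs with h
    · have e : Finsupp.weight bigWt d =
          Finsupp.weight bigWt (d - Finsupp.single v 1) + bigWt v := by
        conv_lhs => rw [← tsub_add_cancel_of_le (Finsupp.single_le_iff.mpr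
          (Nat.one_le_iff_ne_zero.mpr (Finsupp.mem_support_iff.mp h)))]
        rw [map_add, Finsupp.weight_single, one_smul]
      rw [hp, e]
      push_cast
      rw [smul_eq_mul]
      ring
    · simp

lemma weight_of_killed {f : Big} (hE : bigE f = 0) (hF : bigF f = 0) :
    IsWeightedHomogeneous bigWt f 0 := by
  intro d hd
  have := coeff_bracket f d
  rw [Derivation.commutator_apply, hE, hF, map_zero, map_zero, sub_zero, coeff_zero] at this
  exact_mod_cast (mul_eq_zero.mp this.symm).resolve_right hd

lemma rey_mul (N : ℕ) (h : Coord) {P : Coord} (hP : P ∈ invariantRing ![4, 4, 4]) :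
    rey N (h * P) = rey N h * P := by
  have hE := bigE_toBig hP
  have hF := bigF_toBig hP
  rw [rey_apply, rey_apply, map_mul, comp0_mul _ (weight_of_killed hE hF)]
  have := map_reyn (E := (bigE : Big →ₗ[ℂ] Big)) (F := bigF) (E' := bigE) (F' := bigF)
    (LinearMap.mulRight ℂ (toBig P)) (fun v => by simp [hE, mul_comm])
    (fun v => by simp [hF, mul_comm]) N (comp0 (toBig h))
  simp only [LinearMap.mulRight_apply] at this
  rw [← this, map_mul, ofBig_toBig]

lemma rey_one (N : ℕ) : rey (N + 1) 1 = 1 := by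
  rw [rey_apply, map_one, comp0_of_weight (isWeightedHomogeneous_one _ _),
    reyn_of_killed _ _ (by simp), map_one]

/-- The invariant ring is generated by the twenty-five basic traces. -/
theorem invariantRing_eq_gens : invariantRing ![4, 4, 4] = gens := by
  refine le_antisymm (fun P hP => ?_) (Algebra.adjoin_le ?_)
  · obtain ⟨N₀, h⟩ := rey_mem_gens P
    have := h (N₀ + 1) (by omega)
    rwa [← one_mul P, rey_mul _ _ hP, rey_one, one_mul] at this
  · rintro _ ⟨j, rfl⟩
    exact trc_mem_invariantRing _

section Nakayama

variable {σ ι κ : Type*} [Fintype ι] [Fintype κ] {G : ι → MvPolynomial σ ℂ} {e : ι → ℕ}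
  {P : κ → MvPolynomial σ ℂ} {d : κ → ℕ}

lemma homogeneousComponent_mul_of_isHomogeneous (f : MvPolynomial σ ℂ) {g : MvPolynomial σ ℂ}
    {m : ℕ} (hg : g.IsHomogeneous m) (D : ℕ) :
    homogeneousComponent D (f * g) = if m ≤ D then homogeneousComponent (D - m) f * g else 0 := by
  have h : ∀ n : ℕ, homogeneousComponent D (homogeneousComponent n f * g) =
      if n + m = D then homogeneousComponent n f * g else 0 := fun n => by
    rw [homogeneousComponent_of_mem ((homogeneousComponent_isHomogeneous n f).mul hg)]
    simp only [eq_comm]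
  conv_lhs => rw [← sum_homogeneousComponent f, Finset.sum_mul, map_sum]
  simp only [h]
  split_ifs with hm
  · have h' : ∀ n, n + m = D ↔ n = D - m := fun n => by omega
    simp only [h', Finset.sum_ite_eq', Finset.mem_range]
    split_ifs with h2
    · rfl
    · rw [homogeneousComponent_eq_zero _ _ (by omega), zero_mul]
  · exact Finset.sum_eq_zero fun n _ => if_neg (by omega)

lemma monomials_isHomogeneous (hG : ∀ j, (G j).IsHomogeneous (e j)) (a : ι → ℕ) :
    (∏ j, G j ^ a j).IsHomogeneous (∑ j, e j * a j) :=
  IsHomogeneous.prod _ _ _ fun j _ => (hG j).pow (a j)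

/-- A graded form of Nakayama's lemma: an algebra generated by homogeneous elements is integral
over the subalgebra generated by homogeneous elements of positive degree generating a nilpotent
ideal. -/
theorem isIntegral_of_pow_mem (hG : ∀ j, (G j).IsHomogeneous (e j))
    (hP : ∀ i, (P i).IsHomogeneous (d i)) (hd : ∀ i, 0 < d i)
    (hPG : ∀ i, P i ∈ Algebra.adjoin ℂ (Set.range G))
    (h : ∀ j, ∃ n : ℕ, ∃ r : κ → MvPolynomial σ ℂ, (∀ i, r i ∈ Algebra.adjoin ℂ (Set.range G)) ∧
      G j ^ n = ∑ i, r i * P i) (x : MvPolynomial σ ℂ) (hx : x ∈ Algebra.adjoin ℂ (Set.range G)) :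
    IsIntegral (Algebra.adjoin ℂ (Set.range P)) x := by
  classical
  choose n r hr hn using h
  set T := Algebra.adjoin ℂ (Set.range G) with hT
  set B := Algebra.adjoin ℂ (Set.range P) with hB
  have hBT : B ≤ T := Algebra.adjoin_le (by rintro _ ⟨i, rfl⟩; exact hPG i)
  let W : Submodule B (MvPolynomial σ ℂ) :=
    Submodule.span B (Set.range fun a : (∀ j, Fin (n j)) => ∏ j, G j ^ (a j : ℕ))
  have hsmul : ∀ (c : ℂ) f, f ∈ W → c • f ∈ W := fun c f hf => by
    rw [← algebraMap_smul B c f]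
    exact W.smul_mem _ hf
  have key : ∀ D : ℕ, ∀ f ∈ T, homogeneousComponent D f ∈ W := by
    intro D
    induction D using Nat.strong_induction_on with
    | _ D ih =>
      intro f hf
      rw [hT, Algebra.adjoin_range_eq_range_aeval] at hf
      obtain ⟨p, rfl⟩ := hf
      induction p using MvPolynomial.induction_on' with
      | add p q hp hq =>
        have := W.add_mem hp hq
        rwa [← map_add, ← map_add] at this
      | monomial a c =>
        have e1 : aeval G (monomial a c) = c • ∏ j, G j ^ a j := by
          rw [aeval_monomial, Finsupp.prod_fintype _ _ fun _ => pow_zero _, Algebra.smul_def]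
        show homogeneousComponent D (aeval G (monomial a c)) ∈ W
        rw [e1, map_smul]
        refine hsmul c _ ?_
        by_cases ha : ∀ j, a j < n j
        · rw [homogeneousComponent_of_mem (monomials_isHomogeneous hG a)]
          split_ifs
          · exact Submodule.subset_span ⟨fun j => ⟨a j, ha j⟩, rfl⟩
          · exact W.zero_mem
        · push Not at ha
          obtain ⟨j, hj⟩ := ha
          set g := G j ^ (a j - n j) * ∏ i ∈ Finset.univ.erase j, G i ^ a i with hg
          have hgT : g ∈ T := T.mul_mem (T.pow_mem (Algebra.subset_adjoin ⟨j, rfl⟩) _)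
            (T.prod_mem fun i _ => T.pow_mem (Algebra.subset_adjoin ⟨i, rfl⟩) _)
          have e2 : ∏ j, G j ^ a j = ∑ i, (r j i * g) * P i := by
            rw [← Finset.mul_prod_erase _ _ (Finset.mem_univ j), ← Nat.add_sub_of_le hj, pow_add,
              hn, mul_assoc, Finset.sum_mul]
            refine Finset.sum_congr rfl fun i _ => ?_
            rw [hg]
            ring
          rw [e2, map_sum]
          refine W.sum_mem fun i _ => ?_
          rw [homogeneousComponent_mul_of_isHomogeneous _ (hP i)]
          split_ifs with hD
          · rw [mul_comm]
            exact W.smul_mem (⟨P i, Algebra.subset_adjoin ⟨i, rfl⟩⟩ : B)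
              (ih _ (by have := hd i; omega) _ (T.mul_mem (hr j i) hgT))
          · exact W.zero_mem
  let S : Subalgebra B (MvPolynomial σ ℂ) :=
    { T.toSubsemiring with algebraMap_mem' := fun b => hBT b.2 }
  have hS : Subalgebra.toSubmodule S = W := by
    refine le_antisymm (fun f hf => ?_) (Submodule.span_le.mpr ?_)
    · rw [← sum_homogeneousComponent f]
      exact W.sum_mem fun D _ => key D f hf
    · rintro _ ⟨a, rfl⟩
      exact T.prod_mem fun i _ => T.pow_mem (Algebra.subset_adjoin ⟨i, rfl⟩) _
  refine IsIntegral.of_mem_of_fg S ?_ x hx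
  rw [hS]
  exact Submodule.fg_span (Set.finite_range _)

end Nakayama

lemma mat_coef_isHomogeneous (i : Fin 3) (k l : Fin 3) : (mat (coef i) k l).IsHomogeneous 1 := by
  have h : ∀ k, (coef i k).IsHomogeneous 1 := fun k => by
    simpa [coef] using (isHomogeneous_C _ _).mul (isHomogeneous_X ℂ (ix i k))
  have h2 : ∀ k, (-2 * coef i k).IsHomogeneous 1 := fun k => by
    rw [show (-2 : Coord) = C (-2) by rw [map_neg, map_ofNat]]
    exact (h k).C_mul _
  fin_cases k <;> fin_cases l
  exacts [h 2, h2 1, h 0, h 3, h2 2, h 1, h 4, h2 3, h 2]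

lemma trc_isHomogeneous (w : List (Fin 3)) : (trc w).IsHomogeneous w.length := by
  have : ∀ k l, ((w.map fun i => mat (coef i)).prod k l).IsHomogeneous w.length := by
    induction w with
    | nil =>
      intro k l
      rw [List.map_nil, List.prod_nil, Matrix.one_apply]
      split_ifs
      · exact isHomogeneous_one _ _
      · exact isHomogeneous_zero _ _ _
    | cons i w ih =>
      intro k l
      rw [List.map_cons, List.prod_cons, Matrix.mul_apply, List.length_cons, add_comm]
      exact IsHomogeneous.sum _ _ _ fun m _ => (mat_coef_isHomogeneous i k m).mul (ih m l)
  exact IsHomogeneous.sum _ _ _ fun m _ => this m m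

/-- The Hilbert criterion: invariants whose common zeros are zeros of all basic invariants generate
a subalgebra over which the invariant ring is integral. -/
theorem isIntegral_of_zeros {k : ℕ} {P : Fin k → Coord} {d : Fin k → ℕ}
    (hP : ∀ i, P i ∈ invariantRing ![4, 4, 4]) (hh : ∀ i, (P i).IsHomogeneous (d i))
    (hd : ∀ i, 0 < d i)
    (hz : ∀ a, (∀ i, eval (toPt a) (P i) = 0) → ∀ j, eval (toPt a) (trc (gword j)) = 0)
    (x : Coord) (hx : x ∈ invariantRing ![4, 4, 4]) :
    IsIntegral (Algebra.adjoin ℂ (Set.range P)) x := by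
  rw [invariantRing_eq_gens] at hx
  have hP' : ∀ i, P i ∈ gens := fun i => invariantRing_eq_gens ▸ hP i
  refine isIntegral_of_pow_mem (G := fun j => trc (gword j)) (fun j => trc_isHomogeneous _) hh hd
    hP' (fun j => ?_) x hx
  have hrad : trc (gword j) ∈ (Ideal.span (Set.range P)).radical := by
    rw [← vanishingIdeal_zeroLocus_eq_radical (K := ℂ)]
    intro c hc
    obtain ⟨a, rfl⟩ := exists_toPt c
    have := hz a (fun i => by
      have := hc (P i) (Ideal.subset_span ⟨i, rfl⟩)
      simpa using this) j
    simpa using this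
  obtain ⟨n, hn⟩ := hrad
  obtain ⟨h, hh⟩ := (Ideal.mem_span_range_iff_exists_fun).mp hn
  choose N hN using fun i => rey_mem_gens (h i)
  obtain ⟨N', hN'⟩ : ∃ N', ∀ i, N i ≤ N' := by
    exact ⟨Finset.univ.sup N, fun i => Finset.le_sup (Finset.mem_univ i)⟩
  refine ⟨n, fun i => rey (N' + 1) (h i), fun i => hN i _ (by have := hN' i; omega), ?_⟩
  have hinv : trc (gword j) ^ n ∈ invariantRing ![4, 4, 4] :=
    Subalgebra.pow_mem _ (trc_mem_invariantRing _) n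
  calc trc (gword j) ^ n = rey (N' + 1) (1 * trc (gword j) ^ n) := by
        rw [rey_mul _ _ hinv, rey_one, one_mul]
    _ = _ := by
        rw [one_mul, ← hh, map_sum]
        exact Finset.sum_congr rfl fun i _ => rey_mul _ _ (hP i)

section Geometry

open Matrix

/-- Traceless matrices, self-adjoint with respect to `J₃`. -/
structure IsSA (x : Matrix (Fin 3) (Fin 3) ℂ) : Prop where
  mul_eq : J₃ ℂ * x = xᵀ * J₃ ℂ
  trace_eq_zero : x.trace = 0

lemma isSA_mat (a : Fin 5 → ℂ) : IsSA (mat a) :=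
  ⟨(isSystem fun _ => a).mul_eq 0, (isSystem fun _ => a).trace_eq_zero 0⟩

variable {x y z : Matrix (Fin 3) (Fin 3) ℂ}

lemma IsSA.system (hx : IsSA x) (hy : IsSA y) (hz : IsSA z) :
    IsSystem (J₃ ℂ) (K₃ ℂ) ![x, y, z] :=
  ⟨fun i => by fin_cases i <;> [exact hx.2; exact hy.2; exact hz.2],
    fun i => by fin_cases i <;> [exact hx.1; exact hy.1; exact hz.1],
    (isSystem 0).inv_mul, (isSystem 0).mul_inv⟩

lemma ch_mul (hy : y.trace = 0) (m : Matrix (Fin 3) (Fin 3) ℂ) :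
    y * y * m + y * m * y + m * y * y = m.trace • (y * y) + (y * m).trace • y +
      ((y * y).trace / 2) • m + ((y * y * m).trace - m.trace * (y * y).trace / 2) • 1 := by
  have h := polarised_cayley_hamilton y y m
  have e : (y * m * y).trace = (y * y * m).trace := by
    rw [Matrix.trace_mul_comm, Matrix.mul_assoc]
  rw [hy, e] at h
  have h2 : (2 : ℂ) • (y * y * m + y * m * y + m * y * y) =
      (2 : ℂ) • (m.trace • (y * y) + (y * m).trace • y + ((y * y).trace / 2) • m +
        ((y * y * m).trace - m.trace * (y * y).trace / 2) • 1) := by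
    calc _ = y * y * m + y * m * y + y * y * m + y * m * y + m * y * y + m * y * y := by module
      _ = _ := by rw [h]; module
  exact smul_right_injective _ (two_ne_zero (α := ℂ)) h2

lemma ch_cube (hy : y.trace = 0) :
    y * y * y = ((y * y).trace / 2) • y + ((y * y * y).trace / 3) • 1 := by
  have h := ch_mul hy y
  rw [hy] at h
  have h2 : (3 : ℂ) • (y * y * y) =
      (3 : ℂ) • (((y * y).trace / 2) • y + ((y * y * y).trace / 3) • 1) := by
    calc _ = y * y * y + y * y * y + y * y * y := by module
      _ = _ := by rw [h]; module
  exact smul_right_injective _ (three_ne_zero (α := ℂ)) h2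

/-- A skew-adjoint matrix of square zero vanishes. -/
lemma eq_zero_of_skew {w : Matrix (Fin 3) (Fin 3) ℂ} (h : J₃ ℂ * w = - (wᵀ * J₃ ℂ))
    (h2 : w * w = 0) : w = 0 := by
  have e := fun i j => congrFun (congrFun h i) j
  have f := fun i j => congrFun (congrFun h2 i) j
  have e00 := e 0 0
  have e01 := e 0 1
  have e02 := e 0 2
  have e11 := e 1 1
  have e12 := e 1 2
  have e22 := e 2 2
  have f00 := f 0 0
  have f11 := f 1 1
  have f02 := f 0 2
  have f20 := f 2 0
  simp [J₃, Matrix.mul_apply, Fin.sum_univ_three] at e00 e01 e02 e11 e12 e22 f00 f11 f02 f20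
  have g20 : w 2 0 = 0 := by linear_combination e00 / 2
  have g02 : w 0 2 = 0 := by linear_combination e22 / 2
  have g11 : w 1 1 = 0 := by linear_combination -e11 / 4
  have g21 : w 2 1 = 2 * w 1 0 := by linear_combination e01
  have g01 : w 0 1 = 2 * w 1 2 := by linear_combination -e12
  have g22 : w 2 2 = - w 0 0 := by linear_combination e02
  rw [g01, g02] at f02
  rw [g21, g20] at f20
  have g12 : w 1 2 = 0 := by
    have : w 1 2 * w 1 2 = 0 := by linear_combination f02 / 2
    simpa using this
  have g10 : w 1 0 = 0 := by
    have : w 1 0 * w 1 0 = 0 := by linear_combination f20 / 2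
    simpa using this
  have g00 : w 0 0 = 0 := by
    rw [g10, g20] at f00
    simpa using f00
  ext i j
  fin_cases i <;> fin_cases j <;> simp [g00, g01, g02, g10, g11, g12, g20, g21, g22]

lemma adj_mul {u v u' v' : Matrix (Fin 3) (Fin 3) ℂ} (hu : J₃ ℂ * u = u'ᵀ * J₃ ℂ)
    (hv : J₃ ℂ * v = v'ᵀ * J₃ ℂ) : J₃ ℂ * (u * v) = (v' * u')ᵀ * J₃ ℂ := by
  rw [← Matrix.mul_assoc, hu, Matrix.mul_assoc, hv, ← Matrix.mul_assoc, Matrix.transpose_mul]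

lemma trace_rev (hx : IsSA x) (hy : IsSA y) (hz : IsSA z) :
    (x * x * z * y).trace = (x * x * y * z).trace := by
  have h := (hx.system hy hz).trw_reverse [1, 2, 0, 0]
  simp only [trw, List.reverse_cons, List.reverse_nil, List.nil_append, List.cons_append,
    List.map_cons, List.map_nil, List.prod_cons, List.prod_nil, Matrix.mul_one,
    Matrix.cons_val] at h
  rw [Matrix.mul_assoc, Matrix.mul_assoc, h, ← Matrix.mul_assoc, Matrix.trace_mul_comm]
  simp only [Matrix.mul_assoc]

lemma cube_eq_zero (hx : IsSA x) (h2 : (x * x).trace = 0) (h3 : (x * x * x).trace = 0) :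
    x * x * x = 0 := by
  rw [ch_cube hx.2, h2, h3]
  simp

lemma sq_mul_sq (hx : IsSA x) (h2 : (x * x).trace = 0) (h3 : (x * x * x).trace = 0)
    (m : Matrix (Fin 3) (Fin 3) ℂ) : (x * x) * m * (x * x) = (x * x * m).trace • (x * x) := by
  have hc := cube_eq_zero hx h2 h3
  have h := congrArg (fun w => x * x * w) (ch_mul hx.2 m)
  simp only [h2, mul_add, Matrix.mul_smul] at h
  have e1 : x * x * (x * x * m) = 0 := by
    rw [show x * x * (x * x * m) = x * x * x * (x * m) by noncomm_ring, hc, zero_mul]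
  have e2 : x * x * (x * m * x) = 0 := by
    rw [show x * x * (x * m * x) = x * x * x * (m * x) by noncomm_ring, hc, zero_mul]
  have e3 : x * x * (x * x) = 0 := by
    rw [show x * x * (x * x) = x * x * x * x by noncomm_ring, hc, zero_mul]
  have e4 : x * x * x = 0 := hc
  rw [e1, e2, e3, e4] at h
  simp at h
  rw [← h]
  noncomm_ring

/-- If the traces of degree two and three involving `x` twice vanish, then the square of `x`
annihilates itself around words of length at most two in `y`. -/
lemma sq_relations (hx : IsSA x) (hy : IsSA y) (h20 : (x * x).trace = 0)
    (h11 : (x * y).trace = 0) (h30 : (x * x * x).trace = 0) (h21 : (x * x * y).trace = 0) :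
    (x * x) * y * (x * x) = 0 ∧ (x * x) * (y * y) * (x * x) = 0 := by
  have hc := cube_eq_zero hx h20 h30
  have h1 : (x * x) * y * (x * x) = 0 := by rw [sq_mul_sq hx h20 h30, h21, zero_smul]
  refine ⟨h1, ?_⟩
  have hp := ch_mul hx.2 y
  simp only [h20, h11, h21, hy.2, zero_smul, zero_div, mul_zero, sub_zero, add_zero] at hp
  have hw : x * y * (x * x) = 0 := by
    have e : x * x * y * x = - (x * y * (x * x)) := by
      have := congrArg (fun w => w * x) hp
      simp only [add_mul, zero_mul] at this
      rw [show y * x * x * x = y * (x * x * x) by noncomm_ring, hc, mul_zero, add_zero] at this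
      rw [eq_neg_iff_add_eq_zero, ← this]
      noncomm_ring
    refine eq_zero_of_skew ?_ ?_
    · have := adj_mul (adj_mul hx.1 hy.1) (adj_mul hx.1 hx.1)
      rw [this, show x * x * (y * x) = x * x * y * x by noncomm_ring, e, Matrix.transpose_neg,
        Matrix.neg_mul]
    · rw [show x * y * (x * x) * (x * y * (x * x)) = x * y * (x * x * x) * (y * (x * x)) by
        noncomm_ring, hc, mul_zero, zero_mul]
  have e : x * x * y = - (x * y * x) - y * x * x := by
    rw [eq_sub_iff_add_eq, eq_neg_iff_add_eq_zero, ← hp]; abel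
  calc (x * x) * (y * y) * (x * x) = (x * x * y) * (y * (x * x)) := by noncomm_ring
    _ = - (x * y * x * (y * (x * x))) - y * x * x * (y * (x * x)) := by
      rw [e, sub_mul, Matrix.neg_mul]
    _ = - (x * y * (x * y * (x * x))) - y * ((x * x) * y * (x * x)) := by noncomm_ring
    _ = 0 := by rw [hw, h1]; simp

lemma trace_sq_mul_sq (hx : IsSA x) (hy : IsSA y) (h20 : (x * x).trace = 0)
    (h11 : (x * y).trace = 0) (h30 : (x * x * x).trace = 0) (h21 : (x * x * y).trace = 0) :
    (x * x * (y * y)).trace = 0 := by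
  have h := (sq_relations hx hy h20 h11 h30 h21).2
  rw [sq_mul_sq hx h20 h30, smul_eq_zero] at h
  obtain h | h := h
  · exact h
  · rw [h, zero_mul, Matrix.trace_zero]

lemma IsSA.add (hx : IsSA x) (hy : IsSA y) : IsSA (x + y) :=
  ⟨by rw [mul_add, Matrix.transpose_add, add_mul, hx.1, hy.1],
    by rw [Matrix.trace_add, hx.2, hy.2, add_zero]⟩

lemma trace_sq_mul_mul (hx : IsSA x) (hy : IsSA y) (hz : IsSA z) (hxx : (x * x).trace = 0)
    (hxy : (x * y).trace = 0) (hxz : (x * z).trace = 0) (hxxx : (x * x * x).trace = 0)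
    (hxxy : (x * x * y).trace = 0) (hxxz : (x * x * z).trace = 0) :
    (x * x * y * z).trace = 0 := by
  have h1 := trace_sq_mul_sq hx hy hxx hxy hxxx hxxy
  have h2 := trace_sq_mul_sq hx hz hxx hxz hxxx hxxz
  have h3 := trace_sq_mul_sq hx (hy.add hz) hxx
    (by rw [mul_add, Matrix.trace_add, hxy, hxz, add_zero])
    hxxx (by rw [mul_add, Matrix.trace_add, hxxy, hxxz, add_zero])
  have h4 := trace_rev hx hy hz
  have e : x * x * ((y + z) * (y + z)) =
      x * x * (y * y) + x * x * (z * z) + x * x * y * z + x * x * z * y := by noncomm_ring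
  rw [e, Matrix.trace_add, Matrix.trace_add, Matrix.trace_add, h1, h2, h4] at h3
  linear_combination h3 / 2

/-- The square of the second vector vanishes if the first has a suitable annihilating element. -/
lemma trace_sq_eq_zero_of_relations {r : Matrix (Fin 3) (Fin 3) ℂ} (hr : r ≠ 0) (hrs : IsSA r)
    (hy : IsSA y) (hrr : r * r = 0) (hryr : r * y * r = 0) (hryyr : r * (y * y) * r = 0)
    (hry : (y * r).trace = 0) (hyyy : (y * y * y).trace = 0) : (y * y).trace = 0 := by
  have hcomm : r * y - y * r = 0 := by
    refine eq_zero_of_skew ?_ ?_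
    · rw [mul_sub, adj_mul hrs.1 hy.1, adj_mul hy.1 hrs.1, ← sub_mul, ← Matrix.transpose_sub,
        ← Matrix.neg_mul, ← Matrix.transpose_neg, neg_sub]
    · calc (r * y - y * r) * (r * y - y * r) =
          (r * y * r) * y - r * (y * y) * r - y * (r * r) * y + y * (r * y * r) := by noncomm_ring
        _ = 0 := by rw [hryr, hryyr, hrr]; simp
  have hc : r * y = y * r := sub_eq_zero.mp hcomm
  have h := ch_mul hy.2 r
  rw [hrs.2, hry] at h
  have e1 : y * r * y = y * y * r := by rw [Matrix.mul_assoc, hc, ← Matrix.mul_assoc]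
  have e2 : r * y * y = y * y * r := by rw [hc, e1]
  rw [e1, e2] at h
  simp only [zero_smul, zero_add, zero_mul, zero_div, sub_zero] at h
  have hτ : (y * y * r).trace = 0 := by
    have := congrArg (fun w => w * r) h
    simp only [add_mul, Matrix.smul_mul, Matrix.one_mul, hrr, smul_zero, zero_add] at this
    rw [Matrix.mul_assoc, hrr, mul_zero, add_zero, add_zero] at this
    exact (smul_eq_zero.mp this.symm).resolve_right hr
  rw [hτ, zero_smul, add_zero] at h
  by_contra hs
  have h6 : y * y * r = ((y * y).trace / 6) • r := by
    have : (3 : ℂ) • (y * y * r) = (3 : ℂ) • (((y * y).trace / 6) • r) := by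
      calc _ = y * y * r + y * y * r + y * y * r := by module
        _ = _ := by rw [h]; module
    exact smul_right_injective _ (three_ne_zero (α := ℂ)) this
  have h3 : y * y * y * r = ((y * y).trace / 2) • (y * r) := by
    rw [ch_cube hy.2, hyyy]
    simp
  have h3' : y * y * y * r = ((y * y).trace / 6) • (y * r) := by
    rw [show y * y * y * r = y * (y * y * r) by noncomm_ring, h6, Matrix.mul_smul]
  have h0 : ((y * y).trace / 3) • (y * r) = 0 := by
    have := h3.symm.trans h3'
    rw [← sub_eq_zero, ← sub_smul] at this
    rw [← this]
    congr 1
    ring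
  have hyr : y * r = 0 := (smul_eq_zero.mp h0).resolve_left (by simpa using hs)
  rw [Matrix.mul_assoc, hyr, mul_zero] at h6
  obtain h6 | h6 := smul_eq_zero.mp h6.symm
  · exact hs (by simpa using h6)
  · exact hr h6

/-- The five-plus-seven invariants force the Gram matrix to vanish. -/
lemma trace_sq_eq_zero (hx : IsSA x) (hy : IsSA y) (hxx : (x * x).trace = 0)
    (hxy : (x * y).trace = 0) (hxz : (x * z).trace = (y * y).trace) (hxxx : (x * x * x).trace = 0)
    (hxxy : (x * x * y).trace = 0) (hyyy : (y * y * y).trace = 0)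
    (hxyy : (x * (y * y)).trace = (x * x * z).trace) : (y * y).trace = 0 := by
  by_cases h0 : x = 0
  · rw [← hxz, h0, zero_mul, Matrix.trace_zero]
  by_cases h1 : x * x = 0
  · have hm : ∀ m : Matrix (Fin 3) (Fin 3) ℂ, x * m * x = (x * m).trace • x := fun m => by
      have := ch_mul hx.2 m
      rw [Matrix.mul_assoc m, h1] at this
      simpa using this
    refine trace_sq_eq_zero_of_relations h0 hx hy h1 ?_ ?_ ?_ hyyy
    · rw [hm, hxy, zero_smul]
    · rw [hm, hxyy, h1]
      simp
    · rw [Matrix.trace_mul_comm, hxy]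
  · obtain ⟨h2, h3⟩ := sq_relations hx hy hxx hxy hxxx hxxy
    refine trace_sq_eq_zero_of_relations h1 ⟨adj_mul hx.1 hx.1, hxx⟩ hy ?_ h2 h3 ?_ hyyy
    · rw [← Matrix.mul_assoc, cube_eq_zero hx hxx hxxx, zero_mul]
    · rw [Matrix.trace_mul_comm, hxxy]

lemma trace_mat_mul (a b : Fin 5 → ℂ) : (mat a * mat b).trace =
    a 0 * b 4 - 4 * (a 1 * b 3) + 6 * (a 2 * b 2) - 4 * (a 3 * b 1) + a 4 * b 0 := by
  simp [mat, Matrix.trace, Fin.sum_univ_three]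
  ring

/-- Three vectors spanning an isotropic subspace are linearly dependent. -/
lemma exists_dependent (a : Fin 3 → Fin 5 → ℂ) (h : ∀ i j, (mat (a i) * mat (a j)).trace = 0) :
    ∃ c : Fin 3 → ℂ, c ≠ 0 ∧ ∑ i, c i • mat (a i) = 0 := by
  let V : Matrix (Fin 3) (Fin 5) ℂ := a
  let Q : Matrix (Fin 5) (Fin 5) ℂ :=
    !![0, 0, 0, 0, 1; 0, 0, 0, -4, 0; 0, 0, 6, 0, 0; 0, -4, 0, 0, 0; 1, 0, 0, 0, 0]
  let Q' : Matrix (Fin 5) (Fin 5) ℂ :=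
    !![0, 0, 0, 0, 1; 0, 0, 0, -1 / 4, 0; 0, 0, 1 / 6, 0, 0; 0, -1 / 4, 0, 0, 0; 1, 0, 0, 0, 0]
  have hQ : Q * Q' = 1 := by
    ext i j
    fin_cases i <;> fin_cases j <;> simp [Q, Q', Matrix.mul_apply, Fin.sum_univ_five] <;> norm_num
  have hdet : IsUnit Q.det := Matrix.isUnit_det_of_right_inverse hQ
  have h0 : V * Q * Vᵀ = 0 := by
    ext i j
    rw [Matrix.zero_apply, ← h i j, trace_mat_mul]
    have e : ∀ k l, V k l = a k l := fun _ _ => rfl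
    simp only [Matrix.mul_apply, Fin.sum_univ_five, Matrix.transpose_apply, e]
    simp [Q]
    ring
  have hrank := Matrix.rank_add_rank_le_card_of_mul_eq_zero h0
  rw [Matrix.rank_mul_eq_left_of_isUnit_det _ _ hdet, Matrix.rank_transpose] at hrank
  have hdep : ¬ LinearIndependent ℂ V.row := fun hli => by
    have := hli.rank_matrix
    simp at this hrank
    omega
  rw [Fintype.not_linearIndependent_iff] at hdep
  obtain ⟨c, hc, i, hi⟩ := hdep
  refine ⟨c, fun h => hi (congrFun h i), ?_⟩
  have hc' : ∀ k, ∑ i, c i * a i k = 0 := fun k => by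
    have := congrFun hc k
    simpa [Finset.sum_apply, V, Matrix.row] using this
  simp only [Fin.sum_univ_three] at hc' ⊢
  ext k l
  fin_cases k <;> fin_cases l <;> simp [mat] <;>
    first
    | linear_combination hc' 0
    | linear_combination hc' 1
    | linear_combination hc' 2
    | linear_combination hc' 3
    | linear_combination hc' 4
    | linear_combination (-2) * hc' 1
    | linear_combination (-2) * hc' 2
    | linear_combination (-2) * hc' 3

end Geometry

section Nullcone

open Matrix

variable {x y z : Matrix (Fin 3) (Fin 3) ℂ}

lemma trace_quintic_aux (hyc : y * y * y = 0) (hzc : z * z * z = 0)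
    (h1 : y * y * z + y * z * y + z * y * y = 0) (h2 : z * z * y + z * y * z + y * z * z = 0)
    {a b c : ℂ} (ha : a ≠ 0) (h : a • x + b • y + c • z = 0) : (x * x * y * y * z).trace = 0 := by
  have hx : x = (-b / a) • y + (-c / a) • z := by
    have : x = a⁻¹ • (a • x + b • y + c • z) + ((-b / a) • y + (-c / a) • z) := by
      match_scalars <;> field_simp <;> ring
    rw [h, smul_zero, zero_add] at this
    exact this
  have e1 : (y * z * y * y * z).trace = 0 := by
    have : y * z * y * y * z = y * y * z * z * y - y * y * (z * z * y + z * y * z + y * z * z) +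
        (y * y * z + y * z * y + z * y * y) * y * z - z * (y * y * y) * z +
        (y * y * y) * z * z := by noncomm_ring
    rw [this, h1, h2, hyc]
    simp only [mul_zero, zero_mul, sub_zero, add_zero]
    rw [Matrix.trace_mul_comm, ← Matrix.mul_assoc, ← Matrix.mul_assoc, ← Matrix.mul_assoc, hyc]
    simp
  have e2 : (y * y * y * y * z).trace = 0 := by rw [hyc]; simp
  have e3 : (z * y * y * y * z).trace = 0 := by
    rw [show z * y * y * y * z = z * (y * y * y) * z by noncomm_ring, hyc]
    simp
  have e4 : (z * z * y * y * z).trace = 0 := by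
    rw [Matrix.trace_mul_comm, ← Matrix.mul_assoc, ← Matrix.mul_assoc, ← Matrix.mul_assoc, hzc]
    simp
  rw [hx]
  simp only [add_mul, mul_add, smul_mul_assoc, mul_smul_comm, Matrix.trace_add, Matrix.trace_smul,
    e1, e2, e3, e4, smul_zero, add_zero]

lemma trace_quintic (hx : IsSA x) (hy : IsSA y) (hz : IsSA z) {N : List (Fin 3) → ℂ}
    (hN : N = trw ![x, y, z]) (h2 : ∀ i j, N [i, j] = 0) (h3 : ∀ i j k, N [i, j, k] = 0)
    {a b c : ℂ} (h0 : a ≠ 0 ∨ b ≠ 0 ∨ c ≠ 0) (h : a • x + b • y + c • z = 0) :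
    (x * x * y * y * z).trace = 0 := by
  subst hN
  have hsa : ∀ i, IsSA (![x, y, z] i) := fun i => by
    fin_cases i <;> [exact hx; exact hy; exact hz]
  have t2 : ∀ i j, (![x, y, z] i * ![x, y, z] j).trace = 0 := fun i j => by
    simpa [trw] using h2 i j
  have t3 : ∀ i j k, (![x, y, z] i * ![x, y, z] j * ![x, y, z] k).trace = 0 := fun i j k => by
    simpa [trw, mul_assoc] using h3 i j k
  have hc : ∀ i, ![x, y, z] i * ![x, y, z] i * ![x, y, z] i = 0 := fun i =>
    cube_eq_zero (hsa i) (t2 i i) (t3 i i i)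
  have hch : ∀ i j, ![x, y, z] i * ![x, y, z] i * ![x, y, z] j +
      ![x, y, z] i * ![x, y, z] j * ![x, y, z] i + ![x, y, z] j * ![x, y, z] i * ![x, y, z] i = 0 :=
    fun i j => by
      rw [ch_mul (hsa i).2, (hsa j).2, t2, t2, t3]
      simp
  by_cases ha : a = 0
  · by_cases hb : b = 0
    · have hz0 : z = 0 := by
        rw [ha, hb, zero_smul, zero_smul, zero_add, zero_add, smul_eq_zero] at h
        exact h.resolve_left (by simpa [ha, hb] using h0)
      simp [hz0]
    · have e : (x * x * y * y * z).trace = (y * y * x * x * z).trace := by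
        have h := (hx.system hy hz).trw_reverse [2, 1, 1, 0, 0]
        simp only [trw, List.reverse_cons, List.reverse_nil, List.nil_append, List.cons_append,
          List.map_cons, List.map_nil, List.prod_cons, List.prod_nil, Matrix.mul_one,
          Matrix.cons_val] at h
        simp only [Matrix.mul_assoc] at h ⊢
        rw [h, Matrix.trace_mul_comm]
        simp only [Matrix.mul_assoc]
      rw [e]
      exact trace_quintic_aux (hc 0) (hc 2) (hch 0 2) (hch 2 0) hb
        (by rw [← h]; abel : b • y + a • x + c • z = 0)
  · exact trace_quintic_aux (hc 1) (hc 2) (hch 1 2) (hch 2 1) ha h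

variable {M : Fin 3 → Matrix (Fin 3) (Fin 3) ℂ}

lemma trw_two_eq_zero (h00 : trw M [0, 0] = 0) (h01 : trw M [0, 1] = 0) (h02 : trw M [0, 2] = 0)
    (h11 : trw M [1, 1] = 0) (h12 : trw M [1, 2] = 0) (h22 : trw M [2, 2] = 0) (i j : Fin 3) :
    trw M [i, j] = 0 := by
  have s : ∀ i j, trw M [i, j] = trw M [j, i] := fun i j => trw_append_comm [i] [j]
  fin_cases i <;> fin_cases j <;> first | assumption | (rw [s]; assumption)

lemma trw_rotate (i j k : Fin 3) : trw M [i, j, k] = trw M [j, k, i] := trw_append_comm [i] [j, k]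

variable {a : Fin 3 → Fin 5 → ℂ}

lemma trw_swap (i j k : Fin 3) :
    trw (fun i => mat (a i)) [i, j, k] = trw (fun i => mat (a i)) [i, k, j] := by
  rw [← (isSystem a).trw_reverse [i, j, k]]
  exact trw_append_comm [k, j] [i]

lemma three_eq_zero {N : List (Fin 3) → ℂ} (r : ∀ i j k, N [i, j, k] = N [j, k, i])
    (s : ∀ i j k, N [i, j, k] = N [i, k, j])
    (h000 : N [0, 0, 0] = 0) (h001 : N [0, 0, 1] = 0) (h002 : N [0, 0, 2] = 0)
    (h011 : N [0, 1, 1] = 0) (h012 : N [0, 1, 2] = 0) (h022 : N [0, 2, 2] = 0)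
    (h111 : N [1, 1, 1] = 0) (h112 : N [1, 1, 2] = 0) (h122 : N [1, 2, 2] = 0)
    (h222 : N [2, 2, 2] = 0) (i j k : Fin 3) : N [i, j, k] = 0 := by
  have h : ∀ i j k : Fin 3, i ≤ j → j ≤ k → N [i, j, k] = 0 := by
    intro i j k
    fin_cases i <;> fin_cases j <;> fin_cases k <;> intro hij hjk <;>
      first | assumption | exact absurd hij (by decide) | exact absurd hjk (by decide)
  rcases le_total i j with h1 | h1 <;> rcases le_total j k with h2 | h2 <;>
    rcases le_total i k with h3 | h3
  · exact h _ _ _ h1 h2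
  · exact h _ _ _ h1 h2
  · rw [s]; exact h _ _ _ h3 h2
  · rw [r, r]; exact h _ _ _ h3 h1
  · rw [r, s]; exact h _ _ _ h1 h3
  · rw [r]; exact h _ _ _ h2 h3
  · rw [r, r, s]; exact h _ _ _ h2 h1
  · rw [r, r, s]; exact h _ _ _ h2 h1

/-- The invariants of degree at most three cut out the common zeros of all basic invariants. -/
lemma trw_gword_eq_zero {N : List (Fin 3) → ℂ} (hN : N = trw fun i => mat (a i))
    (h2 : ∀ i j, N [i, j] = 0) (h3 : ∀ i j k, N [i, j, k] = 0) (j : Fin 25) :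
    N (gword j) = 0 := by
  subst hN
  have hsa : ∀ i, IsSA (mat (a i)) := fun i => isSA_mat _
  have t2 : ∀ i j, (mat (a i) * mat (a j)).trace = 0 := fun i j => by simpa [trw] using h2 i j
  have t3 : ∀ i j k, (mat (a i) * mat (a j) * mat (a k)).trace = 0 := fun i j k => by
    simpa [trw, mul_assoc] using h3 i j k
  have h4 : ∀ i j k, trw (fun i => mat (a i)) [i, i, j, k] = 0 := fun i j k => by
    have := trace_sq_mul_mul (hsa i) (hsa j) (hsa k) (t2 i i) (t2 i j) (t2 i k) (t3 i i i)
      (t3 i i j) (t3 i i k)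
    simpa [trw, mul_assoc] using this
  obtain ⟨c, hc, h⟩ := exists_dependent a t2
  have hc' : c 0 ≠ 0 ∨ c 1 ≠ 0 ∨ c 2 ≠ 0 := by
    by_contra! h
    exact hc (funext fun i => by fin_cases i <;> simp [h])
  rw [Fin.sum_univ_three] at h
  have h5 : ∀ i j k, (c i ≠ 0 ∨ c j ≠ 0 ∨ c k ≠ 0) →
      c i • mat (a i) + c j • mat (a j) + c k • mat (a k) = 0 →
      trw (fun i => mat (a i)) [i, i, j, j, k] = 0 := fun i j k hc h => by
    have e : ∀ l, ![mat (a i), mat (a j), mat (a k)] l = mat (a (![i, j, k] l)) := fun l => by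
      fin_cases l <;> rfl
    have := trace_quintic (hsa i) (hsa j) (hsa k) rfl
      (fun l m => by simpa [trw, e] using t2 (![i, j, k] l) (![i, j, k] m))
      (fun l m n => by
        simpa [trw, e, mul_assoc] using t3 (![i, j, k] l) (![i, j, k] m) (![i, j, k] n)) hc h
    simpa [trw, mul_assoc] using this
  have g2 := h5 0 1 2 hc' h
  have g1 := h5 0 2 1 (by tauto) (by rw [← h]; abel)
  have g0 := h5 1 2 0 (by tauto) (by rw [← h]; abel)
  fin_cases j
  iterate 6 exact h2 _ _
  iterate 10 exact h3 _ _ _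
  iterate 6 exact h4 _ _ _
  exacts [g2, g1, g0]

/-- Contractions of a linear dependency with the cubic invariants. -/
lemma exists_cubic_relations {N : List (Fin 3) → ℂ} (hN : N = trw fun i => mat (a i))
    (h2 : ∀ i j, N [i, j] = 0) : ∃ c : Fin 3 → ℂ, (c 0 ≠ 0 ∨ c 1 ≠ 0 ∨ c 2 ≠ 0) ∧
      ∀ j k, c 0 * N [0, j, k] + c 1 * N [1, j, k] + c 2 * N [2, j, k] = 0 := by
  subst hN
  obtain ⟨c, hc, h⟩ := exists_dependent a fun i j => by simpa [trw] using h2 i j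
  refine ⟨c, ?_, fun j k => ?_⟩
  · by_contra! h
    exact hc (funext fun i => by fin_cases i <;> simp [h])
  · have := congrArg (fun m => (m * (mat (a j) * mat (a k))).trace) h
    simpa [Fin.sum_univ_three, add_mul, trw, Matrix.trace_add] using this

lemma cubic_relations_aux {α β γ p q r s t : ℂ} (h0 : α ≠ 0 ∨ β ≠ 0 ∨ γ ≠ 0)
    (k00 : α * 0 + β * p + γ * t = 0) (k01 : α * p + β * r + γ * q = 0)
    (k02 : α * t + β * q + γ * p = 0) (k11 : α * r + β * 0 + γ * p = 0)
    (k12 : α * q + β * p + γ * s = 0) (k22 : α * p + β * s + γ * 0 = 0)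
    (ht : r + s + t = 0) : p = 0 ∧ r = 0 ∧ s = 0 ∧ q = 0 := by
  have cancel : ∀ {u v : ℂ}, u ≠ 0 → u * v = 0 → v = 0 := fun hu h =>
    (mul_eq_zero.mp h).resolve_left hu
  by_cases ha : α = 0
  · subst ha
    by_cases hc : γ = 0
    · subst hc
      have hb : β ≠ 0 := by simpa using h0
      exact ⟨cancel hb (by linear_combination k00), cancel hb (by linear_combination k01),
        cancel hb (by linear_combination k22), cancel hb (by linear_combination k02)⟩
    · have hp : p = 0 := cancel hc (by linear_combination k11)
      subst hp
      have hs : s = 0 := cancel hc (by linear_combination k12)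
      have ht' : t = 0 := cancel hc (by linear_combination k00)
      have hr : r = 0 := by linear_combination ht - hs - ht'
      subst hr
      exact ⟨rfl, rfl, hs, cancel hc (by linear_combination k01)⟩
  · obtain ⟨b, rfl⟩ : ∃ b, β = α * b := ⟨β / α, by field_simp⟩
    obtain ⟨g, rfl⟩ : ∃ g, γ = α * g := ⟨γ / α, by field_simp⟩
    have hp : p = - b * s := by
      linear_combination (cancel ha (by linear_combination k22) : p + b * s = 0)
    have hr : r = g * b * s := by
      linear_combination (cancel ha (by linear_combination k11) : r + g * p = 0) - g * hp
    have hq : q = b ^ 2 * s - g * s := by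
      linear_combination (cancel ha (by linear_combination k12) : q + b * p + g * s = 0) - b * hp
    have ht' : t = - g * b * s - s := by linear_combination ht - hr
    subst hp hr hq ht'
    have f1 : s * (b ^ 2 + g + b * g ^ 2) = 0 := cancel ha (by linear_combination -k00)
    have f2 : s * (-b + 2 * b ^ 2 * g - g ^ 2) = 0 := cancel ha (by linear_combination k01)
    have f3 : s * (b ^ 3 - 3 * b * g - 1) = 0 := cancel ha (by linear_combination k02)
    have hs : s = 0 := by
      by_contra hs
      have f1 := cancel hs f1
      have f2 := cancel hs f2
      have f3 := cancel hs f3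
      have f4 : g * (1 + 2 * b ^ 3) = 0 := by linear_combination f1 + b * f2
      rcases mul_eq_zero.mp f4 with hg | hb
      · subst hg
        have hb : b = 0 := by linear_combination -f2
        subst hb
        norm_num at f3
      · have h1 : b * g = -1 / 2 := by linear_combination -f3 / 3 + hb / 6
        have h2 : (1 / 4 : ℂ) = 1 := by
          linear_combination b * f1 - (b * g - 1 / 2 + 1) * h1 - hb / 2
        norm_num at h2
    subst hs
    simp

lemma zeros_of_six_six {N : List (Fin 3) → ℂ} (hN : N = trw fun i => mat (a i))
    (h2 : ∀ i j, N [i, j] = 0) (h000 : N [0, 0, 0] = 0) (h111 : N [1, 1, 1] = 0)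
    (h222 : N [2, 2, 2] = 0) (e1 : N [0, 0, 1] = N [1, 1, 2]) (e2 : N [1, 1, 2] = N [0, 2, 2])
    (e3 : N [0, 1, 1] + N [1, 2, 2] + N [0, 0, 2] = 0) (i j k : Fin 3) : N [i, j, k] = 0 := by
  obtain ⟨c, hc, h⟩ := exists_cubic_relations hN h2
  have r : ∀ i j k, N [i, j, k] = N [j, k, i] := by rw [hN]; exact trw_rotate
  have s : ∀ i j k, N [i, j, k] = N [i, k, j] := by rw [hN]; exact trw_swap
  have k00 := h 0 0
  have k01 := h 0 1
  have k02 := h 0 2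
  have k11 := h 1 1
  have k12 := h 1 2
  have k22 := h 2 2
  rw [r 1 0 0, r 2 0 0] at k00
  rw [r 1 0 1, r 2 0 1] at k01
  rw [r 1 0 2, s 0 2 1, r 2 0 2] at k02
  rw [r 2 1 1] at k11
  rw [r 2 1 2] at k12
  suffices H : N [0, 0, 1] = 0 ∧ N [0, 1, 1] = 0 ∧ N [1, 2, 2] = 0 ∧ N [0, 1, 2] = 0 by
    obtain ⟨H1, H2, H3, H4⟩ := H
    have H5 : N [0, 0, 2] = 0 := by linear_combination e3 - H2 - H3
    exact three_eq_zero r s h000 H1 H5 H2 H4 (by rw [← e2, ← e1, H1]) h111 (by rw [← e1, H1])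
      H3 h222 i j k
  simp only [h000, h111, h222, ← e2, ← e1] at k00 k01 k02 k11 k12 k22
  exact cubic_relations_aux hc k00 k01 k02 k11 k12 k22 (by linear_combination e3)

lemma zeros_of_five_seven {N : List (Fin 3) → ℂ} (hN : N = trw fun i => mat (a i))
    (q00 : N [0, 0] = 0) (q01 : N [0, 1] = 0) (q12 : N [1, 2] = 0) (q22 : N [2, 2] = 0)
    (e : N [1, 1] = N [0, 2]) (h000 : N [0, 0, 0] = 0) (h001 : N [0, 0, 1] = 0)
    (h122 : N [1, 2, 2] = 0) (h222 : N [2, 2, 2] = 0) (h111 : N [1, 1, 1] = 0)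
    (e1 : N [0, 1, 1] = N [0, 0, 2]) (e2 : N [1, 1, 2] = N [0, 2, 2]) :
    (∀ i j, N [i, j] = 0) ∧ ∀ i j k, N [i, j, k] = 0 := by
  have q11 : N [1, 1] = 0 := by
    subst hN
    simp [trw] at *
    exact trace_sq_eq_zero (z := mat (a 2)) (isSA_mat _) (isSA_mat _) q00 q01 e.symm
      (by simpa [mul_assoc] using h000) (by simpa [mul_assoc] using h001)
      (by simpa [mul_assoc] using h111) (by simpa [mul_assoc] using e1)
  have h2 : ∀ i j, N [i, j] = 0 := by
    subst hN
    exact trw_two_eq_zero q00 q01 (by rw [← e, q11]) q11 q12 q22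
  refine ⟨h2, fun i j k => ?_⟩
  obtain ⟨c, hc, h⟩ := exists_cubic_relations hN h2
  have r : ∀ i j k, N [i, j, k] = N [j, k, i] := by rw [hN]; exact trw_rotate
  have s : ∀ i j k, N [i, j, k] = N [i, k, j] := by rw [hN]; exact trw_swap
  have k00 := h 0 0
  have k01 := h 0 1
  have k02 := h 0 2
  have k11 := h 1 1
  have k12 := h 1 2
  have k22 := h 2 2
  rw [r 1 0 0, r 2 0 0] at k00
  rw [r 1 0 1, r 2 0 1] at k01
  rw [r 1 0 2, s 0 2 1, r 2 0 2] at k02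
  rw [r 2 1 1] at k11
  rw [r 2 1 2] at k12
  suffices H : N [0, 1, 1] = 0 ∧ N [0, 1, 2] = 0 ∧ N [1, 1, 2] = 0 by
    obtain ⟨H1, H2, H3⟩ := H
    exact three_eq_zero r s h000 h001 (by rw [← e1, H1]) H1 H2 (by rw [← e2, H3]) h111 H3
      h122 h222 i j k
  simp only [h000, h001, h122, h222, h111, ← e1, ← e2] at k00 k01 k02 k11 k12 k22
  have cancel : ∀ {u v : ℂ}, u ≠ 0 → u * v = 0 → v = 0 := fun hu h =>
    (mul_eq_zero.mp h).resolve_left hu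
  by_cases h2 : c 2 = 0
  · simp only [h2] at k00 k01 k02 k11 k12 k22 hc
    by_cases h0 : c 0 = 0
    · simp only [h0] at k00 k01 k02 k11 k12 k22 hc
      have h1 : c 1 ≠ 0 := by simpa using hc
      exact ⟨cancel h1 (by linear_combination k01), cancel h1 (by linear_combination k02),
        cancel h1 (by linear_combination k12)⟩
    · have hr := cancel h0 (show c 0 * N [1, 1, 2] = 0 by linear_combination k22)
      rw [hr] at k12
      exact ⟨cancel h0 (by linear_combination k11), cancel h0 (by linear_combination k12), hr⟩
  · have hp := cancel h2 (show c 2 * N [0, 1, 1] = 0 by linear_combination k00)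
    rw [hp] at k01 k11
    have hq := cancel h2 (show c 2 * N [0, 1, 2] = 0 by linear_combination k01)
    exact ⟨hp, hq, cancel h2 (by linear_combination k11)⟩

end Nullcone

section Jacobian

variable {σ : Type*} {k : ℕ} {P : Fin k → MvPolynomial σ ℂ}

lemma derivation_aeval (D : Derivation ℂ (MvPolynomial σ ℂ) (MvPolynomial σ ℂ))
    (F : MvPolynomial (Fin k) ℂ) :
    D (aeval P F) = ∑ j, aeval P (pderiv j F) * D (P j) := by
  induction F using MvPolynomial.induction_on with
  | C c => simp [algebraMap_eq, derivation_C]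
  | add f g hf hg => simp only [map_add, hf, hg, add_mul, Finset.sum_add_distrib]
  | mul_X f i hf =>
    simp only [map_mul, aeval_X, Derivation.leibniz, smul_eq_mul, hf, pderiv_X, map_add, add_mul,
      Finset.sum_add_distrib]
    have h : ∑ j, aeval P f * aeval P (Pi.single (M := fun _ => MvPolynomial (Fin k) ℂ) j 1 i) *
        D (P j) = aeval P f * D (P i) := by
      rw [Finset.sum_eq_single i]
      · simp
      · intro j _ hj
        simp [hj.symm]
      · simp
    rw [h, Finset.mul_sum]
    simp only [mul_assoc]

lemma eq_zero_of_aeval_eq_zero (D : Fin k → Derivation ℂ (MvPolynomial σ ℂ) (MvPolynomial σ ℂ))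
    (hdet : (Matrix.of fun j l => D l (P j)).det ≠ 0) (n : ℕ) : ∀ F : MvPolynomial (Fin k) ℂ,
    aeval P F = 0 → (∀ m : Fin k →₀ ℕ, n ≤ m.degree → coeff m F = 0) → F = 0 := by
  induction n with
  | zero => exact fun F _ h => MvPolynomial.ext _ _ fun m => by simpa using h m (Nat.zero_le _)
  | succ n ih =>
    intro F hF h
    have hp : ∀ j, pderiv j F = 0 := by
      have hv : Matrix.vecMul (fun j => aeval P (pderiv j F)) (Matrix.of fun j l => D l (P j)) =
          0 := by
        ext1 l
        rw [Pi.zero_apply, ← map_zero (D l), ← hF, derivation_aeval]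
        rfl
      have := Matrix.eq_zero_of_vecMul_eq_zero hdet hv
      refine fun j => ih _ (congrFun this j) fun m hm => ?_
      rw [coeff_pderiv, h, zero_mul]
      simpa using hm
    have hC : F = C (coeff 0 F) := by
      ext m
      rw [coeff_C]
      split_ifs with hm
      · rw [hm]
      · obtain ⟨i, hi⟩ := Finsupp.ne_iff.mp (Ne.symm hm)
        have hi' : Finsupp.single i 1 ≤ m := by
          rw [Finsupp.single_le_iff]
          exact Nat.one_le_iff_ne_zero.mpr hi
        have := congrArg (coeff (m - Finsupp.single i 1)) (hp i)
        rw [coeff_pderiv, tsub_add_cancel_of_le hi', coeff_zero] at this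
        exact (mul_eq_zero.mp this).resolve_right (Nat.cast_add_one_ne_zero _)
    rw [hC, aeval_C, algebraMap_eq, ← C_0] at hF
    rw [hC, C_injective _ _ hF, C_0]

/-- The Jacobian criterion for algebraic independence. -/
theorem algebraicIndependent_of_det_ne_zero
    (D : Fin k → Derivation ℂ (MvPolynomial σ ℂ) (MvPolynomial σ ℂ))
    (hdet : (Matrix.of fun j l => D l (P j)).det ≠ 0) : AlgebraicIndependent ℂ P := by
  rw [algebraicIndependent_iff]
  refine fun F hF => eq_zero_of_aeval_eq_zero D hdet (F.totalDegree + 1) F hF fun m hm => ?_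
  refine coeff_eq_zero_of_totalDegree_lt ?_
  rw [Finsupp.degree] at hm
  exact hm

lemma aeval_dual (p : σ → DualNumber ℂ) (f : MvPolynomial σ ℂ) :
    (aeval p f).fst = eval (fun i => (p i).fst) f ∧
    (aeval p f).snd = eval (fun i => (p i).fst) (mkDerivation ℂ (fun i => C (p i).snd) f) := by
  induction f using MvPolynomial.induction_on with
  | C c => simp [TrivSqZeroExt.algebraMap_eq_inl, derivation_C]
  | add f g hf hg => simp [hf.1, hf.2, hg.1, hg.2]
  | mul_X f i hf =>
    simp only [map_mul, aeval_X, TrivSqZeroExt.fst_mul, TrivSqZeroExt.snd_mul, hf.1, hf.2, eval_X,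
      Derivation.leibniz, mkDerivation_X, smul_eq_mul, map_add, eval_C, true_and,
      MulOpposite.smul_eq_mul_unop, MulOpposite.unop_op]
    ring

/-- The Jacobian criterion, with derivatives computed over the dual numbers. -/
theorem algebraicIndependent_of_dual (c : σ → ℂ) (p : Fin k → σ → DualNumber ℂ)
    (hp : ∀ l i, (p l i).fst = c i)
    (hdet : (Matrix.of fun j l => (aeval (p l) (P j)).snd).det ≠ 0) :
    AlgebraicIndependent ℂ P := by
  refine algebraicIndependent_of_det_ne_zero (fun l => mkDerivation ℂ fun i => C (p l i).snd)
    fun h => hdet ?_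
  have := congrArg (eval c) h
  rw [RingHom.map_det, map_zero] at this
  rw [← this]
  congr 1
  ext j l
  simp [(aeval_dual (p l) (P j)).2, hp]

end Jacobian

section Evaluation

variable {A : Type*} [CommRing A] [Algebra ℂ A]

/-- Evaluation at the triple of quartic forms with the given normalised coefficients. -/
def evalAt (a : Fin 3 → Fin 5 → A) : Coord →ₐ[ℂ] A :=
  aeval fun j => binom4 (pos j) • a j.1 (pos j)

lemma evalAt_trc (a : Fin 3 → Fin 5 → A) (w : List (Fin 3)) :
    evalAt a (trc w) = trw (fun i => mat (a i)) w := by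
  have h := map_trw (evalAt a : Coord →+* A) (fun i => mat (coef i)) w
  rw [RingHom.coe_coe] at h
  rw [trc, h]
  simp only [map_mat]
  congr! 4 with i
  ext k
  simp [coef, evalAt, ← algebraMap_eq, ← Algebra.smul_def, smul_smul, binom4_ne_zero]

/-- Extension of scalars from integral to complex dual numbers. -/
def dualCast : DualNumber ℤ →+* DualNumber ℂ where
  toFun z := TrivSqZeroExt.inl (z.fst : ℂ) + TrivSqZeroExt.inr (z.snd : ℂ)
  map_one' := by ext <;> simp
  map_zero' := by ext <;> simp
  map_add' x y := by ext <;> simp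
  map_mul' x y := by ext <;> simp

lemma fst_dualCast (z : DualNumber ℤ) : (dualCast z).fst = z.fst := by
  simp [dualCast]

lemma snd_dualCast (z : DualNumber ℤ) : (dualCast z).snd = z.snd := by
  simp [dualCast]

lemma evalAt_dualCast (a : Fin 3 → Fin 5 → DualNumber ℤ) (w : List (Fin 3)) :
    evalAt (fun i => dualCast ∘ a i) (trc w) = dualCast (trw (fun i => mat (a i)) w) := by
  rw [evalAt_trc, map_trw]
  simp only [map_mat]

end Evaluation

/-- The vector of dual numbers with the given value and derivative. -/
def dv (f s : Fin 5 → ℤ) (k : Fin 5) : DualNumber ℤ := (f k, s k)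

/-- A triple of quartic forms over the dual numbers, at which the `j`-th basic invariant is, to
first order, the only basic invariant of its degree that does not vanish. -/
def minPt : Fin 25 → Fin 3 → Fin 5 → DualNumber ℤ :=
  let o : Fin 5 → ℤ := 0
  let u : Fin 5 → ℤ := ![0, 0, 1, 0, 0]
  let v : Fin 5 → ℤ := ![0, 1, 0, 0, 0]
  let w : Fin 5 → ℤ := ![0, 0, 0, 1, 0]
  let y : Fin 5 → ℤ := ![-3, 0, -1, 0, 1]
  let z : Fin 5 → ℤ := ![3, 0, 0, 0, 1]
  ![![dv u u, 0, 0], ![dv u o, dv o u, 0], ![dv u o, 0, dv o u], ![0, dv u u, 0],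
    ![0, dv u o, dv o u], ![0, 0, dv u u],
    ![dv u u, 0, 0], ![dv u o, dv o u, 0], ![dv u o, 0, dv o u],
    ![dv o u, dv u o, 0], ![dv u o, dv v o, dv o w], ![dv o u, 0, dv u o],
    ![0, dv u u, 0], ![0, dv u o, dv o u], ![0, dv o u, dv u o], ![0, 0, dv u u],
    ![dv v o, dv y y, 0], ![dv v o, 0, dv y y], ![0, dv v o, dv y y],
    ![dv v o, dv y o, dv o y], ![dv y o, dv v o, dv o y], ![dv y o, dv o y, dv v o],
    ![dv v o, dv y o, dv o z], ![dv v o, dv o z, dv y o], ![dv o z, dv v o, dv y o]]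

lemma snd_trw_minPt_of_ne : ∀ j k : Fin 25, j ≠ k → (gword j).length = (gword k).length →
    (trw (fun i => mat (minPt j i)) (gword k)).snd = 0 := by
  decide +kernel

lemma snd_trw_minPt_self : ∀ j : Fin 25,
    (trw (fun i => mat (minPt j i)) (gword j)).snd ≠ 0 := by
  decide +kernel

lemma trw_minPt_eq_zero : ∀ j : Fin 25, 4 ≤ (gword j).length → ∀ k, (gword k).length = 2 →
    trw (fun i => mat (minPt j i)) (gword k) = 0 := by
  have : ∀ j : Fin 25, 4 ≤ (gword j).length → ∀ k, (gword k).length = 2 →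
    (trw (fun i => mat (minPt j i)) (gword k)).fst = 0 ∧
     (trw (fun i => mat (minPt j i)) (gword k)).snd = 0 := by
    decide +kernel
  exact fun j hj k hk => TrivSqZeroExt.ext (this j hj k hk).1 (this j hj k hk).2

section Scaling

variable {A : Type*} [CommRing A]

lemma trw_smul (t : A) (a : Fin 3 → Fin 5 → A) (w : List (Fin 3)) :
    trw (fun i => mat fun k => t * a i k) w = t ^ w.length * trw (fun i => mat (a i)) w := by
  have h : ∀ i, mat (fun k => t * a i k) = t • mat (a i) := fun i => by
    ext k l
    fin_cases k <;> fin_cases l <;> simp [mat, mul_left_comm]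
  have h2 : ∀ w : List (Fin 3), (w.map fun i => t • mat (a i)).prod =
      t ^ w.length • (w.map fun i => mat (a i)).prod := fun w => by
    induction w with
    | nil => simp
    | cons i w ih => simp [ih, pow_succ, mul_smul]
  simp only [trw, h, h2, Matrix.trace_smul, smul_eq_mul]

lemma coeff_mul_of_coeff_eq_zero {p q : Polynomial A} {n : ℕ} (h2 : 2 ≤ n) (h5 : n ≤ 5)
    (hp : p.coeff 1 = 0 ∧ (4 ≤ n → p.coeff 2 = 0)) (hq : q.coeff 1 = 0 ∧ (4 ≤ n → q.coeff 2 = 0)) :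
    (p * q).coeff n = p.coeff 0 * q.coeff n + q.coeff 0 * p.coeff n := by
  rw [Polynomial.coeff_mul]
  interval_cases n <;> simp_all [Finset.Nat.antidiagonal_succ, mul_comm]

variable [Algebra ℂ A]

/-- The restriction of a polynomial to the line through a point with coordinates in `A`. -/
def lineHom (a : Fin 3 → Fin 5 → A) : Coord →ₐ[ℂ] Polynomial A :=
  evalAt fun i k => Polynomial.X * Polynomial.C (a i k)

lemma lineHom_trc (a : Fin 3 → Fin 5 → A) (w : List (Fin 3)) :
    lineHom a (trc w) = Polynomial.X ^ w.length * Polynomial.C (trw (fun i => mat (a i)) w) := by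
  rw [lineHom, evalAt_trc, trw_smul, map_trw]
  simp only [map_mat]
  rfl

lemma coeff_zero_lineHom (a : Fin 3 → Fin 5 → A) (f : Coord) :
    (lineHom a f).coeff 0 = algebraMap ℂ A (constantCoeff f) := by
  have : (Polynomial.constantCoeff.comp (lineHom a : Coord →+* Polynomial A)) =
      (algebraMap ℂ A).comp constantCoeff := by
    ext j
    · simp [lineHom, evalAt]
    · simp [lineHom, evalAt]
  exact RingHom.congr_fun this f

end Scaling

lemma two_le_length_gword (j : Fin 25) : 2 ≤ (gword j).length ∧ (gword j).length ≤ 5 := by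
  decide +revert

/-- The line through the `j`-th distinguished point. -/
def minHom (j : Fin 25) : Coord →ₐ[ℂ] Polynomial (DualNumber ℂ) :=
  lineHom fun i => dualCast ∘ minPt j i

lemma minHom_trc (j : Fin 25) (w : List (Fin 3)) : minHom j (trc w) =
    Polynomial.X ^ w.length * Polynomial.C (dualCast (trw (fun i => mat (minPt j i)) w)) := by
  have h := map_trw dualCast (fun i => mat (minPt j i)) w
  simp only [map_mat] at h
  rw [minHom, lineHom_trc, h]

lemma coeff_minHom (j : Fin 25) {f : Coord} (hf : f ∈ gens) :
    (minHom j f).coeff 1 = 0 ∧ (4 ≤ (gword j).length → (minHom j f).coeff 2 = 0) := by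
  induction hf using Algebra.adjoin_induction with
  | mem f hf =>
    obtain ⟨k, rfl⟩ := hf
    have h := minHom_trc j (gword k)
    rw [trc] at h
    simp only [h]
    have hk := two_le_length_gword k
    refine ⟨?_, fun hj => ?_⟩
    · rw [Polynomial.coeff_X_pow_mul', if_neg (by omega)]
    · rw [Polynomial.coeff_X_pow_mul']
      split_ifs with h2
      · rw [trw_minPt_eq_zero j hj k (by omega)]
        simp
      · rfl
  | algebraMap c => simp [Polynomial.algebraMap_apply]
  | add f g _ _ hf hg =>
    simp only [map_add, Polynomial.coeff_add, hf.1, hg.1, add_zero, true_and]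
    intro h
    rw [hf.2 h, hg.2 h, add_zero]
  | mul f g _ _ hf hg =>
    rw [map_mul]
    refine ⟨?_, fun h => ?_⟩
    · simp [Polynomial.coeff_mul, Finset.Nat.antidiagonal_succ, hf.1, hg.1]
    · simp [Polynomial.coeff_mul, Finset.Nat.antidiagonal_succ, hf.1, hg.1, hf.2 h, hg.2 h]

/-- A family of point derivations of the invariant ring at the origin. -/
def cotangent (f : Coord) (j : Fin 25) : ℂ := ((minHom j f).coeff (gword j).length).snd

lemma cotangent_add (f g : Coord) : cotangent (f + g) = cotangent f + cotangent g := by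
  ext j
  simp [cotangent]

lemma cotangent_mul {f g : Coord} (hf : f ∈ gens) (hg : g ∈ gens) :
    cotangent (f * g) = constantCoeff f • cotangent g + constantCoeff g • cotangent f := by
  ext j
  have h := two_le_length_gword j
  rw [cotangent, map_mul, coeff_mul_of_coeff_eq_zero h.1 h.2 (coeff_minHom j hf)
    (coeff_minHom j hg),
    minHom, coeff_zero_lineHom, coeff_zero_lineHom]
  simp [cotangent, minHom, TrivSqZeroExt.algebraMap_eq_inl]

lemma cotangent_C (c : ℂ) : cotangent (algebraMap ℂ Coord c) = 0 := by
  ext j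
  have h := two_le_length_gword j
  rw [cotangent, AlgHom.commutes, Polynomial.algebraMap_apply, Polynomial.coeff_C,
    if_neg (by omega)]
  rfl

lemma cotangent_trc (k j : Fin 25) : cotangent (trc (gword k)) j =
    if j = k then ((trw (fun i => mat (minPt j i)) (gword j)).snd : ℂ) else 0 := by
  rw [cotangent, minHom_trc, Polynomial.coeff_X_pow_mul']
  split_ifs with h1 h2 h2
  · rw [h2]
    simp [snd_dualCast]
  · by_cases h3 : (gword j).length = (gword k).length
    · rw [h3, Nat.sub_self, Polynomial.coeff_C_zero, snd_dualCast, snd_trw_minPt_of_ne j k h2 h3,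
        Int.cast_zero]
    · rw [Polynomial.coeff_C, if_neg (by omega)]
      rfl
  · rw [h2] at h1
    exact absurd le_rfl h1
  · rfl

theorem card_le_of_adjoin_eq (S : Finset Coord) (hS : Algebra.adjoin ℂ (S : Set Coord) = gens) :
    25 ≤ S.card := by
  classical
  have hmem : ∀ f ∈ gens, cotangent f ∈ Submodule.span ℂ
      (S.image cotangent : Set (Fin 25 → ℂ)) := by
    intro f hf
    have hS' : ∀ f ∈ Algebra.adjoin ℂ (S : Set Coord), f ∈ gens := fun f hf => hS ▸ hf
    rw [← hS] at hf
    induction hf using Algebra.adjoin_induction with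
    | mem f hf => exact Submodule.subset_span (by simpa using ⟨f, hf, rfl⟩)
    | algebraMap c =>
      rw [cotangent_C]
      exact Submodule.zero_mem _
    | add f g _ _ hf hg =>
      rw [cotangent_add]
      exact Submodule.add_mem _ hf hg
    | mul f g hf' hg' hf hg =>
      rw [cotangent_mul (hS' f hf') (hS' g hg')]
      exact Submodule.add_mem _ (Submodule.smul_mem _ _ hg) (Submodule.smul_mem _ _ hf)
  have htop : Submodule.span ℂ
      (S.image cotangent : Set (Fin 25 → ℂ)) = ⊤ := by
    rw [eq_top_iff]
    intro v _
    have : v = ∑ k, (v k / ((trw (fun i => mat (minPt k i)) (gword k)).snd : ℂ)) •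
        cotangent (trc (gword k)) := by
      ext j
      have hj : ((trw (fun i => mat (minPt j i)) (gword j)).snd : ℂ) ≠ 0 :=
        Int.cast_ne_zero.mpr (snd_trw_minPt_self j)
      simp [Finset.sum_apply, cotangent_trc, hj]
    rw [this]
    exact Submodule.sum_mem _ fun k _ => Submodule.smul_mem _ _ (hmem _ (trc_mem_gens _))
  have h := finrank_span_finset_le_card (R := ℂ) (S.image cotangent)
  rw [Set.finrank, htop, finrank_top, Module.finrank_fin_fun] at h
  exact h.trans Finset.card_image_le

lemma trc_gword_injective : Function.Injective fun j => trc (gword j) := by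
  intro j k h
  by_contra hne
  have h1 := congrFun (congrArg cotangent h) j
  simp only [cotangent_trc, if_neg hne, if_true] at h1
  exact snd_trw_minPt_self j (by exact_mod_cast h1)

theorem isMinimalNumGens : IsMinimalNumGens ![4, 4, 4] 25 := by
  classical
  refine ⟨⟨Finset.univ.image fun j => trc (gword j), ?_, ?_⟩, ?_⟩
  · rw [Finset.card_image_of_injective _ trc_gword_injective, Finset.card_fin]
  · rw [invariantRing_eq_gens, Finset.coe_image, Finset.coe_univ, Set.image_univ]
    rfl
  · rintro _ ⟨S, rfl, hS⟩
    exact card_le_of_adjoin_eq S (hS.trans invariantRing_eq_gens)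

/-- Algebraic independence of twelve functions whose Jacobian matrix along integral directions at an
integral point is diagonal. -/
lemma algebraicIndependent_of_diagonal {P : Fin 12 → Coord}
    (p : Fin 12 → Fin 3 → Fin 5 → DualNumber ℤ) {Q : Fin 12 → Fin 12 → DualNumber ℤ}
    (hQ : ∀ l j, evalAt (fun i => dualCast ∘ p l i) (P j) = dualCast (Q l j))
    (hp : ∀ l i k, (p l i k).fst = (p 0 i k).fst) (hne : ∀ l j, j ≠ l → (Q l j).snd = 0)
    (hself : ∀ l, (Q l l).snd ≠ 0) : AlgebraicIndependent ℂ P := by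
  refine algebraicIndependent_of_dual (fun j => binom4 (pos j) * (p 0 j.1 (pos j)).fst)
    (fun l j => binom4 (pos j) • dualCast (p l j.1 (pos j))) (fun l j => ?_) ?_
  · rw [TrivSqZeroExt.fst_smul, fst_dualCast, hp, smul_eq_mul]
  · have : (Matrix.of fun j l => (aeval (fun j => binom4 (pos j) • dualCast (p l j.1 (pos j)))
        (P j)).snd) = Matrix.diagonal fun l => ((Q l l).snd : ℂ) := by
      ext j l
      have h : aeval (fun j => binom4 (pos j) • dualCast (p l j.1 (pos j))) (P j) =
        dualCast (Q l j) := hQ l j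
      rw [Matrix.of_apply, h, snd_dualCast]
      by_cases hj : j = l
      · rw [hj, Matrix.diagonal_apply_eq]
      · rw [Matrix.diagonal_apply_ne _ hj, hne l j hj, Int.cast_zero]
    rw [this, Matrix.det_diagonal]
    exact Finset.prod_ne_zero_iff.mpr fun l _ => Int.cast_ne_zero.mpr (hself l)

section Families

variable {R : Type*} [CommRing R]

/-- Six quadratic and six cubic combinations of the values `N w` of the basic invariants. -/
def sixSix (N : List (Fin 3) → R) : Fin 12 → R :=
  ![N [0, 0], N [0, 1], N [0, 2], N [1, 1], N [1, 2], N [2, 2], N [0, 0, 0], N [1, 1, 1],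
    N [2, 2, 2], N [0, 0, 1] - N [1, 1, 2], N [1, 1, 2] - N [0, 2, 2],
    N [0, 1, 1] + N [1, 2, 2] + N [0, 0, 2]]

/-- Five quadratic and seven cubic combinations of the values `N w` of the basic invariants. -/
def fiveSeven (N : List (Fin 3) → R) : Fin 12 → R :=
  ![N [0, 0], N [0, 1], N [1, 2], N [2, 2], N [1, 1] - N [0, 2], N [0, 0, 0], N [0, 0, 1],
    N [1, 2, 2], N [2, 2, 2], N [1, 1, 1], N [0, 1, 1] - N [0, 0, 2], N [1, 1, 2] - N [0, 2, 2]]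

variable {R' : Type*} [CommRing R'] (φ : R →+* R') (N : List (Fin 3) → R) (j : Fin 12)

lemma map_sixSix : φ (sixSix N j) = sixSix (fun w => φ (N w)) j := by
  fin_cases j <;> simp [sixSix]

lemma map_fiveSeven : φ (fiveSeven N j) = fiveSeven (fun w => φ (N w)) j := by
  fin_cases j <;> simp [fiveSeven]

lemma sixSix_induction {N : List (Fin 3) → R} {p : ℕ → R → Prop}
    (h : ∀ w n, w.length = n → p n (N w))
    (hsub : ∀ n x y, p n x → p n y → p n (x - y))
    (hadd : ∀ n x y, p n x → p n y → p n (x + y)) (j : Fin 12) :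
    p ((![2, 2, 2, 2, 2, 2, 3, 3, 3, 3, 3, 3] : Fin 12 → ℕ) j) (sixSix N j) := by
  fin_cases j <;> first
    | exact h _ _ rfl
    | exact hsub _ _ _ (h _ _ rfl) (h _ _ rfl)
    | exact hadd _ _ _ (hadd _ _ _ (h _ _ rfl) (h _ _ rfl)) (h _ _ rfl)

lemma fiveSeven_induction {N : List (Fin 3) → R} {p : ℕ → R → Prop}
    (h : ∀ w n, w.length = n → p n (N w))
    (hsub : ∀ n x y, p n x → p n y → p n (x - y)) (j : Fin 12) :
    p ((![2, 2, 2, 2, 2, 3, 3, 3, 3, 3, 3, 3] : Fin 12 → ℕ) j)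
    (fiveSeven N j) := by
  fin_cases j <;> first
    | exact h _ _ rfl
    | exact hsub _ _ _ (h _ _ rfl) (h _ _ rfl)

end Families

/-- Directions along which the Jacobian matrix of `sixSix` at an integral point is diagonal. -/
def sixSixPt : Fin 12 → Fin 3 → Fin 5 → DualNumber ℤ :=
  let a : Fin 5 → ℤ := ![1, 0, 0, 0, -1]
  let b : Fin 5 → ℤ := ![1, 0, 0, 0, 1]
  let c : Fin 5 → ℤ := ![0, 0, 0, 1, 0]
  ![![dv a ![-2, 0, 0, -1, 2], dv b 0, dv c ![0, 0, 0, 1, 0]],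
    ![dv a ![2, 0, 0, 1, 2], dv b 0, dv c ![0, 0, 0, -1, 0]],
    ![dv a 0, dv b ![0, 1, 0, 0, 0], dv c ![0, 0, 0, 0, 4]],
    ![dv a ![2, 0, 0, -1, 2], dv b ![4, 0, 0, 0, 0], dv c ![0, 0, 0, -1, 0]],
    ![dv a 0, dv b ![0, -1, 0, 0, 0], dv c 0],
    ![dv a 0, dv b 0, dv c ![0, -1, 0, 0, 0]],
    ![dv a ![0, 0, -2, -1, 0], dv b 0, dv c 0],
    ![dv a ![0, 0, 0, -1, 0], dv b ![0, 0, 2, 1, 0], dv c ![0, 0, 0, 1, 0]],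
    ![dv a 0, dv b ![0, -1, 0, 0, 0], dv c ![-2, 0, 0, 0, -2]],
    ![dv a ![0, 0, 0, -1, 0], dv b ![0, 0, 0, 1, 0], dv c ![0, 0, 0, 1, 0]],
    ![dv a ![0, 0, 0, -1, 0], dv b 0, dv c ![0, 0, 0, 1, 0]],
    ![dv a ![0, 0, 0, -1, 0], dv b 0, dv c 0]]

/-- Directions along which the Jacobian matrix of `fiveSeven` at an integral point is diagonal. -/
def fiveSevenPt : Fin 12 → Fin 3 → Fin 5 → DualNumber ℤ :=
  let a : Fin 5 → ℤ := ![0, -1, 0, 0, 0]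
  let b : Fin 5 → ℤ := ![0, 0, 0, 1, 0]
  let c : Fin 5 → ℤ := ![0, -1, 0, 0, 0]
  ![![dv a ![0, 0, 0, 2, 0], dv b ![0, -1, 0, 0, 0], dv c 0],
    ![dv a ![0, -1, 0, 0, 0], dv b 0, dv c 0],
    ![dv a ![0, 1, 0, 0, 0], dv b ![0, 0, 0, 1, 0], dv c 0],
    ![dv a 0, dv b ![0, -1, 0, 0, 0], dv c ![0, 0, 0, 2, 0]],
    ![dv a 0, dv b ![0, -1, 0, 0, 0], dv c 0],
    ![dv a ![-2, 0, 0, 0, -1], dv b 0, dv c ![-1, 0, 0, 0, 0]],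
    ![dv a 0, dv b ![0, 0, 0, 0, -2], dv c ![0, 0, 1, 0, 0]],
    ![dv a 0, dv b 0, dv c ![0, 0, -1, 0, 0]],
    ![dv a ![-1, 0, 0, 0, 0], dv b 0, dv c ![-2, 0, 0, 0, -1]],
    ![dv a 0, dv b ![-1, 0, 0, 0, 0], dv c 0],
    ![dv a ![-1, 0, 0, 0, 0], dv b 0, dv c 0],
    ![dv a 0, dv b 0, dv c ![-1, 0, 0, 0, 0]]]

lemma algebraicIndependent_sixSix : AlgebraicIndependent ℂ (sixSix trc) := by
  refine algebraicIndependent_of_diagonal sixSixPt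
    (Q := fun l => sixSix fun w => trw (fun i => mat (sixSixPt l i)) w) (fun l j => ?_)
    (by decide +kernel) (by decide +kernel) (by decide +kernel)
  rw [map_sixSix, ← RingHom.coe_coe, map_sixSix]
  simp only [RingHom.coe_coe, evalAt_dualCast]

lemma algebraicIndependent_fiveSeven : AlgebraicIndependent ℂ (fiveSeven trc) := by
  refine algebraicIndependent_of_diagonal fiveSevenPt
    (Q := fun l => fiveSeven fun w => trw (fun i => mat (fiveSevenPt l i)) w) (fun l j => ?_)
    (by decide +kernel) (by decide +kernel) (by decide +kernel)
  rw [map_fiveSeven, ← RingHom.coe_coe, map_fiveSeven]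
  simp only [RingHom.coe_coe, evalAt_dualCast]

lemma isHSOP_of {F : (List (Fin 3) → Coord) → Fin 12 → Coord} {d : Fin 12 → ℕ}
    {F' : (List (Fin 3) → ℂ) → Fin 12 → ℂ}
    (hmap : ∀ a j, eval (toPt a) (F trc j) = F' (fun w => trw (fun i => mat (a i)) w) j)
    (hmem : ∀ j, F trc j ∈ invariantRing ![4, 4, 4]) (hd : ∀ j, 0 < d j)
    (hhom : ∀ j, (F trc j).IsHomogeneous (d j)) (hind : AlgebraicIndependent ℂ (F trc))
    (hz : ∀ a : Fin 3 → Fin 5 → ℂ, (∀ j, F' (fun w => trw (fun i => mat (a i)) w) j = 0) →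
      (∀ i j, trw (fun i => mat (a i)) [i, j] = 0) ∧
        ∀ i j k, trw (fun i => mat (a i)) [i, j, k] = 0) :
    IsHSOP ![4, 4, 4] (F trc) d := by
  refine ⟨hmem, hd, hhom, hind, isIntegral_of_zeros hmem hhom hd fun a h j => ?_⟩
  obtain ⟨h2, h3⟩ := hz a fun j => by rw [← hmap, h]
  rw [eval_trc]
  exact trw_gword_eq_zero rfl h2 h3 j

lemma isHSOP_sixSix : IsHSOP ![4, 4, 4] (sixSix trc) ![2, 2, 2, 2, 2, 2, 3, 3, 3, 3, 3, 3] := by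
  refine isHSOP_of (F := sixSix) (F' := sixSix) (fun a j => ?_) (fun j => ?_) (by decide)
    (fun j => ?_) algebraicIndependent_sixSix fun a h => ?_
  · rw [map_sixSix]
    simp only [eval_trc]
  · exact sixSix_induction (p := fun _ x => x ∈ invariantRing ![4, 4, 4])
      (fun w _ _ => trc_mem_invariantRing w) (fun _ _ _ => sub_mem) (fun _ _ _ => add_mem) j
  · exact sixSix_induction (p := fun n x => MvPolynomial.IsHomogeneous x n)
      (fun w _ hw => hw ▸ trc_isHomogeneous w) (fun _ _ _ => IsHomogeneous.sub)
      (fun _ _ _ => IsHomogeneous.add) j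
  · have h2 := trw_two_eq_zero (h 0) (h 1) (h 2) (h 3) (h 4) (h 5)
    exact ⟨h2, zeros_of_six_six rfl h2 (h 6) (h 7) (h 8) (sub_eq_zero.mp (h 9))
      (sub_eq_zero.mp (h 10)) (h 11)⟩

lemma isHSOP_fiveSeven :
    IsHSOP ![4, 4, 4] (fiveSeven trc) ![2, 2, 2, 2, 2, 3, 3, 3, 3, 3, 3, 3] := by
  refine isHSOP_of (F := fiveSeven) (F' := fiveSeven) (fun a j => ?_) (fun j => ?_) (by decide)
    (fun j => ?_) algebraicIndependent_fiveSeven fun a h => ?_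
  · rw [map_fiveSeven]
    simp only [eval_trc]
  · exact fiveSeven_induction (p := fun _ x => x ∈ invariantRing ![4, 4, 4])
      (fun w _ _ => trc_mem_invariantRing w) (fun _ _ _ => sub_mem) j
  · exact fiveSeven_induction (p := fun n x => MvPolynomial.IsHomogeneous x n)
      (fun w _ hw => hw ▸ trc_isHomogeneous w) (fun _ _ _ => IsHomogeneous.sub) j
  · exact zeros_of_five_seven rfl (h 0) (h 1) (h 2) (h 3) (sub_eq_zero.mp (h 4)) (h 5) (h 6) (h 7)
      (h 8) (h 9) (sub_eq_zero.mp (h 10)) (sub_eq_zero.mp (h 11))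

lemma length_gword : ∀ j, (gword j).length = (![2, 2, 2, 2, 2, 2, 3, 3, 3, 3, 3, 3, 3, 3, 3, 3,
    4, 4, 4, 4, 4, 4, 5, 5, 5] : Fin 25 → ℕ) j := by
  decide

end ThreeQuartics

end

open BinInv in
/-- For `V = 3V₄`: there are homogeneous systems of parameters with 6 invariants of
degree 2 and 6 of degree 3, and also with 5 invariants of degree 2 and 7 of degree 3;
the minimal number of generators is `25`, with degrees
`2 (×6), 3 (×10), 4 (×6), 5 (×3)`. -/
theorem threeV4_hsop_and_generators :
    (∃ P : Fin 12 → MvPolynomial (Idx ![4, 4, 4]) ℂ,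
      IsHSOP ![4, 4, 4] P ![2, 2, 2, 2, 2, 2, 3, 3, 3, 3, 3, 3]) ∧
    (∃ P : Fin 12 → MvPolynomial (Idx ![4, 4, 4]) ℂ,
      IsHSOP ![4, 4, 4] P ![2, 2, 2, 2, 2, 3, 3, 3, 3, 3, 3, 3]) ∧
    HasMinimalGens ![4, 4, 4]
      ![2, 2, 2, 2, 2, 2, 3, 3, 3, 3, 3, 3, 3, 3, 3, 3,
        4, 4, 4, 4, 4, 4, 5, 5, 5] := by
  refine ⟨⟨_, ThreeQuartics.isHSOP_sixSix⟩, ⟨_, ThreeQuartics.isHSOP_fiveSeven⟩,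
    ThreeQuartics.isMinimalNumGens, fun j => ThreeQuartics.trc (ThreeQuartics.gword j),
    ThreeQuartics.trc_gword_injective, fun j => ?_, ThreeQuartics.invariantRing_eq_gens.symm⟩
  exact ThreeQuartics.length_gword j ▸ ThreeQuartics.trc_isHomogeneous _
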